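/- arXiv:1901.06866 — 4 statements merged into one kernel-verified Lean document; each statement's English description precedes it below -/
import Mathlib

section
/- Let 𝒫 be a Beurling generalized prime system and ρ > 0. Suppose the sets {θ ∈ ℝ : ψ_𝒫(x) − x = O(x^θ)} and {θ ∈ ℝ : N_𝒫(x) − ρx = O(x^θ)} are nonempty with infima α and β satisfying α < β < 1. Then there exists a zero-free holomorphic function Z on {s ∈ ℂ : Re s > α} ∖ {1} agreeing with Σ_e (∏ᵢ pᵢ^{e i})^{−s} for Re s > 1, and for any such Z, for every σ with α < σ < β and every λ ∈ ℝ, neither Z(σ + it) = O(|t|^λ) nor 1/Z(σ + it) = O(|t|^λ) holds as |t| → ∞. -/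
open Filter Asymptotics

/-- ψ_𝒫(x): sum of log pᵢ over pairs (i,k) with k ≥ 1 and pᵢ^k ≤ x. -/
noncomputable def psiP (p : ℕ → ℝ) (x : ℝ) : ℝ :=
  ∑ᶠ ik ∈ {ik : ℕ × ℕ | 1 ≤ ik.2 ∧ p ik.1 ^ ik.2 ≤ x}, Real.log (p ik.1)

/-- N_𝒫(x): number of finitely supported e : ℕ → ℕ with ∏ pᵢ^{e i} ≤ x. -/
noncomputable def NP (p : ℕ → ℝ) (x : ℝ) : ℕ :=
  Nat.card {e : ℕ →₀ ℕ | ∏ i ∈ e.support, p i ^ e i ≤ x}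

/-- The statement that Z agrees with the Beurling zeta series Σ_e (∏ pᵢ^{e i})^{-s}
for Re s > 1, in the sense that the series sums to Z s there. -/
def AgreesWithZeta (p : ℕ → ℝ) (Z : ℂ → ℂ) : Prop :=
  ∀ s : ℂ, 1 < s.re →
    HasSum (fun e : ℕ →₀ ℕ => ((∏ i ∈ e.support, p i ^ e i : ℝ) : ℂ) ^ (-s)) (Z s)


theorem bz_primitive (α : ℝ) (f : ℂ → ℂ) (hf : DifferentiableOn ℂ f {s : ℂ | α < s.re}) :
    ∃ g : ℂ → ℂ, ∀ s : ℂ, α < s.re → HasDerivAt g (f s) s := by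
  have hopen : IsOpen {s : ℂ | α < s.re} := isOpen_lt continuous_const Complex.continuous_re
  set φ : ℂ → ℂ := fun w => α + (1 + w) / (1 - w) with hφ
  have hne : ∀ w ∈ Metric.ball (0 : ℂ) 1, (1 : ℂ) - w ≠ 0 := by
    intro w hw h
    have : w = 1 := by linear_combination -h
    rw [this] at hw; simp at hw
  have hmaps : ∀ w ∈ Metric.ball (0 : ℂ) 1, α < (φ w).re := by
    intro w hw
    have h1 := hne w hw
    have h2 : 0 < Complex.normSq (1 - w) := Complex.normSq_pos.mpr h1
    have h3 : ‖w‖ < 1 := by simpa using hw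
    have h4 : Complex.normSq w < 1 := by
      rw [Complex.normSq_eq_norm_sq]; nlinarith [norm_nonneg w]
    simp only [hφ, Complex.add_re, Complex.ofReal_re, Complex.div_re]
    have : 0 < (1 + w).re * (1 - w).re / Complex.normSq (1 - w) +
        (1 + w).im * (1 - w).im / Complex.normSq (1 - w) := by
      rw [← add_div]
      apply div_pos _ h2
      simp [Complex.normSq_apply] at h4 ⊢
      nlinarith
    simp at this ⊢
    exact this
  have hd : DifferentiableOn ℂ (fun w => f (φ w) * (2 / (1 - w) ^ 2)) (Metric.ball (0 : ℂ) 1) := by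
    intro w hw
    have h1 := hne w hw
    have hφd : DifferentiableAt ℂ φ w := by
      simp only [hφ]
      exact (differentiableAt_const _).add
        (((differentiableAt_const _).add differentiableAt_id).div
          ((differentiableAt_const _).sub differentiableAt_id) h1)
    have hfd : DifferentiableAt ℂ f (φ w) :=
      hf.differentiableAt (hopen.mem_nhds (hmaps w hw))
    refine ((hfd.comp w hφd).mul ?_).differentiableWithinAt
    exact (differentiableAt_const _).div
      (((differentiableAt_const _).sub differentiableAt_id).pow 2) (pow_ne_zero 2 h1)
  obtain ⟨g, hg⟩ := hd.isExactOn_ball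
  refine ⟨fun s => g ((s - α - 1) / (s - α + 1)), fun s hs => ?_⟩
  have hs1 : s - α + 1 ≠ 0 := by
    intro h
    have := congrArg Complex.re h
    simp at this; linarith
  have hball : (s - α - 1) / (s - α + 1) ∈ Metric.ball (0 : ℂ) 1 := by
    simp only [Metric.mem_ball, dist_zero_right, norm_div]
    rw [div_lt_one (norm_pos_iff.mpr hs1)]
    rw [← sq_lt_sq₀ (norm_nonneg _) (norm_nonneg _), ← Complex.normSq_eq_norm_sq,
      ← Complex.normSq_eq_norm_sq]
    simp [Complex.normSq_apply]
    nlinarith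
  have h1 := hg _ hball
  have hψ : HasDerivAt (fun s : ℂ => (s - α - 1) / (s - α + 1)) (2 / (s - α + 1) ^ 2) s := by
    have := (((hasDerivAt_id s).sub_const (α : ℂ)).sub_const 1).div
      (((hasDerivAt_id s).sub_const (α : ℂ)).add_const 1) hs1
    refine this.congr_deriv ?_
    simp only [id]; ring
  have h2 := HasDerivAt.comp s h1 hψ
  refine h2.congr_deriv ?_
  have e1 : 1 - (s - α - 1) / (s - α + 1) = 2 / (s - α + 1) := by field_simp; ring
  have e2 : φ ((s - α - 1) / (s - α + 1)) = s := by
    simp only [hφ, e1]; field_simp; ring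
  simp only [e2, e1]; field_simp

theorem bz_half_le (s : ℂ) (hs : 0 ≤ s.re) : (1 + |s.im|) / 2 ≤ ‖s + 1‖ := by
  have h1 : (s + 1).re ≤ ‖s + 1‖ := Complex.re_le_norm _
  have h2 : |(s + 1).im| ≤ ‖s + 1‖ := Complex.abs_im_le_norm _
  simp at h1 h2
  linarith

theorem bz_stepPL (W : ℂ → ℂ) (a0 a b : ℝ) (ha0 : a0 < a) (ha : 0 ≤ a) (hab : a < b)
    (hW : DifferentiableOn ℂ W {s : ℂ | a0 < s.re})
    (C1 : ℝ) (hC1 : 0 ≤ C1)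
    (hpoly : ∀ s : ℂ, a ≤ s.re → s.re ≤ b → ‖W s‖ ≤ C1 * (1 + |s.im|) ^ 2)
    (C2 M : ℝ) (hleft : ∀ s : ℂ, s.re = a → (W s).re ≤ C2 + M * Real.log (1 + |s.im|))
    (C3 : ℝ) (hright : ∀ s : ℂ, s.re = b → (W s).re ≤ C3) :
    ∃ C M' : ℝ, 0 < C ∧ 0 ≤ M' ∧ ∀ s : ℂ, a ≤ s.re → s.re ≤ b →
      (W s).re ≤ C + M' * Real.log (1 + |s.im|) := by
  obtain ⟨m, hm⟩ := exists_nat_ge M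
  set F : ℂ → ℂ := fun s => Complex.exp (W s) / (s + 1) ^ m with hF
  have hlog : ∀ s : ℂ, 0 ≤ Real.log (1 + |s.im|) := fun s =>
    Real.log_nonneg (by linarith [abs_nonneg s.im])
  have hnorm : ∀ s : ℂ, ‖F s‖ = Real.exp (W s).re / ‖s + 1‖ ^ m := by
    intro s; simp [hF, Complex.norm_exp]
  have hge1 : ∀ s : ℂ, a ≤ s.re → 1 ≤ ‖s + 1‖ := by
    intro s hs
    have h1 : (s + 1).re ≤ ‖s + 1‖ := Complex.re_le_norm _
    simp at h1; linarith
  have hdF : DifferentiableOn ℂ F {s : ℂ | a0 < s.re ∧ -1 < s.re} := by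
    intro s hs
    have hs1 : s + 1 ≠ 0 := by
      intro h
      have := congrArg Complex.re h
      simp at this; linarith [hs.2]
    refine DifferentiableWithinAt.div ?_ ?_ (pow_ne_zero _ hs1)
    · exact (hW.mono (fun z hz => hz.1) s hs).cexp
    · fun_prop
  set C4 : ℝ := Real.exp C2 * 2 ^ m + Real.exp C3 with hC4
  have key : ∀ s : ℂ, a ≤ s.re → s.re ≤ b → ‖F s‖ ≤ C4 := by
    intro s hs1 hs2
    refine PhragmenLindelof.vertical_strip (a := a) (b := b) (f := F) ?_ ?_ ?_ ?_ hs1 hs2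
    · apply DifferentiableOn.diffContOnCl
      apply hdF.mono
      intro z hz
      have : z ∈ Complex.re ⁻¹' Set.Icc a b := by
        refine closure_minimal ?_ (isClosed_Icc.preimage Complex.continuous_re) hz
        exact Set.preimage_mono Set.Ioo_subset_Icc_self
      simp at this
      simp; constructor <;> linarith
    · set c := Real.pi / (b - a) / 2 with hc
      have hcpos : 0 < c := by
        have := Real.pi_pos
        have : 0 < b - a := by linarith
        positivity
      refine ⟨c, ?_, C1 * (1 + 2 / c) ^ 2, ?_⟩
      · rw [hc]; exact half_lt_self (div_pos Real.pi_pos (by linarith))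
      · apply IsBigO.of_bound 1
        rw [eventually_inf_principal]
        refine Eventually.of_forall fun z hz => ?_
        simp at hz
        rw [hnorm, one_mul, Real.norm_of_nonneg (Real.exp_nonneg _)]
        have h1 : Real.exp (W z).re / ‖z + 1‖ ^ m ≤ Real.exp (W z).re := by
          apply div_le_self (Real.exp_nonneg _)
          exact one_le_pow₀ (hge1 z hz.1.le)
        refine h1.trans (Real.exp_le_exp.mpr ?_)
        have h2 := hpoly z hz.1.le hz.2.le
        have h3 := Complex.re_le_norm (W z)
        have h4 : 1 + |z.im| ≤ (1 + 2 / c) * (1 + c * |z.im| / 2) := by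
          have : (1 + 2 / c) * (1 + c * |z.im| / 2) = 1 + |z.im| + 2 / c + c * |z.im| / 2 := by
            field_simp; ring
          rw [this]
          have : 0 ≤ 2 / c := by positivity
          have : 0 ≤ c * |z.im| / 2 := by positivity
          linarith
        have h5 : (1 + c * |z.im| / 2) ^ 2 ≤ Real.exp (c * |z.im|) := by
          have : Real.exp (c * |z.im|) = Real.exp (c * |z.im| / 2) ^ 2 := by
            rw [← Real.exp_nat_mul]; congr 1; push_cast; ring
          rw [this]
          apply pow_le_pow_left₀ (by positivity)
          linarith [Real.add_one_le_exp (c * |z.im| / 2)]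
        have h6 : (1 + |z.im|) ^ 2 ≤ (1 + 2 / c) ^ 2 * Real.exp (c * |z.im|) := by
          calc (1 + |z.im|) ^ 2 ≤ ((1 + 2 / c) * (1 + c * |z.im| / 2)) ^ 2 :=
                pow_le_pow_left₀ (by positivity) h4 2
            _ = (1 + 2 / c) ^ 2 * (1 + c * |z.im| / 2) ^ 2 := by ring
            _ ≤ _ := by gcongr
        calc (W z).re ≤ C1 * (1 + |z.im|) ^ 2 := h3.trans h2
          _ ≤ C1 * ((1 + 2 / c) ^ 2 * Real.exp (c * |z.im|)) := by gcongr
          _ = _ := by ring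
    · intro z hz
      rw [hnorm]
      have h1 := hleft z hz
      have h2 : (W z).re ≤ C2 + m * Real.log (1 + |z.im|) := by
        have := mul_le_mul_of_nonneg_right hm (hlog z)
        linarith
      have h3 : Real.exp (W z).re ≤ Real.exp C2 * (1 + |z.im|) ^ m := by
        refine (Real.exp_le_exp.mpr h2).trans ?_
        rw [Real.exp_add, Real.exp_nat_mul, Real.exp_log (by positivity)]
      have h4 : ((1 + |z.im|) / 2) ^ m ≤ ‖z + 1‖ ^ m :=
        pow_le_pow_left₀ (by positivity) (bz_half_le z (by linarith)) m
      have h5 : Real.exp (W z).re / ‖z + 1‖ ^ m ≤ Real.exp C2 * 2 ^ m := by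
        rw [div_le_iff₀ (pow_pos (lt_of_lt_of_le one_pos (hge1 z hz.ge)) m)]
        calc _ ≤ Real.exp C2 * (1 + |z.im|) ^ m := h3
          _ = Real.exp C2 * 2 ^ m * ((1 + |z.im|) / 2) ^ m := by
            rw [div_pow]; field_simp
          _ ≤ _ := by gcongr
      linarith [Real.exp_pos C3]
    · intro z hz
      rw [hnorm]
      have h1 : Real.exp (W z).re / ‖z + 1‖ ^ m ≤ Real.exp (W z).re := by
        apply div_le_self (Real.exp_nonneg _)
        exact one_le_pow₀ (hge1 z (by linarith))
      have h2 := Real.exp_le_exp.mpr (hright z hz)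
      have : 0 < Real.exp C2 * 2 ^ m := by positivity
      linarith
  have hC4pos : 0 < C4 := by positivity
  refine ⟨|Real.log C4| + m * |Real.log (b + 1)| + 1, m, by positivity, by positivity, fun s h1 h2 => ?_⟩
  have h3 := key s h1 h2
  have hp : 0 < ‖s + 1‖ := lt_of_lt_of_le one_pos (hge1 s h1)
  rw [hnorm, div_le_iff₀ (pow_pos hp m)] at h3
  have h4 : (W s).re ≤ Real.log C4 + m * Real.log ‖s + 1‖ := by
    have := Real.log_le_log (Real.exp_pos _) h3
    rwa [Real.log_exp, Real.log_mul hC4pos.ne' (pow_pos hp m).ne', Real.log_pow] at this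
  have h5 : ‖s + 1‖ ≤ (b + 1) * (1 + |s.im|) := by
    have h := Complex.norm_le_abs_re_add_abs_im (s + 1)
    simp at h
    rw [abs_of_nonneg (by linarith : 0 ≤ s.re + 1)] at h
    nlinarith [abs_nonneg s.im]
  have h6 : Real.log ‖s + 1‖ ≤ Real.log (b + 1) + Real.log (1 + |s.im|) := by
    rw [← Real.log_mul (by linarith) (by positivity)]
    exact Real.log_le_log hp h5
  have h7 : (m : ℝ) * Real.log ‖s + 1‖ ≤ m * (|Real.log (b + 1)| + Real.log (1 + |s.im|)) := by
    apply mul_le_mul_of_nonneg_left _ (by positivity)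
    linarith [le_abs_self (Real.log (b + 1))]
  linarith [le_abs_self (Real.log C4)]


theorem bz_log_shift (t T : ℝ) :
    Real.log (1 + |t|) ≤ Real.log (1 + |T|) + |t - T| := by
  have h1 : 1 + |t| ≤ (1 + |T|) * (1 + |t - T|) := by
    have := abs_add_le T (t - T)
    rw [add_sub_cancel] at this
    nlinarith [abs_nonneg T, abs_nonneg (t - T)]
  have h2 := Real.log_le_log (by positivity) h1
  rw [Real.log_mul (by positivity) (by positivity)] at h2
  have h3 := Real.log_le_sub_one_of_pos (show 0 < 1 + |t - T| by positivity)
  linarith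

theorem bz_BC (W : ℂ → ℂ) (a0 a σ1 : ℝ) (ha0 : a0 < a) (ha : 0 ≤ a) (haσ : a < σ1) (hσ2 : σ1 < 2)
    (hW : DifferentiableOn ℂ W {s : ℂ | a0 < s.re})
    (C M : ℝ) (hC : 0 < C) (hM : 0 ≤ M)
    (hre : ∀ s : ℂ, a ≤ s.re → s.re ≤ 4 → (W s).re ≤ C + M * Real.log (1 + |s.im|))
    (C3 : ℝ) (hC3 : 0 ≤ C3) (hbd : ∀ s : ℂ, 2 ≤ s.re → ‖W s‖ ≤ C3) :
    ∃ K : ℝ, 0 < K ∧ ∀ s : ℂ, σ1 ≤ s.re → s.re ≤ 2 →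
      ‖W s‖ ≤ K * (1 + Real.log (1 + |s.im|)) := by
  set D := σ1 - a with hD
  have hDpos : 0 < D := by rw [hD]; linarith
  refine ⟨(4 * (C + 2 * M + M) + 4 * C3) / D, by positivity, fun s h1 h2 => ?_⟩
  have hlog : 0 ≤ Real.log (1 + |s.im|) := Real.log_nonneg (by linarith [abs_nonneg s.im])
  set Λ := Real.log (1 + |s.im|) with hΛ
  set f : ℂ → ℂ := fun z => W (2 + s.im * Complex.I + z) with hf
  have hopen : IsOpen {s : ℂ | a0 < s.re} := isOpen_lt continuous_const Complex.continuous_re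
  have hin : ∀ z ∈ Metric.ball (0 : ℂ) (2 - a), a < (2 + s.im * Complex.I + z).re ∧
      (2 + s.im * Complex.I + z).re < 4 ∧ |(2 + s.im * Complex.I + z).im - s.im| ≤ 2 := by
    intro z hz
    have hz' : ‖z‖ < 2 - a := by simpa using hz
    have h3 := (abs_le.mp (Complex.abs_re_le_norm z))
    have h4 := (Complex.abs_im_le_norm z)
    simp
    refine ⟨by linarith, by linarith, by linarith⟩
  have hfd : DifferentiableOn ℂ f (Metric.ball 0 (2 - a)) := by
    intro z hz
    apply DifferentiableAt.differentiableWithinAt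
    have : DifferentiableAt ℂ W (2 + s.im * Complex.I + z) :=
      hW.differentiableAt (hopen.mem_nhds (lt_trans ha0 (hin z hz).1))
    exact this.comp z (by fun_prop)
  have hmaps : Set.MapsTo f (Metric.ball 0 (2 - a)) {z | z.re ≤ C + 2 * M + M * Λ} := by
    intro z hz
    obtain ⟨h3, h4, h5⟩ := hin z hz
    have h6 := hre _ h3.le h4.le
    have h7 := bz_log_shift (2 + s.im * Complex.I + z).im s.im
    have h8 : M * Real.log (1 + |(2 + s.im * Complex.I + z).im|) ≤ M * (Λ + 2) := by
      apply mul_le_mul_of_nonneg_left _ hM; linarith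
    show (W (2 + s.im * Complex.I + z)).re ≤ _
    linarith
  have hz : ((s.re - 2 : ℝ) : ℂ) ∈ Metric.ball (0 : ℂ) (2 - a) := by
    simp only [Metric.mem_ball, dist_zero_right, Complex.norm_real, Real.norm_eq_abs]
    rw [abs_lt]; constructor <;> linarith
  have hnz : ‖((s.re - 2 : ℝ) : ℂ)‖ = 2 - s.re := by
    simp only [Complex.norm_real, Real.norm_eq_abs]
    rw [abs_of_nonpos (by linarith)]; ring
  have h3 := Complex.borelCaratheodory (M := C + 2 * M + M * Λ) (by positivity) hfd hmaps
    (by linarith) hz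
  have e1 : f ((s.re - 2 : ℝ) : ℂ) = W s := by
    simp only [hf]; congr 1
    apply Complex.ext <;> simp
  have e2 : ‖f 0‖ ≤ C3 := by
    simp only [hf]; apply hbd; simp
  rw [e1, hnz] at h3
  refine h3.trans ?_
  rw [← add_div, div_mul_eq_mul_div]
  apply div_le_div₀ (by positivity) _ hDpos (by linarith)
  have hml : 0 ≤ M * Λ := by positivity
  have i1 : 2 * (C + 2 * M + M * Λ) * (2 - s.re) ≤ 2 * (C + 2 * M + M * Λ) * 2 := by
    apply mul_le_mul_of_nonneg_left _ (by positivity); linarith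
  have i2 : ‖f 0‖ * (2 - a + (2 - s.re)) ≤ C3 * 4 := by
    apply mul_le_mul e2 (by linarith) (by linarith) hC3
  nlinarith [mul_nonneg hC.le hlog, mul_nonneg hC3 hlog]

theorem bz_rpow_le (κ η : ℝ) (hκ0 : 0 ≤ κ) (hκ : κ < 1) (hη : 0 < η) :
    ∃ C : ℝ, 0 ≤ C ∧ ∀ y : ℝ, 1 ≤ y → y ^ κ ≤ C + η * y := by
  set Y := η ^ (1 / (κ - 1)) with hY
  have hYp : 0 < Y := Real.rpow_pos_of_pos hη _
  refine ⟨Y ^ κ, (Real.rpow_pos_of_pos hYp _).le, fun y hy => ?_⟩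
  have hy0 : 0 < y := by linarith
  rcases le_total y Y with h | h
  · have := Real.rpow_le_rpow hy0.le h hκ0
    have : 0 < η * y := by positivity
    linarith
  · have e : y ^ κ = y ^ (κ - 1) * y := by
      rw [← Real.rpow_add_one hy0.ne']; congr 1; ring
    have h1 : y ^ (κ - 1) ≤ Y ^ (κ - 1) := Real.rpow_le_rpow_of_nonpos hYp h (by linarith)
    have h2 : Y ^ (κ - 1) = η := by
      rw [hY, ← Real.rpow_mul hη.le, one_div, inv_mul_cancel₀ (by linarith), Real.rpow_one]
    rw [e]
    have : 0 < Y ^ κ := Real.rpow_pos_of_pos hYp _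
    rw [h2] at h1
    nlinarith

theorem bz_three (W : ℂ → ℂ) (a0 σ1 σ2 : ℝ) (ha0 : a0 < σ1) (ha : 0 ≤ σ1) (h12 : σ1 < σ2)
    (hσ2 : σ2 < 2) (hW : DifferentiableOn ℂ W {s : ℂ | a0 < s.re})
    (K : ℝ) (hK : 0 < K)
    (hbound : ∀ s : ℂ, σ1 ≤ s.re → s.re ≤ 2 → ‖W s‖ ≤ K * (1 + Real.log (1 + |s.im|)))
    (C3 : ℝ) (hC3 : 0 ≤ C3) (hbd : ∀ s : ℂ, 2 ≤ s.re → ‖W s‖ ≤ C3) (η : ℝ) (hη : 0 < η) :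
    ∃ C : ℝ, 0 ≤ C ∧ ∀ s : ℂ, σ2 ≤ s.re → s.re ≤ 2 → ‖W s‖ ≤ C + η * Real.log (1 + |s.im|) := by
  set κ := (2 - σ2) / (2 - σ1) with hκ
  have hκ0 : 0 ≤ κ := div_nonneg (by linarith) (by linarith)
  have hκ1 : κ < 1 := by rw [hκ, div_lt_one (by linarith)]; linarith
  set B := (C3 + 1) * Real.exp 4 with hB
  set A := 2 * (K + 1) * Real.exp 4 with hA
  have he4 : 1 ≤ Real.exp 4 := Real.one_le_exp (by norm_num)
  have hB1 : 1 ≤ B := by rw [hB]; nlinarith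
  have hA1 : 1 ≤ A := by rw [hA]; nlinarith
  obtain ⟨C, hC0, hC⟩ := bz_rpow_le κ (η / (A * B)) hκ0 hκ1 (by positivity)
  refine ⟨B * C + η, by positivity, fun s h1 h2 => ?_⟩
  set T := s.im with hT
  set Λ := Real.log (1 + |T|) with hΛ
  have hlog : 0 ≤ Λ := Real.log_nonneg (by linarith [abs_nonneg T])
  set g : ℂ → ℂ := fun z => W z * Complex.exp ((z - T * Complex.I) ^ 2) with hg
  have hge : ∀ z : ℂ, ‖Complex.exp ((z - T * Complex.I) ^ 2)‖ =
      Real.exp (z.re ^ 2) * Real.exp (-(z.im - T) ^ 2) := by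
    intro z
    rw [Complex.norm_exp, ← Real.exp_add]
    congr 1
    simp [pow_two]; ring
  have hge4 : ∀ z : ℂ, σ1 ≤ z.re → z.re ≤ 2 → Real.exp (z.re ^ 2) ≤ Real.exp 4 := by
    intro z hz1 hz2
    apply Real.exp_le_exp.mpr; nlinarith
  have hgb : ∀ z : ℂ, σ1 ≤ z.re → z.re ≤ 2 → ‖g z‖ ≤ A * (1 + Λ) := by
    intro z hz1 hz2
    simp only [hg]
    rw [norm_mul, hge]
    set u := |z.im - T| with hu
    have hu2 : (z.im - T) ^ 2 = u ^ 2 := by rw [hu, sq_abs]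
    have hu0 : 0 ≤ u := abs_nonneg _
    have i1 : ‖W z‖ ≤ K * (1 + Λ + u) := by
      refine (hbound z hz1 hz2).trans ?_
      apply mul_le_mul_of_nonneg_left _ hK.le
      have := bz_log_shift z.im T
      linarith
    have i2 : (1 + Λ + u) * Real.exp (-(z.im - T) ^ 2) ≤ 2 * (1 + Λ) := by
      rw [hu2, Real.exp_neg, ← div_eq_mul_inv, div_le_iff₀ (Real.exp_pos _)]
      have := Real.add_one_le_exp (u ^ 2)
      nlinarith [sq_nonneg (u - 1)]
    calc ‖W z‖ * (Real.exp (z.re ^ 2) * Real.exp (-(z.im - T) ^ 2))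
        ≤ K * (1 + Λ + u) * (Real.exp 4 * Real.exp (-(z.im - T) ^ 2)) := by
          gcongr
          nlinarith
      _ = K * Real.exp 4 * ((1 + Λ + u) * Real.exp (-(z.im - T) ^ 2)) := by ring
      _ ≤ K * Real.exp 4 * (2 * (1 + Λ)) := by gcongr
      _ ≤ A * (1 + Λ) := by
        rw [hA]
        have : 0 ≤ Real.exp 4 * (1 + Λ) := by positivity
        nlinarith
  have hgr : ∀ z : ℂ, z.re = 2 → ‖g z‖ ≤ B := by
    intro z hz
    simp only [hg]
    rw [norm_mul, hge]
    have i1 := hbd z hz.ge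
    have i2 : Real.exp (-(z.im - T) ^ 2) ≤ 1 := Real.exp_le_one_iff.mpr (by nlinarith [sq_nonneg (z.im - T)])
    have i3 := hge4 z (by linarith) hz.le
    calc ‖W z‖ * (Real.exp (z.re ^ 2) * Real.exp (-(z.im - T) ^ 2))
        ≤ (C3 + 1) * (Real.exp 4 * 1) := by gcongr; linarith
      _ = B := by rw [hB]; ring
  have hmain := Complex.HadamardThreeLines.norm_le_interp_of_mem_verticalClosedStrip' (f := g)
    (z := s) (l := σ1) (u := 2) (a := A * (1 + Λ)) (b := B) (by linarith)
    (by simp [Complex.HadamardThreeLines.verticalClosedStrip]; constructor <;> linarith) 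
    (by
      apply DifferentiableOn.diffContOnCl
      have : DifferentiableOn ℂ g {s : ℂ | a0 < s.re} := hW.mul (by fun_prop)
      apply this.mono
      intro z hz
      have : z ∈ Complex.re ⁻¹' Set.Icc σ1 2 := by
        refine closure_minimal ?_ (isClosed_Icc.preimage Complex.continuous_re) hz
        exact Set.preimage_mono Set.Ioo_subset_Icc_self
      simp at this
      simp; linarith)
    (by
      refine ⟨A * (1 + Λ), ?_⟩
      rintro _ ⟨z, hz, rfl⟩
      simp [Complex.HadamardThreeLines.verticalClosedStrip] at hz
      exact hgb z hz.1 hz.2)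
    (by intro z hz; simp at hz; exact hgb z hz.ge (by linarith))
    (by intro z hz; simp at hz; exact hgr z hz)
  have hWg : ‖W s‖ ≤ ‖g s‖ := by
    simp only [hg]
    rw [norm_mul, hge]
    apply le_mul_of_one_le_right (norm_nonneg _)
    rw [← hT]; simp
    positivity
  have hAL : 1 ≤ A * (1 + Λ) := by nlinarith
  have j1 : (A * (1 + Λ)) ^ (1 - (s.re - σ1) / (2 - σ1)) ≤ (A * (1 + Λ)) ^ κ := by
    apply Real.rpow_le_rpow_of_exponent_le hAL
    rw [hκ, one_sub_div (by linarith)]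
    apply div_le_div_of_nonneg_right _ (by linarith)
    linarith
  have j2 : B ^ ((s.re - σ1) / (2 - σ1)) ≤ B := by
    conv_rhs => rw [← Real.rpow_one B]
    apply Real.rpow_le_rpow_of_exponent_le hB1
    rw [div_le_one (by linarith)]; linarith
  have j3 := hC _ hAL
  calc ‖W s‖ ≤ _ := hWg.trans hmain
    _ ≤ (A * (1 + Λ)) ^ κ * B := by gcongr
    _ ≤ (C + η / (A * B) * (A * (1 + Λ))) * B := by gcongr
    _ = B * C + η + η * Λ := by field_simp; ring

/-- From one-sided control on a vertical line to `o(log)` control of the logarithm. -/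
theorem bz_lemmaA (W : ℂ → ℂ) (a0 a σ2 : ℝ) (ha0 : a0 < a) (ha : 0 ≤ a) (haσ : a < σ2)
    (hσ2 : σ2 < 2)
    (hW : DifferentiableOn ℂ W {s : ℂ | a0 < s.re})
    (C1 : ℝ) (hC1 : 0 ≤ C1)
    (hpoly : ∀ s : ℂ, a ≤ s.re → s.re ≤ 4 → ‖W s‖ ≤ C1 * (1 + |s.im|) ^ 2)
    (C2 M : ℝ) (hleft : ∀ s : ℂ, s.re = a → (W s).re ≤ C2 + M * Real.log (1 + |s.im|))
    (C3 : ℝ) (hC3 : 0 ≤ C3) (hbd : ∀ s : ℂ, 2 ≤ s.re → ‖W s‖ ≤ C3) (η : ℝ) (hη : 0 < η) :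
    ∃ C : ℝ, 0 ≤ C ∧ ∀ s : ℂ, σ2 ≤ s.re → s.re ≤ 2 → ‖W s‖ ≤ C + η * Real.log (1 + |s.im|) := by
  obtain ⟨C, M', hC, hM', h1⟩ := bz_stepPL W a0 a 4 ha0 ha (by linarith) hW C1 hC1 hpoly C2 M hleft C3
    (fun s hs => (Complex.re_le_norm _).trans (hbd s (by linarith)))
  obtain ⟨K, hK, h2⟩ := bz_BC W a0 a ((a + σ2) / 2) ha0 ha (by linarith) (by linarith) hW C M' hC hM' h1
    C3 hC3 hbd
  exact bz_three W a0 ((a + σ2) / 2) σ2 (by linarith) (by linarith) (by linarith) hσ2 hW K hK h2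
    C3 hC3 hbd η hη


/-- Truncated Mellin transform. -/
noncomputable def bzM (R : ℝ → ℝ) (s : ℂ) : ℂ :=
  ∫ x in Set.Ici (1 : ℝ), (R x : ℂ) * (x : ℂ) ^ (-s - 1)

theorem bz_norm_cpow (x : ℝ) (hx : 0 < x) (s : ℂ) : ‖(x : ℂ) ^ (-s - 1)‖ = x ^ (-s.re - 1) := by
  rw [Complex.norm_cpow_eq_rpow_re_of_pos hx]; simp

theorem bz_integrableOn_rpow (n a : ℝ) (hn : 1 ≤ n) (ha : a < -1) :
    MeasureTheory.IntegrableOn (fun x : ℝ => x ^ a) (Set.Ici n) := by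
  rw [integrableOn_Ici_iff_integrableOn_Ioi]
  exact integrableOn_Ioi_rpow_of_lt ha (by linarith)

theorem bz_integral_rpow (n a : ℝ) (hn : 1 ≤ n) (ha : a < -1) :
    ∫ x in Set.Ici n, x ^ a = -n ^ (a + 1) / (a + 1) := by
  rw [MeasureTheory.integral_Ici_eq_integral_Ioi]
  exact integral_Ioi_rpow_of_lt ha (by linarith)

theorem bz_integrableOn_cpow (n : ℝ) (a : ℂ) (hn : 1 ≤ n) (ha : a.re < -1) :
    MeasureTheory.IntegrableOn (fun x : ℝ => (x : ℂ) ^ a) (Set.Ici n) := by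
  rw [integrableOn_Ici_iff_integrableOn_Ioi]
  exact integrableOn_Ioi_cpow_of_lt ha (by linarith)

theorem bz_integral_cpow (n : ℝ) (a : ℂ) (hn : 1 ≤ n) (ha : a.re < -1) :
    ∫ x in Set.Ici n, (x : ℂ) ^ a = -(n : ℂ) ^ (a + 1) / (a + 1) := by
  rw [MeasureTheory.integral_Ici_eq_integral_Ioi]
  exact integral_Ioi_cpow_of_lt ha (by linarith)

theorem bz_abel {ι : Type*} [Countable ι] (n w : ι → ℝ) (hn : ∀ j, 1 ≤ n j) (hw : ∀ j, 0 ≤ w j)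
    (A : ℝ → ℝ) (hA : ∀ x, HasSum (fun j => if n j ≤ x then w j else 0) (A x))
    (C : ℝ) (hC : ∀ x, 1 ≤ x → A x ≤ C * x) (s : ℂ) (hs : 1 < s.re) :
    Summable (fun j => w j * n j ^ (-s.re)) ∧
    HasSum (fun j => (w j : ℂ) * (n j : ℂ) ^ (-s)) (s * bzM A s) := by
  set F : ι → ℝ → ℂ := fun j x => ((if n j ≤ x then w j else 0 : ℝ) : ℂ) * (x : ℂ) ^ (-s - 1) with hF
  have hFi : ∀ j, F j = Set.indicator (Set.Ici (n j)) (fun x => (w j : ℂ) * (x : ℂ) ^ (-s - 1)) := by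
    intro j; ext x
    by_cases h : n j ≤ x <;> simp [hF, h]
  have hinter : ∀ j, Set.Ici 1 ∩ Set.Ici (n j) = Set.Ici (n j) := by
    intro j; rw [Set.Ici_inter_Ici, sup_eq_right.mpr (hn j)]
  have hre : (-s - 1).re < -1 := by simp; linarith
  have hFint : ∀ j, MeasureTheory.Integrable (F j) (MeasureTheory.volume.restrict (Set.Ici 1)) := by
    intro j
    rw [hFi, MeasureTheory.integrable_indicator_iff measurableSet_Ici, MeasureTheory.IntegrableOn,
      MeasureTheory.Measure.restrict_restrict measurableSet_Ici, Set.inter_comm, hinter]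
    exact (bz_integrableOn_cpow (n j) _ (hn j) hre).const_mul _
  have hFn : ∀ j, ∀ x ∈ Set.Ici (1 : ℝ), ‖F j x‖ =
      Set.indicator (Set.Ici (n j)) (fun x => w j * x ^ (-s.re - 1)) x := by
    intro j x hx
    have hx0 : (0 : ℝ) < x := lt_of_lt_of_le one_pos hx
    rw [hFi]
    by_cases h : n j ≤ x
    · simp only [Set.mem_Ici, h, Set.indicator_of_mem, norm_mul, bz_norm_cpow x hx0]
      simp [abs_of_nonneg (hw j)]
    · simp [h]
  have hFnint : ∀ j, ∫ x in Set.Ici 1, ‖F j x‖ = w j * n j ^ (-s.re) / s.re := by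
    intro j
    rw [MeasureTheory.setIntegral_congr_fun measurableSet_Ici (hFn j),
      MeasureTheory.setIntegral_indicator measurableSet_Ici, hinter,
      MeasureTheory.integral_const_mul, bz_integral_rpow (n j) _ (hn j) (by linarith)]
    rw [show -s.re - 1 + 1 = -s.re by ring, neg_div_neg_eq]; ring
  have hsum : Summable fun j => ∫ x in Set.Ici 1, ‖F j x‖ := by
    apply summable_of_sum_le (c := ∫ x in Set.Ici (1 : ℝ), C * x ^ (-s.re))
      (fun j => MeasureTheory.integral_nonneg fun x => norm_nonneg _)
    intro u
    rw [← MeasureTheory.integral_finsetSum _ (fun j _ => (hFint j).norm)]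
    apply MeasureTheory.setIntegral_mono_on
    · exact MeasureTheory.integrable_finsetSum _ (fun j _ => (hFint j).norm)
    · exact (bz_integrableOn_rpow 1 _ le_rfl (by linarith)).const_mul _
    · exact measurableSet_Ici
    · intro x hx
      have hx0 : (0 : ℝ) < x := lt_of_lt_of_le one_pos hx
      have h1 : ∑ i ∈ u, ‖F i x‖ = (∑ i ∈ u, if n i ≤ x then w i else 0) * x ^ (-s.re - 1) := by
        rw [Finset.sum_mul]
        apply Finset.sum_congr rfl
        intro j _
        rw [hFn j x hx]
        by_cases h : n j ≤ x <;> simp [h]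
      rw [h1]
      have h2 : (∑ i ∈ u, if n i ≤ x then w i else 0) ≤ C * x :=
        (sum_le_hasSum u (fun i _ => by split_ifs; exacts [hw i, le_rfl]) (hA x)).trans (hC x hx)
      calc _ ≤ C * x * x ^ (-s.re - 1) := by gcongr
        _ = C * x ^ (-s.re) := by
          rw [mul_assoc, mul_comm x, ← Real.rpow_add_one hx0.ne']; congr 2; ring
  constructor
  · have := hsum.mul_right s.re
    refine this.congr fun j => ?_
    rw [hFnint]; field_simp
  · have h1 := (MeasureTheory.hasSum_integral_of_summable_integral_norm hFint hsum).mul_left s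
    have h2 : ∫ x in Set.Ici (1 : ℝ), ∑' j, F j x = bzM A s := by
      apply MeasureTheory.integral_congr_ae
      refine Eventually.of_forall fun x => ?_
      have := (Complex.hasSum_ofReal.mpr (hA x)).mul_right ((x : ℂ) ^ (-s - 1))
      exact this.tsum_eq
    rw [h2] at h1
    have h3 : ∀ j, s * ∫ x in Set.Ici 1, F j x = (w j : ℂ) * (n j : ℂ) ^ (-s) := by
      intro j
      rw [hFi, MeasureTheory.setIntegral_indicator measurableSet_Ici, hinter,
        MeasureTheory.integral_const_mul, bz_integral_cpow (n j) _ (hn j) hre]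
      have : s ≠ 0 := by rintro rfl; simp at hs; linarith
      rw [show -s - 1 + 1 = -s by ring, neg_div_neg_eq]; field_simp
    simpa only [h3] using h1

theorem bz_M_integrable (R : ℝ → ℝ) (hR : Measurable R) (C θ : ℝ)
    (hb : ∀ x, 1 ≤ x → |R x| ≤ C * x ^ θ) (s : ℂ) (hs : θ < s.re) :
    MeasureTheory.IntegrableOn (fun x : ℝ => (R x : ℂ) * (x : ℂ) ^ (-s - 1)) (Set.Ici 1) := by
  have h1 := (bz_integrableOn_rpow 1 (θ - s.re - 1) le_rfl (by linarith)).const_mul C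
  refine MeasureTheory.Integrable.mono' h1 ?_ ?_
  · apply Measurable.aestronglyMeasurable
    fun_prop
  · rw [MeasureTheory.ae_restrict_iff' measurableSet_Ici]
    refine Eventually.of_forall fun x hx => ?_
    have hx0 : (0 : ℝ) < x := lt_of_lt_of_le one_pos hx
    rw [norm_mul, bz_norm_cpow x hx0, Complex.norm_real, Real.norm_eq_abs]
    calc _ ≤ C * x ^ θ * x ^ (-s.re - 1) := by gcongr; exact hb x hx
      _ = C * x ^ (θ - s.re - 1) := by
        rw [mul_assoc, ← Real.rpow_add hx0]; congr 2; ring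

theorem bz_M_bound (R : ℝ → ℝ) (C θ : ℝ)
    (hb : ∀ x, 1 ≤ x → |R x| ≤ C * x ^ θ) (s : ℂ) (hs : θ < s.re) :
    ‖bzM R s‖ ≤ C / (s.re - θ) := by
  have h1 := (bz_integrableOn_rpow 1 (θ - s.re - 1) le_rfl (by linarith)).const_mul C
  have h2 : ‖bzM R s‖ ≤ ∫ x in Set.Ici (1 : ℝ), C * x ^ (θ - s.re - 1) := by
    apply MeasureTheory.norm_integral_le_of_norm_le h1
    rw [MeasureTheory.ae_restrict_iff' measurableSet_Ici]
    refine Eventually.of_forall fun x hx => ?_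
    have hx0 : (0 : ℝ) < x := lt_of_lt_of_le one_pos hx
    rw [norm_mul, bz_norm_cpow x hx0, Complex.norm_real, Real.norm_eq_abs]
    calc _ ≤ C * x ^ θ * x ^ (-s.re - 1) := by gcongr; exact hb x hx
      _ = C * x ^ (θ - s.re - 1) := by
        rw [mul_assoc, ← Real.rpow_add hx0]; congr 2; ring
  refine h2.trans_eq ?_
  rw [MeasureTheory.integral_const_mul, bz_integral_rpow 1 _ le_rfl (by linarith), Real.one_rpow,
    show θ - s.re - 1 + 1 = -(s.re - θ) by ring, neg_div_neg_eq]
  ring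

theorem bz_M_eq_mellin (R : ℝ → ℝ) (s : ℂ) :
    bzM R s = mellin (Set.indicator (Set.Ici 1) (fun x => (R x : ℂ))) (-s) := by
  have : (fun x : ℝ => (x : ℂ) ^ (-s - 1) • (Set.indicator (Set.Ici 1) (fun x => (R x : ℂ))) x) =
      Set.indicator (Set.Ici 1) (fun x : ℝ => (R x : ℂ) * (x : ℂ) ^ (-s - 1)) := by
    ext x
    by_cases h : 1 ≤ x
    · simp [h, mul_comm]
    · simp [h]
  rw [mellin, this, MeasureTheory.setIntegral_indicator measurableSet_Ici, bzM]
  congr 2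
  ext x; simp; intro h; linarith

theorem bz_M_diff (R : ℝ → ℝ) (hR : Measurable R) (C θ : ℝ)
    (hb : ∀ x, 1 ≤ x → |R x| ≤ C * x ^ θ) (s : ℂ) (hs : θ < s.re) :
    DifferentiableAt ℂ (bzM R) s := by
  have hfun : bzM R = (mellin (Set.indicator (Set.Ici 1) (fun x => (R x : ℂ)))) ∘ (fun s => -s) := by
    ext s; exact bz_M_eq_mellin R s
  rw [hfun]
  refine DifferentiableAt.comp s ?_ (by fun_prop)
  apply mellin_differentiableAt_of_isBigO_rpow (a := -θ) (b := -s.re - 1)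
  · have hmeas : Measurable (Set.indicator (Set.Ici 1) (fun x => (R x : ℂ))) :=
      Measurable.indicator (by fun_prop) measurableSet_Ici
    apply MeasureTheory.LocallyIntegrable.locallyIntegrableOn
    intro y
    refine ⟨Set.Icc (y - 1) (y + 1), Icc_mem_nhds (by linarith) (by linarith), ?_⟩
    apply MeasureTheory.Measure.integrableOn_of_bounded (M := |C| * (|y| + 2) ^ |θ|)
    · simp
    · exact hmeas.aestronglyMeasurable
    · rw [MeasureTheory.ae_restrict_iff' measurableSet_Icc]
      refine Eventually.of_forall fun x hx => ?_
      by_cases h : 1 ≤ x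
      · simp only [Set.mem_Ici, h, Set.indicator_of_mem, Complex.norm_real, Real.norm_eq_abs]
        refine (hb x h).trans ?_
        have h1 : x ^ θ ≤ x ^ |θ| := Real.rpow_le_rpow_of_exponent_le h (le_abs_self θ)
        have h2 : x ^ |θ| ≤ (|y| + 2) ^ |θ| := by
          apply Real.rpow_le_rpow (by linarith) _ (abs_nonneg _)
          linarith [hx.2, le_abs_self y]
        have h3 : 0 ≤ x ^ θ := by positivity
        calc C * x ^ θ ≤ |C| * x ^ θ := by gcongr; exact le_abs_self C
          _ ≤ _ := by gcongr; linarith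
      · simp [h]; positivity
  · apply IsBigO.of_bound C
    filter_upwards [eventually_ge_atTop (1 : ℝ)] with x hx
    simp only [Set.mem_Ici, hx, Set.indicator_of_mem, Complex.norm_real, Real.norm_eq_abs, neg_neg]
    rw [abs_of_nonneg (a := x ^ θ) (by positivity)]
    exact hb x hx
  · simpa using hs
  · apply IsBigO.of_bound 1
    have : ∀ᶠ x : ℝ in nhdsWithin 0 (Set.Ioi 0), x < 1 :=
      eventually_nhdsWithin_of_eventually_nhds (eventually_lt_nhds one_pos)
    filter_upwards [this] with x hx
    simp [Set.indicator, not_le.mpr hx]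
  · simp


theorem bz_M_prim (R : ℝ → ℝ) (hR : Measurable R) (C θ : ℝ) (hθ : 0 ≤ θ)
    (hb : ∀ x, 1 ≤ x → |R x| ≤ C * x ^ θ) (s : ℂ) (hs : θ < s.re) :
    bzM (fun x => ∫ u in (1 : ℝ)..x, R u) (s + 1) = bzM R s / (s + 1) := by
  set μ := MeasureTheory.volume.restrict (Set.Ici (1 : ℝ)) with hμ
  set f : ℝ → ℝ → ℂ := fun u x => if u ≤ x then (R u : ℂ) * (x : ℂ) ^ (-s - 2) else 0 with hf
  have hre : (-s - 2).re < -1 := by simp; linarith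
  have hinter : ∀ u : ℝ, 1 ≤ u → Set.Ici 1 ∩ Set.Ici u = Set.Ici u := by
    intro j hj; rw [Set.Ici_inter_Ici, sup_eq_right.mpr hj]
  have hfi : ∀ u, f u = Set.indicator (Set.Ici u) (fun x : ℝ => (R u : ℂ) * (x : ℂ) ^ (-s - 2)) := by
    intro u; ext x
    by_cases h : u ≤ x <;> simp [hf, h]
  have hs1 : s + 1 ≠ 0 := by
    intro h
    have := congrArg Complex.re h
    simp at this; linarith
  have hinner : ∀ u ∈ Set.Ici (1 : ℝ), ∫ x, f u x ∂μ = (R u : ℂ) * (u : ℂ) ^ (-s - 1) / (s + 1) := by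
    intro u hu
    rw [hfi, hμ, MeasureTheory.setIntegral_indicator measurableSet_Ici, hinter u hu,
      MeasureTheory.integral_const_mul, bz_integral_cpow u _ hu hre,
      show -s - 2 + 1 = -(s + 1) by ring, neg_div_neg_eq, show -(s + 1) = -s - 1 by ring]
    ring
  have hnorm : ∀ u x : ℝ, x ∈ Set.Ici (1 : ℝ) → ‖f u x‖ =
      Set.indicator (Set.Ici u) (fun x => |R u| * x ^ (-s.re - 2)) x := by
    intro u x hx
    have hx0 : (0 : ℝ) < x := lt_of_lt_of_le one_pos hx
    rw [hfi]
    by_cases h : u ≤ x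
    · simp only [Set.mem_Ici, h, Set.indicator_of_mem, norm_mul,
        Complex.norm_cpow_eq_rpow_re_of_pos hx0]
      simp
    · simp [h]
  have hinnern : ∀ u ∈ Set.Ici (1 : ℝ), ∫ x, ‖f u x‖ ∂μ = |R u| * u ^ (-s.re - 1) / (s.re + 1) := by
    intro u hu
    rw [hμ, MeasureTheory.setIntegral_congr_fun measurableSet_Ici (hnorm u),
      MeasureTheory.setIntegral_indicator measurableSet_Ici, hinter u hu,
      MeasureTheory.integral_const_mul, bz_integral_rpow u _ hu (by linarith),
      show -s.re - 2 + 1 = -(s.re + 1) by ring, neg_div_neg_eq,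
      show -(s.re + 1) = -s.re - 1 by ring]
    ring
  have hmeas : Measurable (Function.uncurry f) := by
    have : Function.uncurry f = fun p : ℝ × ℝ => if p.1 ≤ p.2 then (R p.1 : ℂ) * (p.2 : ℂ) ^ (-s - 2) else 0 := by
      ext p; rfl
    rw [this]
    apply Measurable.ite (measurableSet_le measurable_fst measurable_snd)
    · fun_prop
    · fun_prop
  have hIntg : MeasureTheory.Integrable (Function.uncurry f) (μ.prod μ) := by
    rw [MeasureTheory.integrable_prod_iff hmeas.aestronglyMeasurable]
    constructor
    · rw [hμ, MeasureTheory.ae_restrict_iff' measurableSet_Ici]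
      refine Eventually.of_forall fun u hu => ?_
      show MeasureTheory.Integrable (f u) _
      rw [hfi, MeasureTheory.integrable_indicator_iff measurableSet_Ici, MeasureTheory.IntegrableOn,
        MeasureTheory.Measure.restrict_restrict measurableSet_Ici, Set.inter_comm, hinter u hu]
      exact (bz_integrableOn_cpow u _ hu hre).const_mul _
    · have h1 := ((bz_M_integrable R hR C θ hb s hs).norm).div_const (s.re + 1)
      refine h1.congr ?_
      rw [Filter.EventuallyEq, MeasureTheory.ae_restrict_iff' measurableSet_Ici]
      refine Eventually.of_forall fun u hu => ?_
      have hu0 : (0 : ℝ) < u := lt_of_lt_of_le one_pos hu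
      show _ = ∫ x, ‖f u x‖ ∂μ
      rw [hinnern u hu, norm_mul, bz_norm_cpow u hu0, Complex.norm_real, Real.norm_eq_abs]
  have hswap := MeasureTheory.integral_integral_swap hIntg
  have hL : ∫ u, ∫ x, f u x ∂μ ∂μ = bzM R s / (s + 1) := by
    rw [hμ, MeasureTheory.setIntegral_congr_fun measurableSet_Ici hinner,
      MeasureTheory.integral_div]
    rfl
  have hRt : ∫ x, ∫ u, f u x ∂μ ∂μ = bzM (fun x => ∫ u in (1 : ℝ)..x, R u) (s + 1) := by
    rw [hμ, bzM]
    apply MeasureTheory.setIntegral_congr_fun measurableSet_Ici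
    intro x hx
    have e : (fun u => f u x) = Set.indicator (Set.Iic x) (fun u => (R u : ℂ) * (x : ℂ) ^ (-s - 2)) := by
      ext u
      by_cases h : u ≤ x <;> simp [hf, h]
    simp only [e]
    rw [MeasureTheory.setIntegral_indicator measurableSet_Iic, Set.Ici_inter_Iic,
      MeasureTheory.integral_Icc_eq_integral_Ioc, MeasureTheory.integral_mul_const,
      intervalIntegral.integral_of_le hx, integral_complex_ofReal]
    congr 2; ring
  rw [← hL, ← hRt, hswap]

theorem bz_integrable_line (r : ℝ) (hr : 1 < r) :
    MeasureTheory.Integrable (fun y : ℝ => (1 + |y|) ^ (-r)) := by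
  have := integrable_one_add_norm (E := ℝ) (μ := MeasureTheory.volume) (r := r) (by simpa using hr)
  simpa using this

theorem bz_line_integrable (Φ : ℂ → ℂ) (a' c' b K r : ℝ) (h1 : a' < b) (h2 : b < c') (hr : 1 < r)
    (hΦ : DifferentiableOn ℂ Φ {s : ℂ | a' < s.re ∧ s.re < c'})
    (hb : ∀ y : ℝ, ‖Φ (b + y * Complex.I)‖ ≤ K * (1 + |y|) ^ (-r)) :
    MeasureTheory.Integrable (fun y : ℝ => Φ (b + y * Complex.I)) := by
  refine MeasureTheory.Integrable.mono' ((bz_integrable_line r hr).const_mul K) ?_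
    (Eventually.of_forall hb)
  apply Continuous.aestronglyMeasurable
  have : ContinuousOn Φ {s : ℂ | a' < s.re ∧ s.re < c'} := hΦ.continuousOn
  exact this.comp_continuous (by fun_prop) (fun y => by simp [h1, h2])

theorem bz_shift (Φ : ℂ → ℂ) (a' a c c' K r : ℝ) (h1 : a' < a) (h2 : a ≤ c) (h3 : c < c') (hr : 1 < r)
    (hΦ : DifferentiableOn ℂ Φ {s : ℂ | a' < s.re ∧ s.re < c'})
    (hb : ∀ s : ℂ, a ≤ s.re → s.re ≤ c → ‖Φ s‖ ≤ K * (1 + |s.im|) ^ (-r)) :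
    ∫ y : ℝ, Φ (a + y * Complex.I) = ∫ y : ℝ, Φ (c + y * Complex.I) := by
  have hia := bz_line_integrable Φ a' c' a K r h1 (by linarith) hr hΦ
    (fun y => by simpa using hb (a + y * Complex.I) (by simp) (by simpa using h2))
  have hic := bz_line_integrable Φ a' c' c K r (by linarith) h3 hr hΦ
    (fun y => by simpa using hb (c + y * Complex.I) (by simpa using h2) (by simp))
  have hrect : ∀ T : ℝ, (∫ x in a..c, Φ (x + (-T : ℝ) * Complex.I)) - (∫ x in a..c, Φ (x + T * Complex.I))
      + Complex.I * (∫ y in (-T)..T, Φ (c + y * Complex.I))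
      - Complex.I * (∫ y in (-T)..T, Φ (a + y * Complex.I)) = 0 := by
    intro T
    have := Complex.integral_boundary_rect_eq_zero_of_differentiableOn Φ (a - T * Complex.I)
      (c + T * Complex.I) (by
        apply hΦ.mono
        intro z hz
        rw [Complex.mem_reProdIm] at hz
        have := hz.1
        simp [Set.uIcc_of_le h2] at this
        simp; constructor <;> linarith)
    simpa using this
  have hta := MeasureTheory.intervalIntegral_tendsto_integral hia tendsto_neg_atTop_atBot tendsto_id
  have htc := MeasureTheory.intervalIntegral_tendsto_integral hic tendsto_neg_atTop_atBot tendsto_id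
  have hz : Tendsto (fun T : ℝ => K * (1 + |T|) ^ (-r) * |c - a|) atTop (nhds 0) := by
    have e1 : Tendsto (fun T : ℝ => (1 + |T|)) atTop atTop :=
      tendsto_atTop_add_const_left _ _ tendsto_abs_atTop_atTop
    have e2 := (tendsto_rpow_neg_atTop (show 0 < r by linarith)).comp e1
    simpa using (e2.const_mul K).mul_const |c - a|
  have hh : ∀ (ε : ℝ), |ε| = 1 → Tendsto (fun T : ℝ => ∫ x in a..c, Φ (x + (ε * T : ℝ) * Complex.I)) atTop (nhds 0) := by
    intro ε hε
    refine squeeze_zero_norm (fun T => ?_) hz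
    apply intervalIntegral.norm_integral_le_of_norm_le_const
    intro x hx
    rw [Set.uIoc_of_le h2] at hx
    have := hb (x + (ε * T : ℝ) * Complex.I) (by simpa using hx.1.le) (by simpa using hx.2)
    simpa [abs_mul, hε] using this
  have hp := hh 1 (by simp)
  have hm := hh (-1) (by simp)
  have hlim := ((hm.sub hp).add (htc.const_mul Complex.I)).sub (hta.const_mul Complex.I)
  have hconst : Tendsto (fun _ : ℝ => (0 : ℂ)) atTop (nhds 0) := tendsto_const_nhds
  have heq := tendsto_nhds_unique (hlim.congr (fun T => by
    have := hrect T
    simpa using this)) hconst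
  have : Complex.I * ((∫ y : ℝ, Φ (c + y * Complex.I)) - ∫ y : ℝ, Φ (a + y * Complex.I)) = 0 := by
    linear_combination heq
  rcases mul_eq_zero.mp this with h | h
  · exact absurd h Complex.I_ne_zero
  · exact (sub_eq_zero.mp h).symm


theorem bz_inv (R : ℝ → ℝ) (hR : Measurable R) (hRi : ∀ a b, IntervalIntegrable R MeasureTheory.volume a b)
    (C θ : ℝ) (hC : 0 ≤ C) (hθ : 0 ≤ θ) (hb : ∀ x, 1 ≤ x → |R x| ≤ C * x ^ θ) (c : ℝ) (hc : θ < c)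
    (Φ : ℂ → ℂ) (hΦ : ∀ y : ℝ, Φ (c + y * Complex.I) = bzM R (c + y * Complex.I) / (c + y * Complex.I + 1))
    (hIntg : MeasureTheory.Integrable (fun y : ℝ => Φ (c + y * Complex.I)))
    (x : ℝ) (hx : 1 < x) :
    ((∫ u in (1 : ℝ)..x, R u : ℝ) : ℂ) =
      (1 / (2 * Real.pi) : ℝ) * ∫ y : ℝ, (x : ℂ) ^ (c + y * Complex.I + 1) * Φ (c + y * Complex.I) := by
  set F : ℝ → ℝ := fun x => ∫ u in (1 : ℝ)..x, R u with hF
  have hFc : Continuous F := intervalIntegral.continuous_primitive hRi 1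
  have hFb : ∀ x, 1 ≤ x → |F x| ≤ C * x ^ (θ + 1) := by
    intro x hx
    have hx0 : 0 < x := by linarith
    have h1 : ‖F x‖ ≤ C * x ^ θ * |x - 1| := by
      apply intervalIntegral.norm_integral_le_of_norm_le_const
      intro u hu
      rw [Set.uIoc_of_le hx] at hu
      refine (hb u hu.1.le).trans ?_
      have : u ^ θ ≤ x ^ θ := Real.rpow_le_rpow (by linarith [hu.1]) hu.2 hθ
      gcongr
    rw [abs_of_nonneg (by linarith : 0 ≤ x - 1)] at h1
    refine h1.trans ?_
    rw [Real.rpow_add_one hx0.ne', mul_assoc]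
    gcongr
    linarith
  set f : ℝ → ℂ := Set.indicator (Set.Ici 1) (fun x => (F x : ℂ)) with hf
  have hmel : ∀ s : ℂ, mellin f (-s) = bzM F s := fun s => (bz_M_eq_mellin F s).symm
  have hconv : MellinConvergent f ((-(c + 1) : ℝ) : ℂ) := by
    have h1 := bz_M_integrable F hFc.measurable C (θ + 1) hFb ((c + 1 : ℝ) : ℂ) (by
      simp only [Complex.ofReal_re]; linarith)
    rw [← MeasureTheory.integrable_indicator_iff measurableSet_Ici] at h1
    unfold MellinConvergent
    have h2 := h1.integrableOn (s := Set.Ioi 0)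
    refine h2.congr_fun (fun x hx => ?_) measurableSet_Ioi
    by_cases h : 1 ≤ x
    · simp [hf, h, mul_comm]
    · simp [hf, h]
  have hval : ∀ y : ℝ, mellin f (((-(c + 1) : ℝ) : ℂ) + y * Complex.I) =
      Φ (c + (-y : ℝ) * Complex.I) := by
    intro y
    have : ((-(c + 1) : ℝ) : ℂ) + y * Complex.I = -((c + (-y : ℝ) * Complex.I) + 1) := by
      push_cast; ring
    rw [this, hmel, bz_M_prim R hR C θ hθ hb _ (by simpa using hc), hΦ]
  have hvert : Complex.VerticalIntegrable (mellin f) (-(c + 1)) := by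
    unfold Complex.VerticalIntegrable
    simp only [hval]
    exact hIntg.comp_neg
  have hcont : ContinuousAt f x := by
    have h1 : ContinuousAt (fun x => (F x : ℂ)) x := by fun_prop
    refine h1.congr ?_
    filter_upwards [eventually_gt_nhds hx] with z hz
    simp [hf, hz.le]
  have hmain := mellinInv_mellin_eq (-(c + 1)) f (by linarith) hconv hvert hcont
  have hfx : f x = (F x : ℂ) := by simp [hf, hx.le]
  rw [hfx] at hmain
  show (F x : ℂ) = _
  rw [← hmain, mellinInv]
  simp only [hval, smul_eq_mul]
  rw [← MeasureTheory.integral_neg_eq_self]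
  rw [Complex.real_smul]
  congr 2
  ext y
  congr 2
  · push_cast; ring
  · push_cast; ring_nf

theorem bz_diff_bound (x a η : ℝ) (hx : 1 < x) (ha : 0 ≤ a) (hη : 0 < η) (hη2 : η < 1 / 2)
    (s : ℂ) (hs : s.re = a) :
    ‖((x + 1 : ℝ) : ℂ) ^ (s + 1) - (x : ℂ) ^ (s + 1)‖ ≤
      2 * (x + 1) ^ (a + 2 * η) * ‖s + 1‖ ^ (1 - 2 * η) := by
  set D := ‖((x + 1 : ℝ) : ℂ) ^ (s + 1) - (x : ℂ) ^ (s + 1)‖ with hD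
  have hx1 : 0 < x + 1 := by linarith
  have hs1 : s + 1 ≠ 0 := by
    intro h
    have := congrArg Complex.re h
    simp at this; linarith
  have h1 : D ≤ 2 * (x + 1) ^ (a + 1) := by
    refine (norm_sub_le _ _).trans ?_
    rw [Complex.norm_cpow_eq_rpow_re_of_pos hx1, Complex.norm_cpow_eq_rpow_re_of_pos (by linarith)]
    simp only [Complex.add_re, hs, Complex.one_re]
    have : x ^ (a + 1) ≤ (x + 1) ^ (a + 1) := Real.rpow_le_rpow (by linarith) (by linarith) (by linarith)
    linarith
  have h2 : D ≤ ‖s + 1‖ * (x + 1) ^ a := by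
    have := (convex_Icc x (x + 1)).norm_image_sub_le_of_norm_hasDerivWithin_le (𝕜 := ℝ)
      (f := fun u : ℝ => (u : ℂ) ^ (s + 1)) (f' := fun u : ℝ => (s + 1) * (u : ℂ) ^ s)
      (C := ‖s + 1‖ * (x + 1) ^ a) (x := x) (y := x + 1) (fun u hu => by
        have hu0 : u ≠ 0 := by linarith [hu.1]
        have h := hasDerivAt_ofReal_cpow_const hu0 (r := s + 1) hs1
        exact (h.congr_deriv (by rw [add_sub_cancel_right])).hasDerivWithinAt)
      (fun u hu => by
        have hu0 : 0 < u := by linarith [hu.1]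
        rw [norm_mul, Complex.norm_cpow_eq_rpow_re_of_pos hu0, hs]
        have : u ^ a ≤ (x + 1) ^ a := Real.rpow_le_rpow hu0.le hu.2 ha
        gcongr)
      (by simp) (by simp)
    rw [hD]
    simpa using this
  have hD0 : 0 ≤ D := norm_nonneg _
  rcases hD0.eq_or_lt with h0 | hpos
  · rw [← h0]; positivity
  · calc D = D ^ (2 * η) * D ^ (1 - 2 * η) := by
          rw [← Real.rpow_add hpos]; simp
      _ ≤ (2 * (x + 1) ^ (a + 1)) ^ (2 * η) * (‖s + 1‖ * (x + 1) ^ a) ^ (1 - 2 * η) := by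
          gcongr; linarith
      _ = 2 ^ (2 * η) * ((x + 1) ^ ((a + 1) * (2 * η)) * (x + 1) ^ (a * (1 - 2 * η))) * ‖s + 1‖ ^ (1 - 2 * η) := by
          rw [Real.mul_rpow (by positivity) (by positivity), Real.mul_rpow (by positivity) (by positivity),
            ← Real.rpow_mul hx1.le, ← Real.rpow_mul hx1.le]; ring
      _ = 2 ^ (2 * η) * (x + 1) ^ (a + 2 * η) * ‖s + 1‖ ^ (1 - 2 * η) := by
          rw [← Real.rpow_add hx1]; congr 3; ring
      _ ≤ _ := by
          gcongr
          calc (2 : ℝ) ^ (2 * η) ≤ 2 ^ (1 : ℝ) := Real.rpow_le_rpow_of_exponent_le (by norm_num) (by linarith)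
            _ = 2 := by simp

theorem bz_perron (N : ℝ → ℝ) (hN : Monotone N) (ρ : ℝ) (hρ : 0 < ρ) (C θ : ℝ) (hC : 0 ≤ C) (hθ : 0 ≤ θ)
    (hb : ∀ x, 1 ≤ x → |N x - ρ * x| ≤ C * x ^ θ)
    (a' a c η K : ℝ) (ha'0 : 0 ≤ a') (haa : a' < a) (hac : a < c) (hθc : θ < c) (hc1 : c < 1)
    (hη : 0 < η) (hη2 : η < 1 / 2) (hK : 0 ≤ K)
    (G : ℂ → ℂ) (hG : DifferentiableOn ℂ G {s : ℂ | a' < s.re ∧ s.re < 1})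
    (hGM : ∀ s : ℂ, s.re = c → G s = bzM (fun x => N x - ρ * x) s)
    (hGb : ∀ s : ℂ, a ≤ s.re → s.re ≤ c → ‖G s‖ ≤ K * (1 + |s.im|) ^ (η - 1)) :
    ∃ C' : ℝ, ∀ x, 3 ≤ x → |N x - ρ * x| ≤ C' * x ^ (a + 2 * η) := by
  set E : ℝ → ℝ := fun x => N x - ρ * x with hE
  have hEm : Measurable E := hN.measurable.sub (by fun_prop)
  have hNi : ∀ a b, IntervalIntegrable N MeasureTheory.volume a b := fun a b => hN.intervalIntegrable
  have hEi : ∀ a b, IntervalIntegrable E MeasureTheory.volume a b := fun a b =>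
    (hNi a b).sub (Continuous.intervalIntegrable (by fun_prop) a b)
  set Φ : ℂ → ℂ := fun s => G s / (s + 1) with hΦ
  have hne : ∀ s : ℂ, a' < s.re → s + 1 ≠ 0 := by
    intro s hs h
    have := congrArg Complex.re h
    simp at this; linarith
  have hΦd : DifferentiableOn ℂ Φ {s : ℂ | a' < s.re ∧ s.re < 1} := by
    apply hG.div (by fun_prop)
    intro s hs; exact hne s hs.1
  have hinv : ∀ s : ℂ, a ≤ s.re → ‖s + 1‖⁻¹ ≤ 2 * (1 + |s.im|) ^ (-1 : ℝ) := by
    intro s hs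
    have h := bz_half_le s (by linarith)
    have hp : 0 < 1 + |s.im| := by positivity
    rw [Real.rpow_neg_one]
    calc ‖s + 1‖⁻¹ ≤ ((1 + |s.im|) / 2)⁻¹ := by
          apply inv_anti₀ (by positivity) h
      _ = _ := by rw [inv_div]; field_simp
  have hΦb : ∀ s : ℂ, a ≤ s.re → s.re ≤ c → ‖Φ s‖ ≤ 2 * K * (1 + |s.im|) ^ (-(2 - η)) := by
    intro s h1 h2
    have hp : 0 < 1 + |s.im| := by positivity
    simp only [hΦ, norm_div]
    rw [div_eq_mul_inv]
    calc _ ≤ K * (1 + |s.im|) ^ (η - 1) * (2 * (1 + |s.im|) ^ (-1 : ℝ)) := by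
          gcongr
          · exact hGb s h1 h2
          · exact hinv s h1
      _ = 2 * K * ((1 + |s.im|) ^ (η - 1) * (1 + |s.im|) ^ (-1 : ℝ)) := by ring
      _ = _ := by rw [← Real.rpow_add hp]; congr 2; ring
  set X : ℝ → ℂ → ℂ := fun x s => (x : ℂ) ^ (s + 1) * Φ s with hX
  have hXd : ∀ x : ℝ, 1 < x → DifferentiableOn ℂ (X x) {s : ℂ | a' < s.re ∧ s.re < 1} := by
    intro x hx
    apply DifferentiableOn.mul _ hΦd
    intro s hs
    apply DifferentiableAt.differentiableWithinAt
    apply DifferentiableAt.const_cpow (by fun_prop)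
    left; exact_mod_cast (by linarith : x ≠ 0)
  have hXb : ∀ x : ℝ, 1 < x → ∀ s : ℂ, a ≤ s.re → s.re ≤ c →
      ‖X x s‖ ≤ x ^ (c + 1) * (2 * K) * (1 + |s.im|) ^ (-(2 - η)) := by
    intro x hx s h1 h2
    simp only [hX, norm_mul]
    rw [Complex.norm_cpow_eq_rpow_re_of_pos (by linarith), mul_assoc]
    gcongr
    · exact hx.le
    · simp; exact h2
    · exact hΦb s h1 h2
  set F : ℝ → ℝ := fun x => ∫ u in (1 : ℝ)..x, E u with hF
  have hFX : ∀ x : ℝ, 1 < x → (F x : ℂ) = (1 / (2 * Real.pi) : ℝ) * ∫ y : ℝ, X x (a + y * Complex.I) := by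
    intro x hx
    have h1 := bz_inv E hEm hEi C θ hC hθ hb c hθc Φ (fun y => by
      simp only [hΦ]; rw [hGM _ (by simp)])
      (bz_line_integrable Φ a' 1 c (2 * K) (2 - η) (by linarith) hc1 (by linarith) hΦd
        (fun y => by simpa using hΦb (c + y * Complex.I) (by simpa using hac.le) (by simp))) x hx
    show ((∫ u in (1 : ℝ)..x, E u : ℝ) : ℂ) = _
    rw [h1, bz_shift (X x) a' a c 1 _ (2 - η) haa hac.le hc1 (by linarith) (hXd x hx) (hXb x hx)]
  have hXint : ∀ x : ℝ, 1 < x → MeasureTheory.Integrable (fun y : ℝ => X x (a + y * Complex.I)) := by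
    intro x hx
    exact bz_line_integrable (X x) a' 1 a _ (2 - η) haa (by linarith) (by linarith) (hXd x hx)
        (fun y => by simpa using hXb x hx (a + y * Complex.I) (by simp) (by simpa using hac.le))
  set J := ∫ y : ℝ, (1 + |y|) ^ (-(1 + η)) with hJ
  have hJ0 : 0 ≤ J := MeasureTheory.integral_nonneg fun y => by positivity
  have hΔ : ∀ x : ℝ, 1 < x → |F (x + 1) - F x| ≤ (x + 1) ^ (a + 2 * η) * (4 * K * J) := by
    intro x hx
    have e : ((F (x + 1) - F x : ℝ) : ℂ) = (1 / (2 * Real.pi) : ℝ) *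
        ∫ y : ℝ, (X (x + 1) (a + y * Complex.I) - X x (a + y * Complex.I)) := by
      rw [MeasureTheory.integral_sub (hXint _ (by linarith)) (hXint _ hx), Complex.ofReal_sub,
        hFX _ (by linarith), hFX _ hx, mul_sub]
    have h1 : ‖∫ y : ℝ, (X (x + 1) (a + y * Complex.I) - X x (a + y * Complex.I))‖ ≤
        ∫ y : ℝ, (x + 1) ^ (a + 2 * η) * (4 * K) * (1 + |y|) ^ (-(1 + η)) := by
      apply MeasureTheory.norm_integral_le_of_norm_le
        ((bz_integrable_line (1 + η) (by linarith)).const_mul _)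
      refine Eventually.of_forall fun y => ?_
      set s : ℂ := a + y * Complex.I with hs
      have hsre : s.re = a := by simp [hs]
      have hsim : s.im = y := by simp [hs]
      have hp : 0 < 1 + |y| := by positivity
      have hn1 : 0 < ‖s + 1‖ := norm_pos_iff.mpr (hne s (by linarith))
      have e2 : X (x + 1) s - X x s = (((x + 1 : ℝ) : ℂ) ^ (s + 1) - (x : ℂ) ^ (s + 1)) * G s / (s + 1) := by
        simp only [hX, hΦ]; ring
      have g1 := hGb s hsre.ge (by linarith)
      have g2 := hinv s hsre.ge
      rw [hsim] at g1 g2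
      have hcomb : ‖s + 1‖ ^ (1 - 2 * η) * ‖s + 1‖⁻¹ = (‖s + 1‖⁻¹) ^ (2 * η) := by
        rw [Real.inv_rpow hn1.le, ← Real.rpow_neg hn1.le, ← Real.rpow_neg_one, ← Real.rpow_add hn1]
        congr 1; ring
      have hcomb2 : (‖s + 1‖⁻¹) ^ (2 * η) ≤ 2 * (1 + |y|) ^ (-(2 * η)) := by
        calc (‖s + 1‖⁻¹) ^ (2 * η) ≤ (2 * (1 + |y|) ^ (-1 : ℝ)) ^ (2 * η) := by gcongr
          _ = 2 ^ (2 * η) * (1 + |y|) ^ (-(2 * η)) := by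
            rw [Real.mul_rpow (by norm_num) (by positivity), ← Real.rpow_mul hp.le]; congr 2; ring
          _ ≤ _ := by
            gcongr
            calc (2 : ℝ) ^ (2 * η) ≤ 2 ^ (1 : ℝ) := Real.rpow_le_rpow_of_exponent_le (by norm_num) (by linarith)
              _ = 2 := by simp
      rw [e2, norm_div, norm_mul, div_eq_mul_inv]
      calc _ ≤ (2 * (x + 1) ^ (a + 2 * η) * ‖s + 1‖ ^ (1 - 2 * η)) * (K * (1 + |y|) ^ (η - 1)) * ‖s + 1‖⁻¹ := by
            gcongr
            exact bz_diff_bound x a η hx (by linarith) hη hη2 s hsre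
        _ = 2 * (x + 1) ^ (a + 2 * η) * K * (1 + |y|) ^ (η - 1) * (‖s + 1‖ ^ (1 - 2 * η) * ‖s + 1‖⁻¹) := by ring
        _ ≤ 2 * (x + 1) ^ (a + 2 * η) * K * (1 + |y|) ^ (η - 1) * (2 * (1 + |y|) ^ (-(2 * η))) := by
            rw [hcomb]
            gcongr
        _ = (x + 1) ^ (a + 2 * η) * (4 * K) * ((1 + |y|) ^ (η - 1) * (1 + |y|) ^ (-(2 * η))) := by ring
        _ = _ := by rw [← Real.rpow_add hp]; congr 2; ring
    rw [MeasureTheory.integral_const_mul] at h1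
    have h2 : |F (x + 1) - F x| = ‖((F (x + 1) - F x : ℝ) : ℂ)‖ := by
      rw [Complex.norm_real, Real.norm_eq_abs]
    rw [h2, e, norm_mul, Complex.norm_real, Real.norm_eq_abs]
    have h3 : |1 / (2 * Real.pi)| ≤ 1 := by
      rw [abs_of_pos (by positivity), div_le_one (by positivity)]
      linarith [Real.pi_gt_three]
    calc _ ≤ 1 * ((x + 1) ^ (a + 2 * η) * (4 * K) * J) := by gcongr
      _ = _ := by ring
  have hFd : ∀ x y, F y - F x = ∫ u in x..y, E u := by
    intro x y
    simp only [hF]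
    rw [intervalIntegral.integral_interval_sub_left (hEi _ _) (hEi _ _)]
  have hup : ∀ x, E x - ρ ≤ F (x + 1) - F x := by
    intro x
    rw [hFd]
    have : ∫ u in x..(x + 1), (E x - ρ) ≤ ∫ u in x..(x + 1), E u := by
      apply intervalIntegral.integral_mono_on (by linarith) (by simp) (hEi _ _)
      intro u hu
      simp only [hE]
      have := hN hu.1
      nlinarith [hu.2]
    simpa using this
  have hlow : ∀ x, F x - F (x - 1) ≤ E x + ρ := by
    intro x
    rw [hFd]
    have : ∫ u in (x - 1)..x, E u ≤ ∫ u in (x - 1)..x, (E x + ρ) := by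
      apply intervalIntegral.integral_mono_on (by linarith) (hEi _ _) (by simp)
      intro u hu
      simp only [hE]
      have := hN hu.2
      nlinarith [hu.1]
    simpa using this
  refine ⟨2 ^ (a + 2 * η) * (4 * K * J) + ρ, fun x hx => ?_⟩
  have hxp : 0 < x := by linarith
  have hpp : 0 ≤ a + 2 * η := by linarith
  have hone : 1 ≤ x ^ (a + 2 * η) := Real.one_le_rpow (by linarith) hpp
  have k1 := hΔ x (by linarith)
  have k2 := hΔ (x - 1) (by linarith)
  rw [sub_add_cancel] at k2
  have k3 : (x + 1) ^ (a + 2 * η) ≤ 2 ^ (a + 2 * η) * x ^ (a + 2 * η) := by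
    rw [← Real.mul_rpow (by norm_num) hxp.le]
    exact Real.rpow_le_rpow (by linarith) (by linarith) hpp
  have k4 : x ^ (a + 2 * η) ≤ (x + 1) ^ (a + 2 * η) := Real.rpow_le_rpow (by linarith) (by linarith) hpp
  have hKJ : 0 ≤ 4 * K * J := by positivity
  have k5 := mul_le_mul_of_nonneg_right k3 hKJ
  have k6 := mul_le_mul_of_nonneg_right k4 hKJ
  have k7 : ρ ≤ ρ * x ^ (a + 2 * η) := le_mul_of_one_le_right hρ.le hone
  have u1 := hup x
  have u2 := hlow x
  have v1 := abs_le.mp k1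
  have v2 := abs_le.mp k2
  show |E x| ≤ _
  rw [abs_le]
  constructor <;> nlinarith


theorem bz_p_gt (p : ℕ → ℝ) (hmono : Monotone p) (hp0 : 1 < p 0) (i : ℕ) : 1 < p i :=
  hp0.trans_le (hmono (Nat.zero_le i))

theorem bz_fin_psi (p : ℕ → ℝ) (hmono : Monotone p) (hp0 : 1 < p 0) (htop : Tendsto p atTop atTop)
    (x : ℝ) : {j : ℕ × ℕ | p j.1 ^ (j.2 + 1) ≤ x}.Finite := by
  obtain ⟨I, hI⟩ := (htop.eventually_gt_atTop x).exists_forall_of_atTop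
  obtain ⟨K, hK⟩ := ((tendsto_pow_atTop_atTop_of_one_lt hp0).eventually_gt_atTop x).exists_forall_of_atTop
  apply ((Set.finite_Iio I).prod (Set.finite_Iio K)).subset
  rintro ⟨i, k⟩ h
  simp only [Set.mem_ofPred_eq] at h
  have hi := bz_p_gt p hmono hp0 i
  refine ⟨?_, ?_⟩
  · simp only [Set.mem_Iio]
    by_contra hc
    have := hI i (by omega)
    have h2 : p i ≤ p i ^ (k + 1) := le_self_pow₀ hi.le (by omega)
    linarith
  · simp only [Set.mem_Iio]
    by_contra hc
    have := hK (k + 1) (by omega)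
    have h2 : p 0 ^ (k + 1) ≤ p i ^ (k + 1) := pow_le_pow_left₀ (by linarith) (hmono (Nat.zero_le i)) _
    linarith

theorem bz_n_ge_one (p : ℕ → ℝ) (hmono : Monotone p) (hp0 : 1 < p 0) (e : ℕ →₀ ℕ) :
    1 ≤ ∏ i ∈ e.support, p i ^ e i :=
  Finset.prod_induction _ (fun y => (1 : ℝ) ≤ y) (fun _ _ ha hb => one_le_mul_of_one_le_of_one_le ha hb)
    le_rfl (fun i _ => one_le_pow₀ (bz_p_gt p hmono hp0 i).le)

theorem bz_fin_N (p : ℕ → ℝ) (hmono : Monotone p) (hp0 : 1 < p 0) (htop : Tendsto p atTop atTop)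
    (x : ℝ) : {e : ℕ →₀ ℕ | ∏ i ∈ e.support, p i ^ e i ≤ x}.Finite := by
  obtain ⟨I, hI⟩ := (htop.eventually_gt_atTop x).exists_forall_of_atTop
  obtain ⟨K, hK⟩ := ((tendsto_pow_atTop_atTop_of_one_lt hp0).eventually_gt_atTop x).exists_forall_of_atTop
  apply (Set.finite_Iic (∑ i ∈ Finset.range I, Finsupp.single i K)).subset
  intro e h
  simp only [Set.mem_ofPred_eq] at h
  intro i
  have hval : (∑ i ∈ Finset.range I, Finsupp.single i K) i = if i < I then K else 0 := by
    rw [Finsupp.finsetSum_apply]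
    simp [Finsupp.single_apply]
  rw [hval]
  by_cases hi : i ∈ e.support
  · have hp := bz_p_gt p hmono hp0 i
    have h1 : p i ^ e i ≤ x := by
      refine le_trans ?_ h
      rw [← Finset.mul_prod_erase _ _ hi]
      refine le_mul_of_one_le_right (by positivity) ?_
      exact Finset.prod_induction _ (fun y => (1 : ℝ) ≤ y) (fun _ _ ha hb => one_le_mul_of_one_le_of_one_le ha hb)
        le_rfl (fun i _ => one_le_pow₀ (bz_p_gt p hmono hp0 i).le)
    have h0 : e i ≠ 0 := by simpa using hi
    have hiI : i < I := by
      by_contra hc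
      have := hI i (by omega)
      have h2 : p i ≤ p i ^ (e i) := le_self_pow₀ hp.le h0
      linarith
    rw [if_pos hiI]
    by_contra hc
    have := hK (e i) (by omega)
    have h2 : p 0 ^ (e i) ≤ p i ^ (e i) := pow_le_pow_left₀ (by linarith) (hmono (Nat.zero_le i)) _
    linarith
  · have h0 : e i = 0 := by simpa using hi
    rw [h0]; exact Nat.zero_le _

theorem bz_hA_psi (p : ℕ → ℝ) (hmono : Monotone p) (hp0 : 1 < p 0) (htop : Tendsto p atTop atTop)
    (x : ℝ) : HasSum (fun j : ℕ × ℕ => if p j.1 ^ (j.2 + 1) ≤ x then Real.log (p j.1) else 0) (psiP p x) := by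
  have hf := bz_fin_psi p hmono hp0 htop x
  have h1 : psiP p x = ∑ j ∈ hf.toFinset, Real.log (p j.1) := by
    unfold psiP
    rw [← finsum_mem_coe_finset, Set.Finite.coe_toFinset]
    symm
    refine finsum_mem_eq_of_bijOn (fun j : ℕ × ℕ => (j.1, j.2 + 1)) ⟨?_, ?_, ?_⟩ ?_
    · intro j hj; simpa using hj
    · rintro ⟨a, b⟩ _ ⟨c, d⟩ _ h
      simpa using h
    · rintro ⟨i, k⟩ ⟨hk, h⟩
      refine ⟨(i, k - 1), ?_, ?_⟩
      · simp only [Set.mem_ofPred_eq]; simp only at hk h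
        rwa [Nat.sub_add_cancel hk]
      · simp only at hk; simp [Nat.sub_add_cancel hk]
    · intro j _; rfl
  rw [h1]
  have : ∑ j ∈ hf.toFinset, Real.log (p j.1) =
      ∑ j ∈ hf.toFinset, (if p j.1 ^ (j.2 + 1) ≤ x then Real.log (p j.1) else 0) := by
    apply Finset.sum_congr rfl
    intro j hj
    rw [if_pos (by simpa using hj)]
  rw [this]
  apply hasSum_sum_of_ne_finset_zero
  intro j hj
  rw [if_neg (by simpa using hj)]

theorem bz_hA_N (p : ℕ → ℝ) (hmono : Monotone p) (hp0 : 1 < p 0) (htop : Tendsto p atTop atTop)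
    (x : ℝ) : HasSum (fun e : ℕ →₀ ℕ => if ∏ i ∈ e.support, p i ^ e i ≤ x then (1 : ℝ) else 0) (NP p x) := by
  have hf := bz_fin_N p hmono hp0 htop x
  have h1 : (NP p x : ℝ) = ∑ e ∈ hf.toFinset, (if ∏ i ∈ e.support, p i ^ e i ≤ x then (1 : ℝ) else 0) := by
    have : ∑ e ∈ hf.toFinset, (if ∏ i ∈ e.support, p i ^ e i ≤ x then (1 : ℝ) else 0) = ∑ e ∈ hf.toFinset, 1 := by
      apply Finset.sum_congr rfl
      intro j hj
      rw [if_pos (by simpa using hj)]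
    rw [this]
    unfold NP
    rw [Nat.card_coe_set_eq, Set.ncard_eq_toFinset_card _ hf]
    simp
  rw [h1]
  apply hasSum_sum_of_ne_finset_zero
  intro j hj
  rw [if_neg (by simpa using hj)]

theorem bz_A_mono {ι : Type*} (n w : ι → ℝ) (hw : ∀ j, 0 ≤ w j) (A : ℝ → ℝ)
    (hA : ∀ x, HasSum (fun j => if n j ≤ x then w j else 0) (A x)) : Monotone A := by
  intro x y hxy
  refine hasSum_le (fun j => ?_) (hA x) (hA y)
  by_cases h : n j ≤ x
  · rw [if_pos h, if_pos (h.trans hxy)]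
  · rw [if_neg h]; split_ifs
    · exact hw j
    · exact le_rfl

theorem bz_global (A : ℝ → ℝ) (hA : Monotone A) (ρ : ℝ) (hρ : 0 < ρ) (θ : ℝ) (hθ : 0 ≤ θ)
    (h : (fun x => A x - ρ * x) =O[atTop] fun x => x ^ θ) :
    ∃ C, 0 ≤ C ∧ ∀ x, 1 ≤ x → |A x - ρ * x| ≤ C * x ^ θ := by
  obtain ⟨C, hC, hb⟩ := h.exists_nonneg
  obtain ⟨X, hX⟩ := hb.bound.exists_forall_of_atTop
  refine ⟨C + (|A 1| + |A X| + ρ * |X|), by positivity, fun x hx => ?_⟩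
  have hx1 : 1 ≤ x ^ θ := Real.one_le_rpow hx hθ
  have hM : 0 ≤ |A 1| + |A X| + ρ * |X| := by positivity
  rcases le_total X x with hXx | hXx
  · have := hX x hXx
    rw [Real.norm_eq_abs, Real.norm_eq_abs, abs_of_nonneg (by positivity : (0 : ℝ) ≤ x ^ θ)] at this
    nlinarith
  · have h1 := hA hx
    have h2 := hA hXx
    have h3 : |A x - ρ * x| ≤ |A 1| + |A X| + ρ * |X| := by
      have e1 := neg_abs_le (A 1)
      have e2 := le_abs_self (A X)
      have e3 := le_abs_self X
      have e4 : ρ * x ≤ ρ * |X| := by gcongr; linarith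
      have e5 : 0 ≤ ρ * x := by positivity
      have e6 := abs_nonneg (A 1)
      have e7 := abs_nonneg (A X)
      rw [abs_le]; constructor <;> linarith
    nlinarith

theorem bz_psi_nonneg (p : ℕ → ℝ) (hmono : Monotone p) (hp0 : 1 < p 0) (htop : Tendsto p atTop atTop)
    (θ : ℝ) (h : (fun x => psiP p x - x) =O[atTop] fun x => x ^ θ) : 0 ≤ θ := by
  by_contra hθ
  push Not at hθ
  have h0 : Tendsto (fun x => psiP p x - x) atTop (nhds 0) := by
    refine h.trans_tendsto ?_
    have := tendsto_rpow_neg_atTop (y := -θ) (by linarith)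
    simpa using this
  have h1 := (tendsto_order.1 h0.abs).2 1 (by simp)
  obtain ⟨X, hX⟩ := h1.exists_forall_of_atTop
  have h2 : Tendsto (fun i => Real.log (p i)) atTop atTop := Real.tendsto_log_atTop.comp htop
  obtain ⟨i, hi1, hi2⟩ := ((htop.eventually_ge_atTop (X + 1)).and (h2.eventually_gt_atTop 3)).exists
  have hw : ∀ j : ℕ × ℕ, 0 ≤ Real.log (p j.1) := fun j => Real.log_nonneg (bz_p_gt p hmono hp0 _).le
  have hj : psiP p (p i - 1) + Real.log (p i) ≤ psiP p (p i) := by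
    have hs := (bz_hA_psi p hmono hp0 htop (p i - 1)).add (hasSum_ite_eq ((i, 0) : ℕ × ℕ) (Real.log (p i)))
    refine hasSum_le (fun j => ?_) hs (bz_hA_psi p hmono hp0 htop (p i))
    by_cases hj : j = (i, 0)
    · subst hj
      have : ¬ (1 : ℝ) ≤ 0 := by norm_num
      simp [this]
    · simp only [hj, if_false, add_zero]
      by_cases h : p j.1 ^ (j.2 + 1) ≤ p i - 1
      · rw [if_pos h, if_pos (by linarith)]
      · rw [if_neg h]; split_ifs
        · exact hw j
        · exact le_rfl
  have e1 := abs_lt.1 (hX (p i) (by linarith))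
  have e2 := abs_lt.1 (hX (p i - 1) (by linarith))
  linarith [e1.2, e2.1]


theorem bz_euler (a : ℕ → ℂ) (h : Summable (fun e : ℕ →₀ ℕ => ‖∏ i ∈ e.support, a i ^ e i‖)) :
    Complex.exp (∑' i, -Complex.log (1 - a i)) = ∑' e : ℕ →₀ ℕ, ∏ i ∈ e.support, a i ^ e i := by
  classical
  obtain ⟨hden⟩ := nonempty_denumerable Nat.Primes
  let en : Nat.Primes ≃ ℕ := Denumerable.eqv Nat.Primes
  let b : ℕ → ℂ := fun q => if hq : q.Prime then a (en ⟨q, hq⟩) else 1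
  let q : ℕ → ℕ := fun i => (en.symm i : ℕ)
  have hqp : ∀ i, (q i).Prime := fun i => (en.symm i).2
  have hqinj : Function.Injective q := fun i j hij => en.symm.injective (Subtype.ext hij)
  have hbq : ∀ i, b (q i) = a i := by
    intro i
    simp only [b, hqp i, dif_pos]
    congr 1
    exact en.apply_symm_apply i
  let f : ℕ →*₀ ℂ :=
    { toFun := fun n => if n = 0 then 0 else n.factorization.prod (fun q k => b q ^ k)
      map_zero' := by simp
      map_one' := by simp
      map_mul' := by
        intro m n
        by_cases hm : m = 0
        · simp [hm]
        by_cases hn : n = 0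
        · simp [hn]
        simp only [hm, hn, mul_eq_zero, or_self, if_false]
        rw [Nat.factorization_mul hm hn, Finsupp.prod_add_index']
        · simp
        · intro q k l; rw [pow_add] }
  have hfp : ∀ r : Nat.Primes, f r = a (en r) := by
    intro r
    show (if (r : ℕ) = 0 then (0 : ℂ) else (r : ℕ).factorization.prod (fun q k => b q ^ k)) = _
    rw [if_neg r.2.ne_zero, r.2.factorization, Finsupp.prod_single_index (by simp)]
    simp only [b, r.2, dif_pos, pow_one]
    rfl
  let φ : (ℕ →₀ ℕ) → ℕ := fun e => (e.mapDomain q).prod (fun q k => q ^ k)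
  have hsupp : ∀ e : ℕ →₀ ℕ, ∀ r ∈ (e.mapDomain q).support, r.Prime := by
    intro e r hr
    have := Finsupp.mapDomain_support hr
    obtain ⟨i, _, rfl⟩ := Finset.mem_image.1 this
    exact hqp i
  have hφfac : ∀ e, (φ e).factorization = e.mapDomain q := fun e =>
    Nat.prod_pow_factorization_eq_self (hsupp e)
  have hφinj : Function.Injective φ := by
    intro e e' hee
    apply Finsupp.mapDomain_injective hqinj
    rw [← hφfac, ← hφfac, hee]
  have hφ0 : ∀ e, φ e ≠ 0 := by
    intro e
    apply Finset.prod_ne_zero_iff.2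
    intro r hr
    exact pow_ne_zero _ (hsupp e r hr).ne_zero
  have hfφ : ∀ e, f (φ e) = ∏ i ∈ e.support, a i ^ e i := by
    intro e
    show (if φ e = 0 then (0 : ℂ) else (φ e).factorization.prod (fun q k => b q ^ k)) = _
    rw [if_neg (hφ0 e), hφfac, Finsupp.prod_mapDomain_index_inj hqinj]
    simp only [hbq]
    rfl
  have hrange : ∀ n, n ∉ Set.range φ → f n = 0 := by
    intro n hn
    by_cases h0 : n = 0
    · rw [h0]; exact map_zero f
    exfalso
    apply hn
    refine ⟨n.factorization.comapDomain q hqinj.injOn, ?_⟩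
    show (Finsupp.mapDomain q _).prod _ = n
    rw [Finsupp.mapDomain_comapDomain q hqinj]
    · exact Nat.prod_factorization_pow_eq_self h0
    · intro r hr
      have hr' : r.Prime := Nat.prime_of_mem_primeFactors (by simpa using hr)
      exact ⟨en ⟨r, hr'⟩, congrArg Subtype.val (en.symm_apply_apply ⟨r, hr'⟩)⟩
  have hsum : Summable (fun n => ‖f n‖) := by
    rw [← hφinj.summable_iff (fun n hn => by rw [hrange n hn, norm_zero])]
    refine h.congr (fun e => ?_)
    simp [hfφ]
  have hmain := EulerProduct.exp_tsum_primes_log_eq_tsum hsum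
  have h1 : ∑' n, f n = ∑' e : ℕ →₀ ℕ, ∏ i ∈ e.support, a i ^ e i := by
    rw [← hφinj.tsum_eq (f := fun n => f n)]
    · simp [hfφ]
    · intro n hn
      by_contra hc
      exact hn (hrange n hc)
  rw [← h1, ← hmain]
  congr 1
  rw [← en.symm.tsum_eq]
  congr 1
  ext i
  rw [hfp]; simp


theorem bz_pow_cpow (x : ℝ) (hx : 0 ≤ x) (k : ℕ) (s : ℂ) : ((x ^ k : ℝ) : ℂ) ^ s = ((x : ℂ) ^ s) ^ k := by
  induction k with
  | zero => simp
  | succ k ih =>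
    rw [pow_succ, pow_succ, Complex.ofReal_mul, Complex.mul_cpow_ofReal_nonneg (pow_nonneg hx k) hx, ih]

theorem bz_K (p : ℕ → ℝ) (hmono : Monotone p) (hp0 : 1 < p 0) (htop : Tendsto p atTop atTop)
    (C : ℝ) (hC : ∀ x, 1 ≤ x → psiP p x ≤ C * x) (C' : ℝ) (hC' : ∀ x, 1 ≤ x → (NP p x : ℝ) ≤ C' * x) :
    ∃ K : ℂ → ℂ, (∃ B, 0 ≤ B ∧ ∀ s : ℂ, 2 ≤ s.re → ‖K s‖ ≤ B) ∧
      (∀ s : ℂ, 1 < s.re → HasDerivAt K (-(s * bzM (psiP p) s)) s) ∧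
      (∀ s : ℂ, 1 < s.re → HasSum (fun e : ℕ →₀ ℕ => ((∏ i ∈ e.support, p i ^ e i : ℝ) : ℂ) ^ (-s))
        (Complex.exp (K s))) ∧
      (∀ s : ℂ, 1 < s.re → HasSum (fun e : ℕ →₀ ℕ => ((∏ i ∈ e.support, p i ^ e i : ℝ) : ℂ) ^ (-s))
        (s * bzM (fun x => (NP p x : ℝ)) s)) := by
  have hp1 : ∀ i, 1 < p i := bz_p_gt p hmono hp0
  have hpp : ∀ i, 0 < p i := fun i => by linarith [hp1 i]
  set n : ℕ × ℕ → ℝ := fun j => p j.1 ^ (j.2 + 1) with hn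
  set w : ℕ × ℕ → ℝ := fun j => Real.log (p j.1) with hw
  have hn1 : ∀ j, 1 ≤ n j := fun j => one_le_pow₀ (hp1 _).le
  have hn0 : ∀ j, 0 < n j := fun j => by linarith [hn1 j]
  have hw0 : ∀ j, 0 ≤ w j := fun j => Real.log_nonneg (hp1 _).le
  have hL : 0 < Real.log (p 0) := Real.log_pos hp0
  have hwL : ∀ j, Real.log (p 0) ≤ w j := fun j =>
    Real.log_le_log (hpp 0) (hmono (Nat.zero_le _))
  have habel := fun s hs => bz_abel n w hn1 hw0 (psiP p) (bz_hA_psi p hmono hp0 htop) C hC s hs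
  have habelN := fun s hs => bz_abel (fun e : ℕ →₀ ℕ => ∏ i ∈ e.support, p i ^ e i) (fun _ => (1 : ℝ))
    (bz_n_ge_one p hmono hp0) (fun _ => zero_le_one) (fun x => (NP p x : ℝ))
    (bz_hA_N p hmono hp0 htop) C' hC' s hs
  set g : ℕ × ℕ → ℂ → ℂ := fun j s => (n j : ℂ) ^ (-s) / ((j.2 + 1 : ℕ) : ℂ) with hg
  set g' : ℕ × ℕ → ℂ → ℂ := fun j s => -((w j : ℂ) * (n j : ℂ) ^ (-s)) with hg'
  have hgd : ∀ j s, HasDerivAt (g j) (g' j s) s := by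
    intro j s
    have h0 : (n j : ℂ) ≠ 0 := by exact_mod_cast (hn0 j).ne'
    have h1 := ((hasDerivAt_neg s).const_cpow (c := (n j : ℂ)) (Or.inl h0)).div_const ((j.2 + 1 : ℕ) : ℂ)
    refine h1.congr_deriv ?_
    have hk : ((j.2 + 1 : ℕ) : ℂ) ≠ 0 := by exact_mod_cast Nat.succ_ne_zero j.2
    have hlog : Complex.log (n j : ℂ) = ((j.2 + 1 : ℕ) : ℂ) * (w j : ℂ) := by
      rw [← Complex.ofReal_log (hn0 j).le]
      simp only [hn, hw, Real.log_pow]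
      push_cast; ring
    rw [hlog]
    simp only [hg']
    field_simp
  have hnn : ∀ j (s : ℂ), ‖(n j : ℂ) ^ (-s)‖ = n j ^ (-s.re) := by
    intro j s
    rw [Complex.norm_cpow_eq_rpow_re_of_pos (hn0 j)]; simp
  have hg'n : ∀ j (s : ℂ) (δ : ℝ), δ ≤ s.re → ‖g' j s‖ ≤ w j * n j ^ (-δ) := by
    intro j s δ hδ
    simp only [hg', norm_neg, norm_mul, hnn, Complex.norm_real, Real.norm_eq_abs, abs_of_nonneg (hw0 j)]
    have := Real.rpow_le_rpow_of_exponent_le (hn1 j) (neg_le_neg hδ)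
    have := hw0 j
    gcongr
  have hgn : ∀ j (s : ℂ) (δ : ℝ), δ ≤ s.re → ‖g j s‖ ≤ (Real.log (p 0))⁻¹ * (w j * n j ^ (-δ)) := by
    intro j s δ hδ
    simp only [hg, norm_div, hnn, Complex.norm_natCast]
    have h1 := Real.rpow_le_rpow_of_exponent_le (hn1 j) (neg_le_neg hδ)
    have h2 : 0 ≤ n j ^ (-s.re) := Real.rpow_nonneg (hn0 j).le _
    have h3 : (1 : ℝ) ≤ ((j.2 + 1 : ℕ) : ℝ) := by exact_mod_cast Nat.succ_le_succ (Nat.zero_le _)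
    calc n j ^ (-s.re) / ((j.2 + 1 : ℕ) : ℝ) ≤ n j ^ (-s.re) := div_le_self h2 h3
      _ ≤ n j ^ (-δ) := h1
      _ = (Real.log (p 0))⁻¹ * (Real.log (p 0) * n j ^ (-δ)) := by field_simp
      _ ≤ _ := by
        have := hwL j
        have := Real.rpow_nonneg (hn0 j).le (-δ)
        gcongr
  have hgs : ∀ s : ℂ, 1 < s.re → Summable (fun j => g j s) := by
    intro s hs
    exact Summable.of_norm_bounded ((habel s hs).1.mul_left _) (fun j => hgn j s s.re le_rfl)
  refine ⟨fun s => ∑' j, g j s, ⟨(Real.log (p 0))⁻¹ * ∑' j, (w j * n j ^ (-(2 : ℝ))), ?_, ?_⟩, ?_, ?_, ?_⟩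
  · have : ∀ j, 0 ≤ w j * n j ^ (-(2 : ℝ)) := fun j => mul_nonneg (hw0 j) (Real.rpow_nonneg (hn0 j).le _)
    exact mul_nonneg (by positivity) (tsum_nonneg this)
  · intro s hs
    have h2 := (habel 2 (by norm_num)).1
    simp only [Complex.re_ofNat] at h2
    rw [← tsum_mul_left]
    exact tsum_of_norm_bounded (h2.mul_left _).hasSum (fun j => hgn j s 2 hs)
  · intro s hs
    set δ := (1 + s.re) / 2 with hδ
    have h1 : 1 < δ := by rw [hδ]; linarith
    have h2 : δ < s.re := by rw [hδ]; linarith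
    have hu := (habel (δ : ℂ) (by simpa using h1)).1
    simp only [Complex.ofReal_re] at hu
    have hopen : IsOpen {z : ℂ | δ < z.re} := isOpen_lt continuous_const Complex.continuous_re
    have hpre : IsPreconnected {z : ℂ | δ < z.re} := (convex_halfSpace_re_gt δ).isPreconnected
    have hd := hasDerivAt_tsum_of_isPreconnected hu hopen hpre (fun j z _ => hgd j z)
      (fun j z hz => hg'n j z δ (le_of_lt hz)) (y₀ := s) h2 (hgs s hs) (y := s) h2
    refine hd.congr_deriv ?_
    simp only [hg']
    rw [tsum_neg, (habel s hs).2.tsum_eq]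
  · intro s hs
    have hN := habelN s hs
    simp only [Complex.ofReal_one, one_mul] at hN
    have ha : ∀ e : ℕ →₀ ℕ, ∏ i ∈ e.support, ((p i : ℂ) ^ (-s)) ^ e i =
        ((∏ i ∈ e.support, p i ^ e i : ℝ) : ℂ) ^ (-s) := by
      intro e
      induction e.support using Finset.induction_on with
      | empty => simp
      | insert i t hi ih =>
        rw [Finset.prod_insert hi, Finset.prod_insert hi, ih, Complex.ofReal_mul,
          Complex.mul_cpow_ofReal_nonneg (pow_nonneg (hpp i).le _)
            (Finset.prod_nonneg (fun i _ => pow_nonneg (hpp i).le _))]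
        congr 1
        rw [bz_pow_cpow _ (hpp i).le]
    have hsummN : Summable (fun e : ℕ →₀ ℕ => ‖∏ i ∈ e.support, ((p i : ℂ) ^ (-s)) ^ e i‖) := by
      refine hN.1.congr (fun e => ?_)
      rw [ha, Complex.norm_cpow_eq_rpow_re_of_pos (by linarith [bz_n_ge_one p hmono hp0 e])]; simp
    have hE := bz_euler (fun i => (p i : ℂ) ^ (-s)) hsummN
    have hlog : ∑' i, -Complex.log (1 - (p i : ℂ) ^ (-s)) = ∑' j, g j s := by
      rw [(hgs s hs).tsum_prod]
      congr 1
      ext i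
      have hlt : ‖(p i : ℂ) ^ (-s)‖ < 1 := by
        rw [Complex.norm_cpow_eq_rpow_re_of_pos (hpp i)]
        exact Real.rpow_lt_one_of_one_lt_of_neg (hp1 i) (by simp; linarith)
      have h1 := Complex.hasSum_taylorSeries_neg_log hlt
      rw [← h1.tsum_eq, h1.summable.tsum_eq_zero_add]
      simp only [Nat.cast_zero, div_zero, zero_add]
      congr 1
      ext k
      simp only [hg, hn]
      congr 1
      rw [bz_pow_cpow _ (hpp i).le]
    rw [hlog] at hE
    show HasSum _ (Complex.exp (∑' j, g j s))
    rw [hE]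
    simp only [ha]
    exact hN.2.summable.hasSum
  · intro s hs
    simpa using (habelN s hs).2


theorem bz_M_id (s : ℂ) (hs : 1 < s.re) (ρ : ℝ) : bzM (fun x => ρ * x) s = ρ / (s - 1) := by
  have h1 : bzM (fun x => ρ * x) s = ∫ x in Set.Ici (1 : ℝ), (ρ : ℂ) * (x : ℂ) ^ (-s) := by
    unfold bzM
    apply MeasureTheory.setIntegral_congr_fun measurableSet_Ici
    intro x hx
    have hx0 : (x : ℂ) ≠ 0 := by
      have : (0 : ℝ) < x := by linarith [Set.mem_Ici.1 hx]
      exact_mod_cast this.ne'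
    simp only
    rw [show -s - 1 = -s + (-1) by ring, Complex.cpow_add _ _ hx0, Complex.cpow_neg_one]
    push_cast
    field_simp
  have hne : s - 1 ≠ 0 := by
    intro h
    have := congrArg Complex.re h
    simp at this; linarith
  have hne' : -s + 1 ≠ 0 := by
    intro h; apply hne; linear_combination -h
  rw [h1, MeasureTheory.integral_const_mul, bz_integral_cpow 1 (-s) le_rfl (by simp; linarith)]
  simp
  field_simp
  ring

theorem bz_M_split (A : ℝ → ℝ) (hA : Measurable A) (ρ C θ : ℝ) (hθ1 : θ ≤ 1)
    (hb : ∀ x, 1 ≤ x → |A x - ρ * x| ≤ C * x ^ θ) (s : ℂ) (hs : 1 < s.re) :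
    bzM A s = bzM (fun x => A x - ρ * x) s + ρ / (s - 1) := by
  rw [← bz_M_id s hs ρ]
  have h1 := bz_M_integrable (fun x => A x - ρ * x) (by fun_prop) C θ hb s (by linarith)
  have h2 := bz_M_integrable (fun x => ρ * x) (by fun_prop) |ρ| 1 (fun x hx => by
    rw [abs_mul, Real.rpow_one, abs_of_nonneg (by linarith : 0 ≤ x)]) s hs
  unfold bzM
  rw [← MeasureTheory.integral_add h1 h2]
  congr 1
  ext x
  push_cast; ring

theorem bz_W (α : ℝ) (hα0 : 0 ≤ α) (hα1 : α < 1) (ψ : ℝ → ℝ) (hψm : Measurable ψ)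
    (hψ : ∀ σ, α < σ → ∃ θ C : ℝ, θ < σ ∧ 0 ≤ θ ∧ 0 ≤ C ∧ ∀ x, 1 ≤ x → |ψ x - 1 * x| ≤ C * x ^ θ)
    (K : ℂ → ℂ) (B : ℝ) (hB : 0 ≤ B) (hKB : ∀ s : ℂ, 2 ≤ s.re → ‖K s‖ ≤ B)
    (hKd : ∀ s : ℂ, 1 < s.re → HasDerivAt K (-(s * bzM ψ s)) s) :
    ∃ W : ℂ → ℂ, DifferentiableOn ℂ W {s | α < s.re} ∧
      (∀ s : ℂ, 1 < s.re → Complex.exp (W s) = Complex.exp (K s) * ((s - 1) / (s + 1))) ∧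
      (∃ C3, 0 ≤ C3 ∧ ∀ s : ℂ, 2 ≤ s.re → ‖W s‖ ≤ C3) ∧
      (∀ a, α < a → a < 1 → ∃ C1, 0 ≤ C1 ∧ ∀ s : ℂ, a ≤ s.re → s.re ≤ 4 → ‖W s‖ ≤ C1 * (1 + |s.im|) ^ 2) := by
  set R : ℝ → ℝ := fun x => ψ x - 1 * x with hR
  have hRm : Measurable R := by fun_prop
  have hop : IsOpen {s : ℂ | α < s.re} := isOpen_lt continuous_const Complex.continuous_re
  have hop1 : IsOpen {s : ℂ | 1 < s.re} := isOpen_lt continuous_const Complex.continuous_re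
  have hs1 : ∀ s : ℂ, α < s.re → s + 1 ≠ 0 := by
    intro s hs h
    have := congrArg Complex.re h
    simp at this; linarith
  set V : ℂ → ℂ := fun s => -1 - s * bzM R s - 1 / (s + 1) with hV
  have hVd : DifferentiableOn ℂ V {s | α < s.re} := by
    intro s hs
    obtain ⟨θ, C, hθ, _, _, hb⟩ := hψ s.re hs
    have h1 : DifferentiableAt ℂ (bzM R) s := bz_M_diff R hRm C θ hb s hθ
    have h2 := hs1 s hs
    apply DifferentiableAt.differentiableWithinAt
    have h3 : DifferentiableAt ℂ (fun s : ℂ => 1 / (s + 1)) s := by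
      exact (differentiableAt_const _).div (differentiableAt_id.add_const 1) h2
    exact ((differentiableAt_const _).sub (differentiableAt_id.mul h1)).sub h3
  obtain ⟨g, hg⟩ := bz_primitive α V hVd
  set L : ℂ → ℂ := fun s => Complex.log (1 + (-2 / (s + 1))) with hL
  have hn : ∀ s : ℂ, 0 < s.re → ‖-2 / (s + 1)‖ ≤ 2 / (s.re + 1) := by
    intro s hs
    rw [norm_div]
    have : s.re + 1 ≤ ‖s + 1‖ := by simpa using Complex.re_le_norm (s + 1)
    simp only [norm_neg, Complex.norm_ofNat]
    gcongr
  have hslit : ∀ s : ℂ, 1 < s.re → 1 + (-2 / (s + 1)) ∈ Complex.slitPlane := by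
    intro s hs
    apply Complex.mem_slitPlane_of_norm_lt_one
    refine (hn s (by linarith)).trans_lt ?_
    rw [div_lt_one (by linarith)]; linarith
  have hfrac : ∀ s : ℂ, 1 < s.re → 1 + (-2 / (s + 1)) = (s - 1) / (s + 1) := by
    intro s hs
    have := hs1 s (by linarith)
    field_simp; ring
  have hne1 : ∀ s : ℂ, 1 < s.re → s - 1 ≠ 0 := by
    intro s hs h
    have := congrArg Complex.re h
    simp at this; linarith
  have hLd : ∀ s : ℂ, 1 < s.re → HasDerivAt L (1 / (s - 1) - 1 / (s + 1)) s := by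
    intro s hs
    have h0 := hs1 s (by linarith)
    have h1 : HasDerivAt (fun s : ℂ => 1 + (-2 / (s + 1))) (2 / (s + 1) ^ 2) s := by
      have := (((hasDerivAt_id s).add_const 1).inv h0).const_mul (-2 : ℂ) |>.const_add 1
      simp only [id] at this
      refine (this.congr_deriv ?_)
      field_simp
    have h2 := h1.clog (hslit s hs)
    refine h2.congr_deriv ?_
    rw [hfrac s hs]
    have := hne1 s hs
    field_simp
    ring
  have hconst : ∀ s : ℂ, 1 < s.re → g s - K s - L s = g 2 - K 2 - L 2 := by
    intro s hs
    have hd : ∀ z : ℂ, 1 < z.re → HasDerivAt (fun z => g z - K z - L z) 0 z := by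
      intro z hz
      refine (((hg z (by linarith)).sub (hKd z hz)).sub (hLd z hz)).congr_deriv ?_
      obtain ⟨θ, C, hθ, _, _, hb⟩ := hψ 1 hα1
      rw [bz_M_split ψ hψm 1 C θ hθ.le hb z hz, ← hR, Complex.ofReal_one]
      simp only [hV]
      have h1 := hne1 z hz
      have h2 := hs1 z (by linarith)
      field_simp
      ring
    exact hop1.is_const_of_deriv_eq_zero (convex_halfSpace_re_gt 1).isPreconnected
      (fun z hz => (hd z hz).differentiableAt.differentiableWithinAt) (fun z hz => (hd z hz).deriv)
      hs (by simp)
  set c := g 2 - K 2 - L 2 with hc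
  have hWeq : ∀ s : ℂ, 1 < s.re → g s - c = K s + L s := by
    intro s hs
    linear_combination hconst s hs
  have hLb : ∀ s : ℂ, 2 ≤ s.re → ‖L s‖ ≤ 2 := by
    intro s hs
    have h1 : ‖-2 / (s + 1)‖ ≤ 2 / 3 := (hn s (by linarith)).trans (by
      rw [div_le_div_iff₀ (by linarith) (by norm_num)]; linarith)
    refine (Complex.norm_log_one_add_le (by linarith)).trans ?_
    set r := ‖-2 / (s + 1)‖
    have hr : 0 ≤ r := norm_nonneg _
    have h2 : (1 - r)⁻¹ ≤ 3 := by
      rw [inv_le_comm₀ (by linarith) (by norm_num)]; linarith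
    have h3 : r ^ 2 ≤ 4 / 9 := by nlinarith
    have h4 : r ^ 2 * (1 - r)⁻¹ ≤ 4 / 9 * 3 := by
      apply mul_le_mul h3 h2 _ (by norm_num)
      exact inv_nonneg.2 (by linarith)
    linarith
  have hWb : ∀ s : ℂ, 2 ≤ s.re → ‖g s - c‖ ≤ B + 2 := by
    intro s hs
    rw [hWeq s (by linarith)]
    exact (norm_add_le _ _).trans (add_le_add (hKB s hs) (hLb s hs))
  refine ⟨fun s => g s - c, ?_, ?_, ⟨B + 2, by positivity, hWb⟩, ?_⟩
  · intro s hs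
    exact ((hg s hs).sub_const c).differentiableAt.differentiableWithinAt
  · intro s hs
    simp only
    rw [hWeq s hs, Complex.exp_add]
    congr 1
    simp only [hL]
    rw [Complex.exp_log (Complex.slitPlane_ne_zero (hslit s hs)), hfrac s hs]
  · intro a ha ha1
    obtain ⟨θ, C, hθ, hθ0, hC, hb⟩ := hψ a ha
    set D := C / (a - θ) with hD
    have hD0 : 0 ≤ D := div_nonneg hC (by linarith)
    have hVb : ∀ s : ℂ, a ≤ s.re → s.re ≤ 4 → ‖V s‖ ≤ (2 + 4 * D) * (1 + |s.im|) := by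
      intro s h1 h2
      have e1 : ‖bzM R s‖ ≤ D := (bz_M_bound R C θ hb s (by linarith)).trans (by
        rw [hD]; apply div_le_div_of_nonneg_left hC (by linarith) (by linarith))
      have e2 : ‖s‖ ≤ 4 + |s.im| := (Complex.norm_le_abs_re_add_abs_im s).trans (by
        rw [abs_of_nonneg (by linarith)]; linarith)
      have e3 : ‖(1 : ℂ) / (s + 1)‖ ≤ 1 := by
        have : s.re + 1 ≤ ‖s + 1‖ := by simpa using Complex.re_le_norm (s + 1)
        rw [norm_div, norm_one]
        exact div_le_one_of_le₀ (by linarith) (norm_nonneg _)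
      have e4 : ‖s * bzM R s‖ ≤ (4 + |s.im|) * D := by
        rw [norm_mul]; gcongr
      have e5 : ‖V s‖ ≤ ‖(-1 : ℂ)‖ + ‖s * bzM R s‖ + ‖(1 : ℂ) / (s + 1)‖ :=
        (norm_sub_le _ _).trans (by gcongr; exact norm_sub_le _ _)
      simp only [norm_neg, norm_one] at e5
      have := abs_nonneg s.im
      nlinarith
    refine ⟨(B + 2) + 2 * (2 + 4 * D), by positivity, fun s h1 h2 => ?_⟩
    set t := s.im with ht
    set Q : Set ℂ := {z | a ≤ z.re} ∩ {z | z.re ≤ 4} ∩ ({z | t ≤ z.im} ∩ {z | z.im ≤ t}) with hQ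
    have hQc : Convex ℝ Q := ((convex_halfSpace_re_ge a).inter (convex_halfSpace_re_le 4)).inter
      ((convex_halfSpace_im_ge t).inter (convex_halfSpace_im_le t))
    set z0 : ℂ := ⟨2, t⟩ with hz0
    have hm := hQc.norm_image_sub_le_of_norm_hasDerivWithin_le (𝕜 := ℂ) (f := fun s => g s - c) (f' := V)
      (C := (2 + 4 * D) * (1 + |t|)) (x := z0) (y := s)
      (fun z hz => ((hg z (lt_of_lt_of_le ha hz.1.1)).sub_const c).hasDerivWithinAt)
      (fun z hz => by
        have : z.im = t := le_antisymm hz.2.2 hz.2.1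
        rw [← this]; exact hVb z hz.1.1 hz.1.2)
      ⟨⟨by simp [hz0]; linarith, by simp [hz0]; norm_num⟩, ⟨by simp [hz0], by simp [hz0]⟩⟩
      ⟨⟨h1, h2⟩, ⟨le_of_eq ht, le_of_eq ht.symm⟩⟩
    have hdist : ‖s - z0‖ ≤ 2 := by
      refine (Complex.norm_le_abs_re_add_abs_im _).trans ?_
      simp only [hz0, Complex.sub_re, Complex.sub_im, ← ht, sub_self, abs_zero, add_zero]
      rw [abs_le]; constructor <;> linarith
    have hz0b := hWb z0 (by simp [hz0])
    have h5 : ‖g s - c‖ ≤ ‖g z0 - c‖ + ‖g s - c - (g z0 - c)‖ := by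
      have := norm_add_le (g z0 - c) (g s - c - (g z0 - c))
      simpa using this
    have h6 : (2 + 4 * D) * (1 + |t|) * ‖s - z0‖ ≤ (2 + 4 * D) * (1 + |t|) * 2 := by gcongr
    have ht0 := abs_nonneg t
    have h7 : ‖g s - c‖ ≤ (B + 2) + (2 + 4 * D) * (1 + |t|) * 2 := by linarith
    refine h7.trans ?_
    have h8 : 1 + |t| ≤ (1 + |t|) ^ 2 := by nlinarith
    have h9 : 1 ≤ (1 + |t|) ^ 2 := by nlinarith
    have h10 : (B + 2) * 1 ≤ (B + 2) * (1 + |t|) ^ 2 := by gcongr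
    have h11 : 2 * (2 + 4 * D) * (1 + |t|) ≤ 2 * (2 + 4 * D) * (1 + |t|) ^ 2 := by gcongr
    linarith


theorem bz_left (u : ℝ → ℝ) (hu : Continuous u) (F : ℝ → ℂ) (D lam : ℝ) (hD : 0 ≤ D)
    (h : ∀ t, Real.exp (u t) ≤ D * ‖F t‖) (hF : F =O[cocompact ℝ] fun t => |t| ^ lam) :
    ∃ C2 M : ℝ, ∀ t, u t ≤ C2 + M * Real.log (1 + |t|) := by
  obtain ⟨c, hc, hb⟩ := hF.exists_pos
  obtain ⟨Q, hQ, hQs⟩ := mem_cocompact.1 hb.bound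
  obtain ⟨B, hB⟩ := ((hQ.union (isCompact_Icc (a := (-1 : ℝ)) (b := 1))).image hu).bddAbove
  have hDc : 0 < D * c + 1 := by positivity
  refine ⟨|B| + |Real.log (D * c + 1)|, |lam|, fun t => ?_⟩
  have hlog : 0 ≤ Real.log (1 + |t|) := Real.log_nonneg (by linarith [abs_nonneg t])
  have hl2 : 0 ≤ |lam| * Real.log (1 + |t|) := by positivity
  by_cases ht : t ∈ Q ∪ Set.Icc (-1) 1
  · have h1 : u t ≤ B := hB ⟨t, ht, rfl⟩
    have := le_abs_self B
    have := abs_nonneg (Real.log (D * c + 1))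
    linarith
  · have htQ : t ∈ Qᶜ := fun hq => ht (Or.inl hq)
    have ht1 : 1 ≤ |t| := by
      by_contra hc
      push Not at hc
      exact ht (Or.inr ⟨(abs_lt.1 hc).1.le, (abs_lt.1 hc).2.le⟩)
    have h1 : ‖F t‖ ≤ c * ‖|t| ^ lam‖ := hQs htQ
    rw [Real.norm_of_nonneg (by positivity)] at h1
    have h2 : |t| ^ lam ≤ (1 + |t|) ^ |lam| :=
      (Real.rpow_le_rpow_of_exponent_le ht1 (le_abs_self _)).trans
        (Real.rpow_le_rpow (abs_nonneg _) (by linarith) (abs_nonneg _))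
    have h3 : Real.exp (u t) ≤ (D * c + 1) * (1 + |t|) ^ |lam| := by
      calc Real.exp (u t) ≤ D * ‖F t‖ := h t
        _ ≤ D * (c * (1 + |t|) ^ |lam|) := by gcongr; exact h1.trans (by gcongr)
        _ ≤ _ := by
          have : 0 ≤ (1 + |t|) ^ |lam| := by positivity
          nlinarith
    have h4 := Real.log_le_log (Real.exp_pos _) h3
    rw [Real.log_exp, Real.log_mul hDc.ne' (by positivity), Real.log_rpow (by positivity)] at h4
    have := le_abs_self (Real.log (D * c + 1))
    have := abs_nonneg B
    linarith

theorem bz_contra (α : ℝ) (hα0 : 0 ≤ α) (W : ℂ → ℂ) (hW : DifferentiableOn ℂ W {s | α < s.re})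
    (N : ℝ → ℝ) (hN : Monotone N) (ρ : ℝ) (hρ : 0 < ρ) (C θ : ℝ) (hC : 0 ≤ C) (hαθ : α ≤ θ) (hθ1 : θ < 1)
    (hb : ∀ x, 1 ≤ x → |N x - ρ * x| ≤ C * x ^ θ)
    (hWN : ∀ s : ℂ, 1 < s.re → Complex.exp (W s) * ((s + 1) / (s - 1)) = s * bzM N s)
    (σ2 η C' : ℝ) (hσ : α < σ2) (hσ1 : σ2 < 1) (hη : 0 < η) (hη2 : η < 1 / 2)
    (hbd : ∀ s : ℂ, σ2 ≤ s.re → s.re ≤ 2 → ‖W s‖ ≤ C' + η * Real.log (1 + |s.im|)) :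
    ∃ C'' : ℝ, ∀ x, 3 ≤ x → |N x - ρ * x| ≤ C'' * x ^ (σ2 + 2 * η) := by
  set c := (max θ σ2 + 1) / 2 with hc
  have hm1 : max θ σ2 < 1 := max_lt hθ1 hσ1
  have hθm := le_max_left θ σ2
  have hσm := le_max_right θ σ2
  have hEm : Measurable (fun x => N x - ρ * x) := hN.measurable.sub (by fun_prop)
  have hs0 : ∀ s : ℂ, α < s.re → s ≠ 0 := by
    intro s hs h; rw [h] at hs; simp at hs; linarith
  have hs1 : ∀ s : ℂ, s.re ≠ 1 → s - 1 ≠ 0 := by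
    intro s hs h
    have := congrArg Complex.re h
    simp at this; exact hs (by linarith)
  set G : ℂ → ℂ := fun s => Complex.exp (W s) * (s + 1) / ((s - 1) * s) - ρ / (s - 1) with hG
  set X : ℂ → ℝ := fun s => 1 + |s.im|
  set d := (1 - c) / 2 with hd
  have hd0 : 0 < d := by rw [hd, hc]; linarith
  have hσ0 : 0 < σ2 / 2 := by linarith
  refine bz_perron N hN ρ hρ C θ hC (hα0.trans hαθ) hb α σ2 c η
    (2 * Real.exp C' / (d * (σ2 / 2)) + ρ / d) hα0 hσ ?_ ?_ ?_ hη hη2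
    (by positivity) G ?_ ?_ ?_
  · rw [hc]; linarith
  · rw [hc]; linarith
  · rw [hc]; linarith
  · intro s hs
    have hWs : DifferentiableWithinAt ℂ W {s : ℂ | α < s.re ∧ s.re < 1} s :=
      (hW s hs.1).mono (fun z hz => hz.1)
    have h0 := hs0 s hs.1
    have h1 := hs1 s hs.2.ne
    have d1 : DifferentiableWithinAt ℂ (fun s : ℂ => s + 1) {s : ℂ | α < s.re ∧ s.re < 1} s := by fun_prop
    have d2 : DifferentiableWithinAt ℂ (fun s : ℂ => s - 1) {s : ℂ | α < s.re ∧ s.re < 1} s := by fun_prop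
    have d3 : DifferentiableWithinAt ℂ (fun s : ℂ => (s - 1) * s) {s : ℂ | α < s.re ∧ s.re < 1} s := by fun_prop
    exact ((hWs.cexp.mul d1).div d3 (mul_ne_zero h1 h0)).sub ((differentiableWithinAt_const _).div d2 h1)
  · have hop : IsOpen {s : ℂ | θ < s.re} := isOpen_lt continuous_const Complex.continuous_re
    have hF1 : DifferentiableOn ℂ (fun s => (s - 1) * (s * bzM (fun x => N x - ρ * x) s)) {s : ℂ | θ < s.re} := by
      intro s hs
      have h := bz_M_diff _ hEm C θ hb s hs
      exact ((differentiableAt_id.sub_const 1).mul (differentiableAt_id.mul h)).differentiableWithinAt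
    have hF2 : DifferentiableOn ℂ (fun s => Complex.exp (W s) * (s + 1) - ρ * s) {s : ℂ | θ < s.re} := by
      have hW' : DifferentiableOn ℂ W {s : ℂ | θ < s.re} := hW.mono (fun z hz => lt_of_le_of_lt hαθ hz)
      exact (hW'.cexp.mul (by fun_prop)).sub (by fun_prop)
    have hnh : {s : ℂ | 1 < s.re} ∈ nhds (2 : ℂ) :=
      (isOpen_lt continuous_const Complex.continuous_re).mem_nhds (by simp)
    have heq := (hF1.analyticOnNhd hop).eqOn_of_preconnected_of_eventuallyEq (hF2.analyticOnNhd hop)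
      (convex_halfSpace_re_gt θ).isPreconnected (z₀ := 2) (by simp; linarith) (by
        filter_upwards [hnh] with s hs
        have h1 := hs1 s (ne_of_gt hs)
        have h2 := hWN s hs
        rw [bz_M_split N hN.measurable ρ C θ hθ1.le hb s hs] at h2
        field_simp at h2
        linear_combination -h2)
    intro s hs
    have hcθ : θ < c := by rw [hc]; linarith
    have hc1 : c < 1 := by rw [hc]; linarith
    have h := heq (show θ < s.re by rw [hs]; exact hcθ)
    simp only at h
    have h0 := hs0 s (by rw [hs]; linarith)
    have h1 := hs1 s (by rw [hs]; linarith)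
    simp only [hG]
    field_simp
    linear_combination -h
  · intro s h1 h2
    have hc1 : c < 1 := by rw [hc]; linarith
    have hX1 : 1 ≤ X s := by simp only [X]; linarith [abs_nonneg s.im]
    have hX0 : 0 < X s := by linarith
    have e1 : ‖Complex.exp (W s)‖ ≤ Real.exp C' * X s ^ η := by
      rw [Complex.norm_exp, Real.rpow_def_of_pos hX0, ← Real.exp_add]
      apply Real.exp_le_exp.2
      have := hbd s h1 (by linarith)
      have := Complex.re_le_norm (W s)
      simp only [X]; linarith
    have e2 : ‖s + 1‖ ≤ 2 * X s := by
      refine (Complex.norm_le_abs_re_add_abs_im _).trans ?_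
      simp only [Complex.add_re, Complex.add_im, Complex.one_re, Complex.one_im, add_zero, X]
      rw [abs_of_nonneg (by linarith)]
      linarith [abs_nonneg s.im]
    have e3 : d * X s ≤ ‖s - 1‖ := by
      have a1 : 1 - c ≤ ‖s - 1‖ := by
        have := Complex.abs_re_le_norm (s - 1)
        simp only [Complex.sub_re, Complex.one_re] at this
        have := neg_abs_le (s.re - 1)
        linarith
      have a2 : |s.im| ≤ ‖s - 1‖ := by
        simpa using Complex.abs_im_le_norm (s - 1)
      have a3 : (1 - c) * |s.im| ≤ 1 * |s.im| := by
        gcongr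
        linarith
      simp only [X, hd]; linarith
    have e4 : σ2 / 2 * X s ≤ ‖s‖ := by
      have a1 : σ2 ≤ ‖s‖ := h1.trans (Complex.re_le_norm s)
      have a2 : |s.im| ≤ ‖s‖ := Complex.abs_im_le_norm s
      have a3 : σ2 * |s.im| ≤ 1 * |s.im| := by gcongr
      simp only [X]; linarith
    have hd1 : 0 < d * X s := by positivity
    have hd2 : 0 < σ2 / 2 * X s := by positivity
    have e5 : ‖Complex.exp (W s) * (s + 1) / ((s - 1) * s)‖ ≤
        (Real.exp C' * X s ^ η) * (2 * X s) / ((d * X s) * (σ2 / 2 * X s)) := by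
      rw [norm_div, norm_mul, norm_mul]
      gcongr
    have e6 : ‖(ρ : ℂ) / (s - 1)‖ ≤ ρ / (d * X s) := by
      rw [norm_div, Complex.norm_real, Real.norm_of_nonneg hρ.le]
      gcongr
    have hXp : X s ^ (η - 1) = X s ^ η / X s := Real.rpow_sub_one hX0.ne' η
    have hXη : 1 ≤ X s ^ η := Real.one_le_rpow hX1 hη.le
    show ‖G s‖ ≤ _ * X s ^ (η - 1)
    calc ‖G s‖ ≤ _ := norm_sub_le _ _
      _ ≤ _ := add_le_add e5 e6
      _ = 2 * Real.exp C' / (d * (σ2 / 2)) * (X s ^ η / X s) + ρ / d * (1 / X s) := by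
        field_simp
      _ ≤ 2 * Real.exp C' / (d * (σ2 / 2)) * (X s ^ η / X s) + ρ / d * (X s ^ η / X s) := by
        gcongr
      _ = _ := by rw [hXp]; ring


theorem bz_final (α β : ℝ) (hα0 : 0 ≤ α) (hαβ : α < β) (hβ1 : β < 1) (W : ℂ → ℂ)
    (hW : DifferentiableOn ℂ W {s | α < s.re})
    (hWb : ∃ C3, 0 ≤ C3 ∧ ∀ s : ℂ, 2 ≤ s.re → ‖W s‖ ≤ C3)
    (hWp : ∀ a, α < a → a < 1 → ∃ C1, 0 ≤ C1 ∧ ∀ s : ℂ, a ≤ s.re → s.re ≤ 4 → ‖W s‖ ≤ C1 * (1 + |s.im|) ^ 2)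
    (N : ℝ → ℝ) (hN : Monotone N) (ρ : ℝ) (hρ : 0 < ρ) (C θ : ℝ) (hC : 0 ≤ C) (hαθ : α ≤ θ) (hθ1 : θ < 1)
    (hb : ∀ x, 1 ≤ x → |N x - ρ * x| ≤ C * x ^ θ)
    (hWN : ∀ s : ℂ, 1 < s.re → Complex.exp (W s) * ((s + 1) / (s - 1)) = s * bzM N s)
    (hβ : ∀ θ, θ < β → ¬ (fun x => N x - ρ * x) =O[atTop] fun x => x ^ θ)
    (σ : ℝ) (hσ : α < σ) (hσβ : σ < β) (F : ℝ → ℂ) (D lam : ℝ) (hD : 0 ≤ D)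
    (ε : ℂ) (hε : ε = 1 ∨ ε = -1)
    (h : ∀ t : ℝ, Real.exp ((ε * W (σ + t * Complex.I)).re) ≤ D * ‖F t‖)
    (hF : F =O[cocompact ℝ] fun t => |t| ^ lam) : False := by
  have hεn : ‖ε‖ = 1 := by rcases hε with h | h <;> simp [h]
  have hcont : Continuous (fun t : ℝ => (ε * W (σ + t * Complex.I)).re) := by
    have h1 : Continuous (fun t : ℝ => W (σ + t * Complex.I)) := by
      apply hW.continuousOn.comp_continuous (by fun_prop)
      intro t
      simpa using hσ
    exact Complex.continuous_re.comp (continuous_const.mul h1)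
  obtain ⟨C2, M, hleft⟩ := bz_left _ hcont F D lam hD h hF
  obtain ⟨C3, hC3, hC3b⟩ := hWb
  obtain ⟨C1, hC1, hC1b⟩ := hWp σ hσ (by linarith)
  set σ2 := (σ + β) / 2 with hσ2
  set η := (β - σ) / 8 with hη
  have hη0 : 0 < η := by rw [hη]; linarith
  obtain ⟨C', hC', hC'b⟩ := bz_lemmaA (fun s => ε * W s) α σ σ2 hσ (by linarith) (by rw [hσ2]; linarith)
    (by rw [hσ2]; linarith) (hW.const_mul ε) C1 hC1
    (fun s h1 h2 => by rw [norm_mul, hεn, one_mul]; exact hC1b s h1 h2) C2 M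
    (fun s hs => by
      have := hleft s.im
      have e : (σ : ℂ) + s.im * Complex.I = s := by rw [← hs]; exact Complex.re_add_im s
      rwa [e] at this) C3 hC3
    (fun s h1 => by rw [norm_mul, hεn, one_mul]; exact hC3b s h1) η hη0
  obtain ⟨C'', hC''⟩ := bz_contra α hα0 W hW N hN ρ hρ C θ hC hαθ hθ1 hb hWN σ2 η C'
    (by rw [hσ2]; linarith) (by rw [hσ2]; linarith) hη0 (by rw [hη]; linarith)
    (fun s h1 h2 => by
      have := hC'b s h1 h2
      rwa [norm_mul, hεn, one_mul] at this)
  apply hβ (σ2 + 2 * η) (by rw [hσ2, hη]; linarith)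
  refine IsBigO.of_bound C'' ?_
  filter_upwards [eventually_ge_atTop 3] with x hx
  rw [Real.norm_eq_abs, Real.norm_of_nonneg (Real.rpow_nonneg (by linarith) _)]
  exact hC'' x hx

theorem bz_ident (α : ℝ) (Z Z0 : ℂ → ℂ) (hZ : DifferentiableOn ℂ Z ({s : ℂ | α < s.re} \ {1}))
    (hZ0 : DifferentiableOn ℂ Z0 ({s : ℂ | α < s.re} \ {1}))
    (he : ∀ s : ℂ, 1 < s.re → Z s = Z0 s) (s : ℂ) (hs : α < s.re) (him : s.im ≠ 0) : Z s = Z0 s := by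
  have key : ∀ U : Set ℂ, IsOpen U → Convex ℝ U → (∀ z ∈ U, α < z.re ∧ z.im ≠ 0) → s ∈ U →
      (∃ z ∈ U, 1 < z.re) → Z s = Z0 s := by
    intro U hU hc hsub hsU hz
    obtain ⟨z, hzU, hz1⟩ := hz
    have hUs : U ⊆ {s : ℂ | α < s.re} \ {1} := by
      intro w hw
      refine ⟨(hsub w hw).1, ?_⟩
      intro h
      apply (hsub w hw).2
      rw [Set.mem_singleton_iff.1 h]; simp
    have hnh : {s : ℂ | 1 < s.re} ∈ nhds z :=
      (isOpen_lt continuous_const Complex.continuous_re).mem_nhds hz1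
    refine ((hZ.mono hUs).analyticOnNhd hU).eqOn_of_preconnected_of_eventuallyEq
      ((hZ0.mono hUs).analyticOnNhd hU) hc.isPreconnected hzU ?_ hsU
    filter_upwards [hnh] with w hw
    exact he w hw
  have ho1 : IsOpen {s : ℂ | α < s.re} := isOpen_lt continuous_const Complex.continuous_re
  rcases lt_or_gt_of_ne him with h | h
  · refine key ({s : ℂ | α < s.re} ∩ {s : ℂ | s.im < 0})
      (ho1.inter (isOpen_lt Complex.continuous_im continuous_const))
      ((convex_halfSpace_re_gt α).inter (convex_halfSpace_im_lt 0)) (fun z hz => ⟨hz.1, ne_of_lt hz.2⟩)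
      ⟨hs, h⟩ ⟨⟨|α| + 2, -1⟩, ⟨?_, ?_⟩, ?_⟩
    · show α < |α| + 2
      linarith [le_abs_self α]
    · show (-1 : ℝ) < 0
      norm_num
    · show 1 < |α| + 2
      linarith [abs_nonneg α]
  · refine key ({s : ℂ | α < s.re} ∩ {s : ℂ | 0 < s.im})
      (ho1.inter (isOpen_lt continuous_const Complex.continuous_im))
      ((convex_halfSpace_re_gt α).inter (convex_halfSpace_im_gt 0)) (fun z hz => ⟨hz.1, ne_of_gt hz.2⟩)
      ⟨hs, h⟩ ⟨⟨|α| + 2, 1⟩, ⟨?_, ?_⟩, ?_⟩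
    · show α < |α| + 2
      linarith [le_abs_self α]
    · show (0 : ℝ) < 1
      norm_num
    · show 1 < |α| + 2
      linarith [abs_nonneg α]

theorem stmt10 (p : ℕ → ℝ) (hmono : Monotone p) (hp0 : 1 < p 0)
    (htop : Tendsto p atTop atTop) (ρ : ℝ) (hρ : 0 < ρ)
    (Sψ SN : Set ℝ)
    (hSψ : Sψ = {θ : ℝ | (fun x => psiP p x - x) =O[atTop] fun x => x ^ θ})
    (hSN : SN = {θ : ℝ | (fun x => (NP p x : ℝ) - ρ * x) =O[atTop] fun x => x ^ θ})
    (hψne : Sψ.Nonempty) (hNne : SN.Nonempty)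
    (α β : ℝ) (hα : α = sInf Sψ) (hβ : β = sInf SN)
    (hαβ : α < β) (hβ1 : β < 1) :
    (∃ Z : ℂ → ℂ, DifferentiableOn ℂ Z ({s : ℂ | α < s.re} \ {1}) ∧
      (∀ s ∈ ({s : ℂ | α < s.re} \ {1} : Set ℂ), Z s ≠ 0) ∧ AgreesWithZeta p Z) ∧
    (∀ Z : ℂ → ℂ, DifferentiableOn ℂ Z ({s : ℂ | α < s.re} \ {1}) →
      (∀ s ∈ ({s : ℂ | α < s.re} \ {1} : Set ℂ), Z s ≠ 0) → AgreesWithZeta p Z →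
      ∀ σ : ℝ, α < σ → σ < β → ∀ lam : ℝ,
        ¬ ((fun t : ℝ => Z (σ + t * Complex.I)) =O[cocompact ℝ] fun t => |t| ^ lam) ∧
        ¬ ((fun t : ℝ => 1 / Z (σ + t * Complex.I)) =O[cocompact ℝ] fun t => |t| ^ lam)) := by
  -- basic facts on the index sets
  have hψ0 : ∀ θ ∈ Sψ, 0 ≤ θ := by
    intro θ hθ
    rw [hSψ] at hθ
    exact bz_psi_nonneg p hmono hp0 htop θ hθ
  have hα0 : 0 ≤ α := by rw [hα]; exact le_csInf hψne hψ0
  have hα1 : α < 1 := hαβ.trans hβ1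
  have hbdd : BddBelow SN := by
    by_contra hc
    rw [Real.sInf_of_not_bddBelow hc] at hβ
    linarith
  have hβnot : ∀ θ, θ < β → ¬ (fun x => (NP p x : ℝ) - ρ * x) =O[atTop] fun x => x ^ θ := by
    intro θ hθ hc
    have hmem : θ ∈ SN := by rw [hSN]; exact hc
    have := csInf_le hbdd hmem
    linarith
  have hψm : Monotone (psiP p) := bz_A_mono _ _
    (fun j => Real.log_nonneg (bz_p_gt p hmono hp0 _).le) _ (bz_hA_psi p hmono hp0 htop)
  have hNm : Monotone (fun x => (NP p x : ℝ)) := bz_A_mono _ _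
    (fun _ => zero_le_one) _ (bz_hA_N p hmono hp0 htop)
  have hψb : ∀ σ, α < σ → ∃ θ C : ℝ, θ < σ ∧ 0 ≤ θ ∧ 0 ≤ C ∧
      ∀ x, 1 ≤ x → |psiP p x - 1 * x| ≤ C * x ^ θ := by
    intro σ hσ
    rw [hα] at hσ
    obtain ⟨θ, hθ, hθσ⟩ := exists_lt_of_csInf_lt hψne hσ
    have h0 := hψ0 θ hθ
    rw [hSψ] at hθ
    obtain ⟨C, hC, hb⟩ := bz_global (psiP p) hψm 1 one_pos θ h0 (by simpa using hθ)
    exact ⟨θ, C, hθσ, h0, hC, hb⟩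
  obtain ⟨θN, hθN, hθN1⟩ := exists_lt_of_csInf_lt hNne (hβ ▸ hβ1)
  have hθNβ : β ≤ θN := by rw [hβ]; exact csInf_le hbdd hθN
  rw [hSN] at hθN
  obtain ⟨CN, hCN, hbN⟩ := bz_global (fun x => (NP p x : ℝ)) hNm ρ hρ θN (by linarith) hθN
  have hlin : ∀ (A : ℝ → ℝ) (r θ C : ℝ), θ < 1 → 0 ≤ C → (∀ x, 1 ≤ x → |A x - r * x| ≤ C * x ^ θ) →
      ∀ x, 1 ≤ x → A x ≤ (C + r) * x := by
    intro A r θ C hθ hC hb x hx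
    have h1 := (abs_le.1 (hb x hx)).2
    have h2 : x ^ θ ≤ x := by
      have := Real.rpow_le_rpow_of_exponent_le hx hθ.le
      rwa [Real.rpow_one] at this
    have h3 : C * x ^ θ ≤ C * x := by gcongr
    linarith
  obtain ⟨θ1, C1, hθ1, _, hC1, hb1⟩ := hψb 1 hα1
  obtain ⟨K, ⟨B, hB, hKB⟩, hKd, hKZ, hNZ⟩ := bz_K p hmono hp0 htop _ (hlin _ _ _ _ hθ1 hC1 hb1)
    _ (hlin _ _ _ _ hθN1 hCN hbN)
  obtain ⟨W, hWd, hWK, hWb, hWp⟩ := bz_W α hα0 hα1 (psiP p) hψm.measurable hψb K B hB hKB hKd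
  have hs1 : ∀ s : ℂ, α < s.re → s + 1 ≠ 0 := by
    intro s hs h
    have := congrArg Complex.re h
    simp at this; linarith
  have hs2 : ∀ s : ℂ, s.re ≠ 1 → s - 1 ≠ 0 := by
    intro s hs h
    have := congrArg Complex.re h
    simp at this; exact hs (by linarith)
  set Z0 : ℂ → ℂ := fun s => Complex.exp (W s) * ((s + 1) / (s - 1)) with hZ0
  have hZ0d : DifferentiableOn ℂ Z0 ({s : ℂ | α < s.re} \ {1}) := by
    intro s hs
    have h1 : s - 1 ≠ 0 := sub_ne_zero.2 hs.2
    have hW' := (hWd s hs.1).mono (Set.sdiff_subset (t := ({1} : Set ℂ)))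
    have d1 : DifferentiableWithinAt ℂ (fun s : ℂ => s + 1) ({s : ℂ | α < s.re} \ {1}) s := by fun_prop
    have d2 : DifferentiableWithinAt ℂ (fun s : ℂ => s - 1) ({s : ℂ | α < s.re} \ {1}) s := by fun_prop
    exact hW'.cexp.mul (d1.div d2 h1)
  have hZ0K : ∀ s : ℂ, 1 < s.re → Z0 s = Complex.exp (K s) := by
    intro s hs
    have h1 := hs1 s (by linarith)
    have h2 := hs2 s (ne_of_gt hs)
    simp only [hZ0]
    rw [hWK s hs]
    field_simp
  have hWN : ∀ s : ℂ, 1 < s.re →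
      Complex.exp (W s) * ((s + 1) / (s - 1)) = s * bzM (fun x => (NP p x : ℝ)) s := by
    intro s hs
    have := hZ0K s hs
    simp only [hZ0] at this
    rw [this]
    exact (hKZ s hs).unique (hNZ s hs)
  refine ⟨⟨Z0, hZ0d, ?_, ?_⟩, ?_⟩
  · intro s hs
    have h1 : s - 1 ≠ 0 := sub_ne_zero.2 hs.2
    exact mul_ne_zero (Complex.exp_ne_zero _) (div_ne_zero (hs1 s hs.1) h1)
  · intro s hs
    rw [hZ0K s hs]
    exact hKZ s hs
  · intro Z hZd hZne hZ σ hσ hσβ lam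
    have hZZ0 : ∀ s : ℂ, α < s.re → s.im ≠ 0 → Z s = Z0 s := bz_ident α Z Z0 hZd hZ0d (fun s hs => by
      rw [hZ0K s hs]
      exact (hZ s hs).unique (hKZ s hs))
    have hev : ∀ᶠ t : ℝ in cocompact ℝ, Z (σ + t * Complex.I) = Z0 (σ + t * Complex.I) := by
      have : ({0} : Set ℝ)ᶜ ∈ cocompact ℝ := isCompact_singleton.compl_mem_cocompact
      filter_upwards [this] with t ht
      apply hZZ0
      · simpa using hσ
      · simpa using ht
    have hre : ∀ t : ℝ, ((σ : ℂ) + t * Complex.I).re = σ := by intro t; simp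
    have hfin := bz_final α β hα0 hαβ hβ1 W hWd hWb hWp (fun x => (NP p x : ℝ)) hNm ρ hρ CN θN hCN
      (by linarith) hθN1 hbN hWN hβnot σ hσ hσβ
    have hp1 : ∀ t : ℝ, 0 < ‖(σ : ℂ) + t * Complex.I + 1‖ := fun t =>
      norm_pos_iff.2 (hs1 _ (by rw [hre]; exact hσ))
    have hm1 : ∀ t : ℝ, 1 - σ ≤ ‖(σ : ℂ) + t * Complex.I - 1‖ := by
      intro t
      have h1 := Complex.abs_re_le_norm ((σ : ℂ) + t * Complex.I - 1)
      rw [Complex.sub_re, hre, Complex.one_re] at h1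
      linarith [neg_abs_le (σ - 1)]
    have hσ1 : 0 < 1 - σ := by linarith
    have htri1 : ∀ t : ℝ, ‖(σ : ℂ) + t * Complex.I - 1‖ ≤ ‖(σ : ℂ) + t * Complex.I + 1‖ := by
      intro t
      rw [Complex.norm_def, Complex.norm_def]
      apply Real.sqrt_le_sqrt
      simp only [Complex.normSq_apply, Complex.sub_re, Complex.sub_im, Complex.add_im, hre,
        Complex.one_re, Complex.one_im]
      rw [Complex.add_re _ 1, hre, Complex.one_re]
      nlinarith
    have htri2 : ∀ t : ℝ, ‖(σ : ℂ) + t * Complex.I + 1‖ ≤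
        (1 + 2 / (1 - σ)) * ‖(σ : ℂ) + t * Complex.I - 1‖ := by
      intro t
      have h1 : ‖(σ : ℂ) + t * Complex.I + 1‖ ≤ ‖(σ : ℂ) + t * Complex.I - 1‖ + 2 := by
        have := norm_add_le ((σ : ℂ) + t * Complex.I - 1) 2
        rw [Complex.norm_ofNat] at this
        rwa [show (σ : ℂ) + t * Complex.I - 1 + 2 = σ + t * Complex.I + 1 by ring] at this
      have h2 : 2 / (1 - σ) * (1 - σ) ≤ 2 / (1 - σ) * ‖(σ : ℂ) + t * Complex.I - 1‖ := by
        have := hm1 t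
        gcongr
      rw [div_mul_cancel₀ _ hσ1.ne'] at h2
      linarith
    constructor
    · intro hO
      have hO' : (fun t : ℝ => Z0 (σ + t * Complex.I)) =O[cocompact ℝ] fun t => |t| ^ lam :=
        hO.congr' hev EventuallyEq.rfl
      refine hfin _ 1 lam zero_le_one 1 (Or.inl rfl) (fun t => ?_) hO'
      simp only [hZ0, one_mul, norm_mul, norm_div, Complex.norm_exp]
      have h1 := hm1 t
      have h2 : 1 ≤ ‖(σ : ℂ) + t * Complex.I + 1‖ / ‖(σ : ℂ) + t * Complex.I - 1‖ := by
        rw [one_le_div (by linarith)]; exact htri1 t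
      exact le_mul_of_one_le_right (Real.exp_pos _).le h2
    · intro hO
      have hO' : (fun t : ℝ => 1 / Z0 (σ + t * Complex.I)) =O[cocompact ℝ] fun t => |t| ^ lam :=
        hO.congr' (hev.mono fun t ht => by simp only [ht]) EventuallyEq.rfl
      refine hfin _ (1 + 2 / (1 - σ)) lam (by positivity) (-1) (Or.inr rfl) (fun t => ?_) hO'
      simp only [hZ0, neg_mul, one_mul, norm_mul, norm_div, Complex.norm_exp, norm_one, Complex.neg_re]
      have h1 := hm1 t
      have h2 := hp1 t
      have h3 := htri2 t
      have hm0 : 0 < ‖(σ : ℂ) + t * Complex.I - 1‖ := by linarith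
      rw [Real.exp_neg, ← mul_div_assoc, mul_one, le_div_iff₀ (by positivity),
        inv_mul_cancel_left₀ (Real.exp_pos _).ne', div_le_iff₀ hm0]
      exact h3
end

section
/- Fix β ∈ (0,1). Then, as x → ∞, the number of pairs (m, n) of positive integers with m · n^{1/β} ≤ x equals ζ(1/β)·x + ζ(β)·x^β + O(x^{β/(1+β)}), where ζ(1/β) = Σ_{n≥1} n^{−1/β} and ζ(β) is the (real) value at β of the analytic continuation of the Riemann zeta function. -/
open Filter Asymptotics ArithmeticFunction

/-- The number of pairs (m,n) of positive integers with m · n^{1/β} ≤ x. -/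
noncomputable def pairCount (β x : ℝ) : ℕ :=
  Nat.card {mn : ℕ × ℕ | 0 < mn.1 ∧ 0 < mn.2 ∧ (mn.1 : ℝ) * (mn.2 : ℝ) ^ (1/β) ≤ x}

/-- Mertens function M(y) = Σ_{k ≤ y} μ(k) (equal to 0 for y < 1). -/
noncomputable def Mob (y : ℝ) : ℤ :=
  ∑ k ∈ Finset.Icc 1 ⌊y⌋₊, moebius k

/-- Σ_{(m,n) : m,n ≥ 1, m·n^{1/β} ≤ x} μ(m)·μ(n) (a finite sum for each x). -/
noncomputable def MobPairSum (β x : ℝ) : ℤ :=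
  ∑ᶠ mn ∈ {mn : ℕ × ℕ | 0 < mn.1 ∧ 0 < mn.2 ∧ (mn.1 : ℝ) * (mn.2 : ℝ) ^ (1/β) ≤ x},
    moebius mn.1 * moebius mn.2



lemma real_mvt {s a b : ℝ} (hs : 0 < s) (hs1 : s ≠ 1) (ha : 0 < a) (hab : a ≤ b) :
    (b - a) * b ^ (-s) ≤ (b ^ (1 - s) - a ^ (1 - s)) / (1 - s) ∧
    (b ^ (1 - s) - a ^ (1 - s)) / (1 - s) ≤ (b - a) * a ^ (-s) := by
  rcases hab.eq_or_lt with rfl | hlt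
  · simp
  have h1 : 1 - s ≠ 0 := sub_ne_zero.mpr hs1.symm
  obtain ⟨c, hc, h⟩ := exists_hasDerivAt_eq_slope (fun t : ℝ => t ^ (1 - s) / (1 - s))
    (fun t => t ^ (-s)) hlt
    (fun t ht => (ContinuousAt.div_const (Real.continuousAt_rpow_const _ _
      (Or.inl (by linarith [ht.1]))) _).continuousWithinAt)
    (fun t ht => by
      have := (Real.hasDerivAt_rpow_const (x := t) (p := 1 - s)
        (Or.inl (by linarith [ht.1]))).div_const (1 - s)
      rwa [show 1 - s - 1 = -s by ring, mul_div_cancel_left₀ _ h1] at this)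
  have hba : 0 < b - a := by linarith
  have e : (b ^ (1 - s) - a ^ (1 - s)) / (1 - s) = (b - a) * c ^ (-s) := by
    rw [h]; field_simp
  rw [e]
  constructor
  · exact mul_le_mul_of_nonneg_left
      (Real.rpow_le_rpow_of_nonpos (by linarith [hc.1]) hc.2.le (by linarith)) hba.le
  · exact mul_le_mul_of_nonneg_left
      (Real.rpow_le_rpow_of_nonpos ha hc.1.le (by linarith)) hba.le

/-- terms whose sum is `1 - (s-1) ζ(s)` -/
noncomputable def gterm (n : ℕ) (s : ℂ) : ℂ :=
  (1 - s) * (((n : ℝ) + 1 : ℝ) : ℂ) ^ (-s) - (((n : ℝ) + 2 : ℝ) : ℂ) ^ (1 - s)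
    + (((n : ℝ) + 1 : ℝ) : ℂ) ^ (1 - s)

lemma deriv_cpow' {t : ℝ} (ht : 0 < t) (r : ℂ) :
    HasDerivAt (fun y : ℝ => (y : ℂ) ^ r) (r * (t : ℂ) ^ (r - 1)) t := by
  have := (hasDerivAt_id (t : ℂ)).cpow_const (c := r) (Or.inl (by simpa using ht))
  have := this.comp_ofReal
  simpa using this

lemma gterm_bound (n : ℕ) {s : ℂ} (hs : 0 < s.re) :
    ‖gterm n s‖ ≤ ‖1 - s‖ * ‖s‖ * ((n : ℝ) + 1) ^ (-s.re - 1) := by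
  set a : ℝ := (n : ℝ) + 1 with ha
  have ha0 : 0 < a := by positivity
  have h1 : ∀ t ∈ Set.Icc a (a + 1), ‖(t : ℂ) ^ (-s) - (a : ℂ) ^ (-s)‖ ≤
      ‖s‖ * a ^ (-s.re - 1) := by
    intro t ht
    have := norm_image_sub_le_of_norm_deriv_le_segment' (a := a) (b := a + 1)
      (f := fun y : ℝ => (y : ℂ) ^ (-s)) (f' := fun y : ℝ => -s * (y : ℂ) ^ (-s - 1))
      (C := ‖s‖ * a ^ (-s.re - 1))
      (fun x hx => (deriv_cpow' (by linarith [hx.1]) _).hasDerivWithinAt)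
      (fun x hx => by
        rw [norm_mul, norm_neg, Complex.norm_cpow_eq_rpow_re_of_pos (by linarith [hx.1])]
        gcongr
        have : (-s - 1).re = -s.re - 1 := by simp
        rw [this]
        exact Real.rpow_le_rpow_of_nonpos ha0 hx.1 (by linarith)) t ht
    refine this.trans (mul_le_of_le_one_right (by positivity) (by linarith [ht.2]))
  have := norm_image_sub_le_of_norm_deriv_le_segment' (a := a) (b := a + 1)
      (f := fun y : ℝ => (1 - s) * (a : ℂ) ^ (-s) * (y : ℂ) - (y : ℂ) ^ (1 - s))
      (f' := fun y : ℝ => (1 - s) * (a : ℂ) ^ (-s) * 1 - (1 - s) * (y : ℂ) ^ (1 - s - 1))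
      (C := ‖1 - s‖ * (‖s‖ * a ^ (-s.re - 1)))
      (fun x hx => (((hasDerivAt_id (x : ℂ)).comp_ofReal.const_mul _).sub
        (deriv_cpow' (by linarith [hx.1]) _)).hasDerivWithinAt)
      (fun x hx => by
        rw [show (1 - s - 1) = -s by ring, mul_one, ← mul_sub, norm_mul, norm_sub_rev ((a : ℂ) ^ (-s))]
        gcongr
        exact h1 x ⟨hx.1, hx.2.le⟩) (a + 1) ⟨by linarith, le_rfl⟩
  rw [add_sub_cancel_left, mul_one, ← mul_assoc] at this
  refine le_of_eq_of_le (congrArg norm ?_) this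
  unfold gterm
  rw [show (n : ℝ) + 2 = a + 1 by rw [ha]; ring, ← ha]
  push_cast
  ring

lemma gterm_sum (N : ℕ) (s : ℂ) : ∑ n ∈ Finset.range N, gterm n s =
    (1 - s) * ∑ n ∈ Finset.range N, (((n : ℝ) + 1 : ℝ) : ℂ) ^ (-s)
      - (((N : ℝ) + 1 : ℝ) : ℂ) ^ (1 - s) + 1 := by
  induction N with
  | zero => simp
  | succ N ih =>
    rw [Finset.sum_range_succ, ih, Finset.sum_range_succ, gterm]
    push_cast
    rw [show (N : ℂ) + 1 + 1 = N + 2 by ring]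
    ring

lemma gterm_summable {s : ℂ} (hs : 0 < s.re) : Summable (fun n => gterm n s) := by
  refine Summable.of_norm_bounded (g := fun n : ℕ => ‖1 - s‖ * ‖s‖ * ((n : ℝ) + 1) ^ (-s.re - 1))
    ?_ (fun n => gterm_bound n hs)
  apply Summable.mul_left
  have := (summable_nat_add_iff 1).mpr (Real.summable_nat_rpow (p := -s.re - 1).mpr (by linarith))
  simpa using this

lemma gterm_tsum_of_one_lt {s : ℂ} (hs : 1 < s.re) : ∑' n, gterm n s = 1 - riemannZeta₁ s := by
  have h1 : s ≠ 1 := by rintro rfl; simp at hs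
  have hz : riemannZeta₁ s = (s - 1) * riemannZeta s := by
    rw [riemannZeta_eq_inv_sub_mul h1, ← mul_assoc, mul_inv_cancel₀ (sub_ne_zero.mpr h1), one_mul]
  have hT := (gterm_summable (s := s) (by linarith)).hasSum.tendsto_sum_nat
  refine tendsto_nhds_unique hT ?_
  simp_rw [gterm_sum]
  have hsum : Summable (fun n : ℕ => (((n : ℝ) + 1 : ℝ) : ℂ) ^ (-s)) := by
    have := (summable_nat_add_iff 1).mpr (Complex.summable_one_div_nat_cpow (p := s).mpr hs)
    refine this.congr (fun n => ?_)
    rw [Complex.cpow_neg, one_div]; push_cast; rfl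
  have hζ : ∑' n : ℕ, (((n : ℝ) + 1 : ℝ) : ℂ) ^ (-s) = riemannZeta s := by
    rw [zeta_eq_tsum_one_div_nat_add_one_cpow hs]
    refine tsum_congr (fun n => ?_)
    rw [Complex.cpow_neg, one_div]; push_cast; rfl
  have hS := hsum.hasSum.tendsto_sum_nat
  rw [hζ] at hS
  have h0 : Tendsto (fun N : ℕ => (((N : ℝ) + 1 : ℝ) : ℂ) ^ (1 - s)) atTop (nhds 0) := by
    rw [tendsto_zero_iff_norm_tendsto_zero]
    have : Tendsto (fun N : ℕ => ((N : ℝ) + 1) ^ (-(s.re - 1))) atTop (nhds 0) :=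
      (tendsto_rpow_neg_atTop (by linarith)).comp
        (tendsto_atTop_add_const_right _ _ tendsto_natCast_atTop_atTop)
    refine this.congr (fun N => ?_)
    rw [Complex.norm_cpow_eq_rpow_re_of_pos (by positivity)]
    simp
  have := ((hS.const_mul (1 - s)).sub h0).add_const 1
  convert this using 2
  rw [hz]; ring

lemma gterm_tsum {s : ℂ} (hs : 0 < s.re) : ∑' n, gterm n s = 1 - riemannZeta₁ s := by
  set δ := min (s.re / 2) 1
  have hδ : 0 < δ := lt_min (by linarith) one_pos
  set U : Set ℂ := {z | δ < z.re} ∩ Metric.ball 0 (‖s‖ + 3) with hU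
  have hUo : IsOpen U := (isOpen_lt continuous_const Complex.continuous_re).inter Metric.isOpen_ball
  have hUc : IsPreconnected U :=
    ((convex_halfSpace_re_gt δ).inter (convex_ball _ _)).isPreconnected
  have hsU : s ∈ U := ⟨by
    have := min_le_left (s.re / 2) 1
    simp only [Set.mem_ofPred_eq]; linarith, by simp⟩
  have h2U : (2 : ℂ) ∈ U := ⟨by
    have := min_le_right (s.re / 2) 1
    simp only [Set.mem_ofPred_eq]; norm_num; linarith, by simp; linarith [norm_nonneg s]⟩
  set R := ‖s‖ + 3
  have hd : DifferentiableOn ℂ (fun z => ∑' n, gterm n z) U := by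
    refine Complex.differentiableOn_tsum_of_summable_norm
      (u := fun n : ℕ => (1 + R) * R * ((n : ℝ) + 1) ^ (-δ - 1)) ?_ ?_ hUo ?_
    · apply Summable.mul_left
      have := (summable_nat_add_iff 1).mpr
        (Real.summable_nat_rpow (p := -δ - 1).mpr (by linarith))
      simpa using this
    · intro n z _
      have a1 : (((n : ℝ) + 1 : ℝ) : ℂ) ≠ 0 := by
        rw [Complex.ofReal_ne_zero]; positivity
      have a2 : (((n : ℝ) + 2 : ℝ) : ℂ) ≠ 0 := by
        rw [Complex.ofReal_ne_zero]; positivity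
      unfold gterm
      refine DifferentiableAt.differentiableWithinAt ?_
      fun_prop (disch := tauto)
    · intro n z hz
      have hz1 : δ < z.re := hz.1
      have hz2 : ‖z‖ ≤ R := (mem_ball_zero_iff.mp hz.2).le
      refine (gterm_bound n (by linarith)).trans ?_
      have : ‖1 - z‖ ≤ 1 + R := (norm_sub_le _ _).trans (by simpa using hz2)
      have h0 : 0 ≤ R := (norm_nonneg z).trans hz2
      gcongr
      linarith
  have h1 : DifferentiableOn ℂ (fun z => 1 - riemannZeta₁ z) U :=
    (differentiable_riemannZeta₁.const_sub 1).differentiableOn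
  refine (hd.analyticOnNhd hUo).eqOn_of_preconnected_of_eventuallyEq (h1.analyticOnNhd hUo)
    hUc h2U ?_ hsU
  have : {z : ℂ | 1 < z.re} ∈ nhds (2 : ℂ) :=
    (isOpen_lt continuous_const Complex.continuous_re).mem_nhds (by norm_num)
  filter_upwards [this] with z hz
  exact gterm_tsum_of_one_lt hz

noncomputable def D (s : ℝ) (N : ℕ) : ℝ :=
  ∑ n ∈ Finset.range N, ((n : ℝ) + 1) ^ (-s) - ((N : ℝ) + 1) ^ (1 - s) / (1 - s)

lemma D_tendsto {s : ℝ} (hs : 0 < s) (hs1 : s ≠ 1) :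
    Tendsto (fun N => (D s N : ℂ)) atTop (nhds (riemannZeta s)) := by
  have hs1' : (s : ℂ) ≠ 1 := by exact_mod_cast hs1
  have hne : (1 : ℂ) - s ≠ 0 := sub_ne_zero.mpr hs1'.symm
  have hT := (gterm_summable (s := s) (by simpa using hs)).hasSum.tendsto_sum_nat
  rw [gterm_tsum (by simpa using hs)] at hT
  have := (hT.sub_const 1).div_const (1 - (s : ℂ))
  have e : (1 - riemannZeta₁ s - 1) / (1 - (s : ℂ)) = riemannZeta s := by
    rw [riemannZeta_eq_inv_sub_mul hs1', show (s : ℂ) - 1 = -(1 - s) by ring, inv_neg]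
    field_simp
    ring
  rw [e] at this
  refine this.congr (fun N => ?_)
  rw [gterm_sum, D]
  push_cast
  have e1 : ∀ n : ℕ, (((((n : ℝ) + 1) ^ (-s) : ℝ)) : ℂ) = ((n : ℂ) + 1) ^ (-(s : ℂ)) := by
    intro n
    rw [Complex.ofReal_cpow (by positivity)]; push_cast; rfl
  have e2 : (((((N : ℝ) + 1) ^ (1 - s) : ℝ)) : ℂ) = ((N : ℂ) + 1) ^ (1 - (s : ℂ)) := by
    rw [Complex.ofReal_cpow (by positivity)]; push_cast; rfl
  simp_rw [e1, e2]
  field_simp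
  ring

lemma D_step {s : ℝ} (hs : 0 < s) (hs1 : s ≠ 1) (N : ℕ) :
    D s N ≤ D s (N + 1) ∧
      D s (N + 1) + ((N + 1 : ℕ) + 1 : ℝ) ^ (-s) ≤ D s N + ((N : ℝ) + 1) ^ (-s) := by
  obtain ⟨h1, h2⟩ := real_mvt hs hs1 (a := (N : ℝ) + 1) (b := (N : ℝ) + 1 + 1) (by positivity)
    (by linarith)
  rw [add_sub_cancel_left, one_mul, sub_div] at h1 h2
  simp only [D, Finset.sum_range_succ]
  push_cast
  constructor <;> linarith

lemma zeta_approx {s : ℝ} (hs : 0 < s) (hs1 : s ≠ 1) : ∃ z : ℝ, riemannZeta s = z ∧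
    ∀ N : ℕ, |D s N - z| ≤ ((N : ℝ) + 1) ^ (-s) := by
  have hT := D_tendsto hs hs1
  have hre : Tendsto (D s) atTop (nhds (riemannZeta s).re) := by
    have := (Complex.continuous_re.tendsto _).comp hT
    simpa [Function.comp_def] using this
  refine ⟨(riemannZeta s).re, ?_, fun N => ?_⟩
  · refine tendsto_nhds_unique hT ?_
    exact (Complex.continuous_ofReal.tendsto _).comp hre
  · have hm : Monotone (D s) := monotone_nat_of_le_succ (fun n => (D_step hs hs1 n).1)
    have ha : Antitone (fun n : ℕ => D s n + ((n : ℝ) + 1) ^ (-s)) :=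
      antitone_nat_of_succ_le (fun n => (D_step hs hs1 n).2)
    have h0 : Tendsto (fun N : ℕ => ((N : ℝ) + 1) ^ (-s)) atTop (nhds 0) :=
      (tendsto_rpow_neg_atTop hs).comp
        (tendsto_atTop_add_const_right _ _ tendsto_natCast_atTop_atTop)
    have b1 := hm.ge_of_tendsto hre N
    have b2 := ha.le_of_tendsto (hre.add h0) N
    simp only [add_zero] at b2
    rw [abs_le]
    have : 0 ≤ ((N : ℝ) + 1) ^ (-s) := by positivity
    constructor <;> linarith

lemma sum_approx {s : ℝ} (hs : 0 < s) (hs1 : s ≠ 1) : ∃ z : ℝ, riemannZeta s = z ∧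
    ∀ y : ℝ, 1 ≤ y → |∑ n ∈ Finset.Icc 1 ⌊y⌋₊, (n : ℝ) ^ (-s) - y ^ (1 - s) / (1 - s) - z|
      ≤ 2 * y ^ (-s) := by
  obtain ⟨z, hz, h⟩ := zeta_approx hs hs1
  refine ⟨z, hz, fun y hy => ?_⟩
  have hN := h ⌊y⌋₊
  have hlt := Nat.lt_floor_add_one y
  have hle := Nat.floor_le (zero_le_one.trans hy)
  have hmono : ((⌊y⌋₊ : ℝ) + 1) ^ (-s) ≤ y ^ (-s) :=
    Real.rpow_le_rpow_of_nonpos (by linarith) hlt.le (by linarith)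
  obtain ⟨h1, h2⟩ := real_mvt hs hs1 (a := y) (b := (⌊y⌋₊ : ℝ) + 1) (by linarith) hlt.le
  have h3 : 0 ≤ ((⌊y⌋₊ : ℝ) + 1 - y) * ((⌊y⌋₊ : ℝ) + 1) ^ (-s) :=
    mul_nonneg (by linarith) (by positivity)
  have h4 : ((⌊y⌋₊ : ℝ) + 1 - y) * y ^ (-s) ≤ y ^ (-s) :=
    mul_le_of_le_one_left (by positivity) (by linarith)
  have hsum : ∑ n ∈ Finset.Icc 1 ⌊y⌋₊, (n : ℝ) ^ (-s) =
      ∑ n ∈ Finset.range ⌊y⌋₊, ((n : ℝ) + 1) ^ (-s) := by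
    generalize ⌊y⌋₊ = N
    induction N with
    | zero => simp
    | succ N ih =>
      rw [Finset.sum_Icc_succ_top (by omega), ih, Finset.sum_range_succ]
      push_cast
      rfl
  rw [hsum]
  rw [D, abs_le] at hN
  rw [sub_div] at h1 h2
  rw [abs_le]
  constructor <;> linarith [hN.1, hN.2]

lemma floor_sum_approx (M : ℕ) (f : ℕ → ℝ) (hf : ∀ n, 0 ≤ f n) :
    |((∑ n ∈ Finset.Icc 1 M, ⌊f n⌋₊ : ℕ) : ℝ) - ∑ n ∈ Finset.Icc 1 M, f n| ≤ M := by
  push_cast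
  rw [← Finset.sum_sub_distrib]
  refine (Finset.abs_sum_le_sum_abs _ _).trans ?_
  have : ∑ n ∈ Finset.Icc 1 M, |(⌊f n⌋₊ : ℝ) - f n| ≤ ∑ n ∈ Finset.Icc 1 M, (1 : ℝ) := by
    refine Finset.sum_le_sum (fun n _ => ?_)
    rw [abs_le]
    constructor <;> linarith [Nat.floor_le (hf n), Nat.lt_floor_add_one (f n)]
  simpa using this

lemma pairCount_eq {β : ℝ} (hβ : 0 < β) {y : ℝ} (hy : 1 ≤ y) :
    pairCount β (y ^ (1 + 1 / β)) + ⌊y⌋₊ * ⌊y⌋₊ =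
      ∑ n ∈ Finset.Icc 1 ⌊y⌋₊, ⌊y ^ (1 + 1 / β) * (n : ℝ) ^ (-(1 / β))⌋₊ +
      ∑ m ∈ Finset.Icc 1 ⌊y⌋₊, ⌊y ^ (1 + β) * (m : ℝ) ^ (-β)⌋₊ := by
  classical
  have hy0 : 0 < y := by linarith
  have hα : 0 < 1 / β := by positivity
  set x := y ^ (1 + 1 / β) with hx
  have hxy : x = y * y ^ (1 / β) := by rw [hx, Real.rpow_add hy0, Real.rpow_one]
  have hxβ : x ^ β = y ^ (1 + β) := by
    rw [hx, ← Real.rpow_mul hy0.le]; congr 1; field_simp; ring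
  have hx0 : 0 < x := by positivity
  set M := ⌊y⌋₊
  have hMle : ∀ n : ℕ, n ≤ M ↔ (n : ℝ) ≤ y := fun n => Nat.le_floor_iff hy0.le
  -- the two descriptions of the condition
  have c1 : ∀ m n : ℕ, 0 < n → (m ≤ ⌊x * (n : ℝ) ^ (-(1 / β))⌋₊ ↔ (m : ℝ) * (n : ℝ) ^ (1 / β) ≤ x) := by
    intro m n hn
    have hn' : (0 : ℝ) < n := by exact_mod_cast hn
    rw [Nat.le_floor_iff (by positivity), Real.rpow_neg hn'.le, ← div_eq_mul_inv,
      le_div_iff₀ (by positivity)]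
  have c2 : ∀ m n : ℕ, 0 < m → (n ≤ ⌊y ^ (1 + β) * (m : ℝ) ^ (-β)⌋₊ ↔
      (m : ℝ) * (n : ℝ) ^ (1 / β) ≤ x) := by
    intro m n hm
    have hm' : (0 : ℝ) < m := by exact_mod_cast hm
    rw [Nat.le_floor_iff (by positivity), Real.rpow_neg hm'.le, ← div_eq_mul_inv,
      le_div_iff₀ (by positivity), ← hxβ,
      ← Real.rpow_le_rpow_iff (z := β) (x := (m : ℝ) * (n : ℝ) ^ (1 / β)) (by positivity) hx0.le hβ,
      Real.mul_rpow hm'.le (by positivity), ← Real.rpow_mul (Nat.cast_nonneg n),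
      one_div_mul_cancel hβ.ne', Real.rpow_one, mul_comm]
  set S1 : Finset (ℕ × ℕ) := (Finset.Icc 1 M).biUnion
    (fun n => Finset.Icc 1 ⌊x * (n : ℝ) ^ (-(1 / β))⌋₊ ×ˢ {n}) with hS1
  set S2 : Finset (ℕ × ℕ) := (Finset.Icc 1 M).biUnion
    (fun m => {m} ×ˢ Finset.Icc 1 ⌊y ^ (1 + β) * (m : ℝ) ^ (-β)⌋₊) with hS2
  have m1 : ∀ p : ℕ × ℕ, p ∈ S1 ↔ (0 < p.1 ∧ 0 < p.2 ∧ (p.1 : ℝ) * (p.2 : ℝ) ^ (1/β) ≤ x) ∧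
      p.2 ≤ M := by
    rintro ⟨m, n⟩
    simp only [hS1, Finset.mem_biUnion, Finset.mem_product, Finset.mem_Icc, Finset.mem_singleton]
    constructor
    · rintro ⟨n', h, h', rfl⟩
      exact ⟨⟨by omega, by omega, (c1 m n (by omega)).1 h'.2⟩, h.2⟩
    · rintro ⟨⟨h1, h2, h3⟩, h4⟩
      exact ⟨n, ⟨h2, h4⟩, ⟨h1, (c1 m n h2).2 h3⟩, rfl⟩
  have m2 : ∀ p : ℕ × ℕ, p ∈ S2 ↔ (0 < p.1 ∧ 0 < p.2 ∧ (p.1 : ℝ) * (p.2 : ℝ) ^ (1/β) ≤ x) ∧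
      p.1 ≤ M := by
    rintro ⟨m, n⟩
    simp only [hS2, Finset.mem_biUnion, Finset.mem_product, Finset.mem_Icc, Finset.mem_singleton]
    constructor
    · rintro ⟨n', h, rfl, h'⟩
      exact ⟨⟨by omega, by omega, (c2 m n (by omega)).1 h'.2⟩, h.2⟩
    · rintro ⟨⟨h1, h2, h3⟩, h4⟩
      exact ⟨m, ⟨h1, h4⟩, rfl, ⟨h2, (c2 m n h1).2 h3⟩⟩
  have k1 : S1.card = ∑ n ∈ Finset.Icc 1 M, ⌊x * (n : ℝ) ^ (-(1 / β))⌋₊ := by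
    rw [hS1, Finset.card_biUnion]
    · simp
    · intro a _ b _ hab
      rw [Function.onFun, Finset.disjoint_left]
      rintro ⟨p, q⟩ h1 h2
      simp only [Finset.mem_product, Finset.mem_singleton] at h1 h2
      exact hab (h1.2.symm.trans h2.2)
  have k2 : S2.card = ∑ m ∈ Finset.Icc 1 M, ⌊y ^ (1 + β) * (m : ℝ) ^ (-β)⌋₊ := by
    rw [hS2, Finset.card_biUnion]
    · simp
    · intro a _ b _ hab
      rw [Function.onFun, Finset.disjoint_left]
      rintro ⟨p, q⟩ h1 h2
      simp only [Finset.mem_product, Finset.mem_singleton] at h1 h2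
      exact hab (h1.1.symm.trans h2.1)
  have hu : {mn : ℕ × ℕ | 0 < mn.1 ∧ 0 < mn.2 ∧ (mn.1 : ℝ) * (mn.2 : ℝ) ^ (1/β) ≤ x} =
      ((S1 ∪ S2 : Finset (ℕ × ℕ)) : Set (ℕ × ℕ)) := by
    ext ⟨m, n⟩
    rw [Finset.mem_coe, Finset.mem_union, m1, m2]
    change (0 < m ∧ 0 < n ∧ (m : ℝ) * (n : ℝ) ^ (1/β) ≤ x) ↔ _
    constructor
    · intro h
      by_contra hc
      have hn : ¬ n ≤ M := fun h' => hc (Or.inl ⟨h, h'⟩)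
      have hm : ¬ m ≤ M := fun h' => hc (Or.inr ⟨h, h'⟩)
      rw [hMle, not_le] at hn hm
      have : x < (m : ℝ) * (n : ℝ) ^ (1/β) := by
        rw [hxy]
        exact mul_lt_mul'' hm (Real.rpow_lt_rpow hy0.le hn hα) hy0.le (by positivity)
      linarith [h.2.2]
    · rintro (h | h) <;> exact h.1
  have hi : S1 ∩ S2 = Finset.Icc 1 M ×ˢ Finset.Icc 1 M := by
    ext ⟨m, n⟩
    rw [Finset.mem_inter, m1, m2, Finset.mem_product, Finset.mem_Icc, Finset.mem_Icc]
    constructor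
    · rintro ⟨⟨⟨h1, h2, _⟩, h3⟩, _, h4⟩
      exact ⟨⟨h1, h4⟩, h2, h3⟩
    · rintro ⟨⟨h1, h4⟩, h2, h3⟩
      have : (m : ℝ) * (n : ℝ) ^ (1/β) ≤ x := by
        rw [hxy]
        have hm := (hMle m).1 h4
        have hn := (hMle n).1 h3
        gcongr
      exact ⟨⟨⟨h1, h2, this⟩, h3⟩, ⟨h1, h2, this⟩, h4⟩
  have hp : pairCount β x = (S1 ∪ S2).card := by
    rw [pairCount, hu]
    simp only [Nat.card_eq_fintype_card, Finset.coe_sort_coe, Fintype.card_coe]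
  have := Finset.card_union_add_card_inter S1 S2
  rw [hi, Finset.card_product, k1, k2, ← hp] at this
  simpa using this

theorem stmt11 (β : ℝ) (hβ : β ∈ Set.Ioo (0:ℝ) 1) :
    (fun x : ℝ => (pairCount β x : ℂ)
        - riemannZeta (1/(β:ℂ)) * (x : ℂ) - riemannZeta (β:ℂ) * ((x ^ β : ℝ) : ℂ))
      =O[atTop] fun x : ℝ => x ^ (β / (1 + β)) := by
  obtain ⟨hβ0, hβ1⟩ := hβ
  have hα : 0 < 1 / β := by positivity
  have hα1 : 1 < 1 / β := by rw [lt_div_iff₀ hβ0]; linarith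
  obtain ⟨z1, hz1, H1⟩ := sum_approx hα hα1.ne'
  obtain ⟨z2, hz2, H2⟩ := sum_approx hβ0 hβ1.ne
  push_cast at hz1
  rw [hz1, hz2]
  refine IsBigO.of_bound 8 ?_
  filter_upwards [eventually_ge_atTop 1] with x hx
  have hx0 : 0 < x := by linarith
  set y := x ^ (β / (1 + β)) with hy
  have hy1 : 1 ≤ y := Real.one_le_rpow hx (by positivity)
  have hy0 : 0 < y := by linarith
  have hxy : y ^ (1 + 1 / β) = x := by
    rw [hy, ← Real.rpow_mul hx0.le]
    have : β / (1 + β) * (1 + 1 / β) = 1 := by field_simp; ring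
    rw [this, Real.rpow_one]
  have hxβ : x ^ β = y ^ (1 + β) := by
    rw [← hxy, ← Real.rpow_mul hy0.le]; congr 1; field_simp; ring
  have hc := pairCount_eq hβ0 hy1
  rw [hxy] at hc
  have hM1 := Nat.floor_le hy0.le
  have hM2 := Nat.lt_floor_add_one y
  have F1 := floor_sum_approx ⌊y⌋₊ (fun n => x * (n : ℝ) ^ (-(1 / β))) (fun n => by positivity)
  have F2 := floor_sum_approx ⌊y⌋₊ (fun n => y ^ (1 + β) * (n : ℝ) ^ (-β)) (fun n => by positivity)
  have hcR : (pairCount β x : ℝ) + (⌊y⌋₊ : ℝ) * ⌊y⌋₊ =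
      ((∑ n ∈ Finset.Icc 1 ⌊y⌋₊, ⌊x * (n : ℝ) ^ (-(1 / β))⌋₊ : ℕ) : ℝ) +
      ((∑ m ∈ Finset.Icc 1 ⌊y⌋₊, ⌊y ^ (1 + β) * (m : ℝ) ^ (-β)⌋₊ : ℕ) : ℝ) := by
    exact_mod_cast hc
  rw [← Finset.mul_sum] at F1 F2
  have G1 := mul_le_mul_of_nonneg_left (H1 y hy1) hx0.le
  have G2 := mul_le_mul_of_nonneg_left (H2 y hy1) (show 0 ≤ y ^ (1 + β) by positivity)
  set A := ∑ n ∈ Finset.Icc 1 ⌊y⌋₊, (n : ℝ) ^ (-(1 / β))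
  set B := ∑ n ∈ Finset.Icc 1 ⌊y⌋₊, (n : ℝ) ^ (-β)
  have e1 : x * y ^ (-(1 / β)) = y := by
    rw [← hxy, ← Real.rpow_add hy0]; simp
  have e2 : y ^ (1 + β) * y ^ (-β) = y := by
    rw [← Real.rpow_add hy0]; simp
  have e3 : x * y ^ (1 - 1 / β) = y ^ 2 := by
    rw [← hxy, ← Real.rpow_add hy0, ← Real.rpow_natCast]; congr 1; push_cast; ring
  have e4 : y ^ (1 + β) * y ^ (1 - β) = y ^ 2 := by
    rw [← Real.rpow_add hy0, ← Real.rpow_natCast]; congr 1; push_cast; ring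
  have G1' : |x * A - y ^ 2 / (1 - 1 / β) - x * z1| ≤ 2 * y := by
    rw [← e3, ← mul_div_assoc', ← mul_sub, ← mul_sub, abs_mul, abs_of_pos hx0]
    linarith
  have G2' : |y ^ (1 + β) * B - y ^ 2 / (1 - β) - y ^ (1 + β) * z2| ≤ 2 * y := by
    rw [← e4, ← mul_div_assoc', ← mul_sub, ← mul_sub, abs_mul,
      abs_of_pos (show 0 < y ^ (1 + β) by positivity)]
    linarith
  have e5 : y ^ 2 / (1 - 1 / β) + y ^ 2 / (1 - β) = y ^ 2 := by
    have h1 : 1 - β ≠ 0 := by linarith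
    have h2 : β - 1 ≠ 0 := by linarith
    have : 1 - 1 / β = (β - 1) / β := by field_simp
    rw [this, show β - 1 = -(1 - β) by ring]
    field_simp
    ring
  have hM3 : (⌊y⌋₊ : ℝ) * ⌊y⌋₊ ≤ y ^ 2 := by nlinarith [Nat.cast_nonneg (α := ℝ) ⌊y⌋₊]
  have hM4 : y ^ 2 - 2 * y ≤ (⌊y⌋₊ : ℝ) * ⌊y⌋₊ := by nlinarith [Nat.cast_nonneg (α := ℝ) ⌊y⌋₊]
  have key : |(pairCount β x : ℝ) - z1 * x - z2 * x ^ β| ≤ 8 * y := by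
    rw [hxβ]
    rw [abs_le] at *
    constructor <;> linarith [F1.1, F1.2, F2.1, F2.2, G1'.1, G1'.2, G2'.1, G2'.2]
  rw [Real.norm_of_nonneg hy0.le]
  refine le_of_eq_of_le ?_ key
  rw [← Real.norm_eq_abs, ← Complex.norm_real]
  push_cast
  rfl
end

section
/- Let β > 0 and let x, a, b be real numbers with a, b ≥ 1 and a·b = x. Then Σ_{(m,n) : m, n ≥ 1, m · n^{1/β} ≤ x} μ(m)μ(n) = Σ_{n ≤ a^β} μ(n)·M(x/n^{1/β}) + Σ_{m ≤ b} μ(m)·M((x/m)^β) − M(a^β)·M(b). -/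
open Filter Asymptotics ArithmeticFunction

theorem sum_floor_aux (y : ℝ) (N : ℕ) (h : ⌊y⌋₊ ≤ N) (g : ℕ → ℤ) :
    ∑ k ∈ Finset.Icc 1 ⌊y⌋₊, g k = ∑ k ∈ Finset.Icc 1 N, if (k : ℝ) ≤ y then g k else 0 := by
  rw [← Finset.sum_filter]
  apply Finset.sum_congr _ (fun _ _ => rfl)
  ext k
  simp only [Finset.mem_Icc, Finset.mem_filter]
  constructor
  · rintro ⟨h1, h2⟩
    exact ⟨⟨h1, h2.trans h⟩, (Nat.le_floor_iff' (by omega)).1 h2⟩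
  · rintro ⟨⟨h1, _⟩, h2⟩
    exact ⟨h1, Nat.le_floor h2⟩

theorem stmt12 (β : ℝ) (hβ : 0 < β) (x a b : ℝ) (ha : 1 ≤ a) (hb : 1 ≤ b)
    (hab : a * b = x) :
    MobPairSum β x
      = (∑ n ∈ Finset.Icc 1 ⌊a ^ β⌋₊, moebius n * Mob (x / (n : ℝ) ^ (1/β)))
        + (∑ m ∈ Finset.Icc 1 ⌊b⌋₊, moebius m * Mob ((x / (m : ℝ)) ^ β))
        - Mob (a ^ β) * Mob b := by
  classical
  have ha0 : 0 < a := by linarith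
  have hb0 : 0 < b := by linarith
  have hx0 : 0 < x := by rw [← hab]; positivity
  have hax : a ≤ x := by rw [← hab]; nlinarith
  have hbx : b ≤ x := by rw [← hab]; nlinarith
  have hone : ∀ n : ℕ, 1 ≤ n → (1 : ℝ) ≤ (n : ℝ) ^ (1/β) := fun n hn =>
    Real.one_le_rpow (by exact_mod_cast hn) (by positivity)
  -- the two ways of solving the defining inequality
  have hP1 : ∀ m n : ℕ, 1 ≤ n → ((m : ℝ) ≤ x / (n : ℝ) ^ (1/β) ↔ (m : ℝ) * (n : ℝ) ^ (1/β) ≤ x) :=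
    fun m n hn => le_div_iff₀ (by linarith [hone n hn])
  have hroot : ∀ (n : ℕ) (y : ℝ), 0 ≤ y → ((n : ℝ) ≤ y ^ β ↔ (n : ℝ) ^ (1/β) ≤ y) := by
    intro n y hy
    rw [one_div, Real.rpow_inv_le_iff_of_pos (Nat.cast_nonneg n) hy hβ]
  have hP2 : ∀ m n : ℕ, 1 ≤ m → ((n : ℝ) ≤ (x / (m : ℝ)) ^ β ↔ (m : ℝ) * (n : ℝ) ^ (1/β) ≤ x) := by
    intro m n hm
    have hm0 : (0 : ℝ) < m := by exact_mod_cast hm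
    rw [hroot n _ (by positivity), le_div_iff₀ hm0, mul_comm]
  have hxm : ∀ m : ℕ, 1 ≤ m → x / (m : ℝ) ≤ x := fun m hm =>
    div_le_self hx0.le (by exact_mod_cast hm)
  set X := ⌊x⌋₊ with hX
  set Y := ⌊x ^ β⌋₊ with hY
  have hL : MobPairSum β x = ∑ n ∈ Finset.Icc 1 Y, ∑ m ∈ Finset.Icc 1 X,
      if (m : ℝ) * (n : ℝ) ^ (1/β) ≤ x then moebius m * moebius n else 0 := by
    rw [Finset.sum_comm, ← Finset.sum_product', ← Finset.sum_filter]
    unfold MobPairSum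
    rw [← finsum_mem_coe_finset]
    apply finsum_mem_congr _ (fun _ _ => rfl)
    ext ⟨m, n⟩
    simp only [Set.mem_ofPred_eq, Finset.coe_filter, Finset.mem_product, Finset.mem_Icc]
    constructor
    · rintro ⟨hm, hn, h⟩
      refine ⟨⟨⟨hm, Nat.le_floor ?_⟩, hn, Nat.le_floor ?_⟩, h⟩
      · exact ((hP1 m n hn).2 h).trans (div_le_self hx0.le (hone n hn))
      · exact ((hP2 m n hm).2 h).trans
          (Real.rpow_le_rpow (by positivity) (hxm m hm) hβ.le)
    · rintro ⟨⟨⟨hm, _⟩, hn, _⟩, h⟩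
      exact ⟨hm, hn, h⟩
  have hAY : ⌊a ^ β⌋₊ ≤ Y := Nat.floor_mono (Real.rpow_le_rpow ha0.le hax hβ.le)
  have hBX : ⌊b⌋₊ ≤ X := Nat.floor_mono hbx
  have h1 : (∑ n ∈ Finset.Icc 1 ⌊a ^ β⌋₊, moebius n * Mob (x / (n : ℝ) ^ (1/β)))
      = ∑ n ∈ Finset.Icc 1 Y, ∑ m ∈ Finset.Icc 1 X,
        if (n : ℝ) ≤ a ^ β then
          (if (m : ℝ) * (n : ℝ) ^ (1/β) ≤ x then moebius m * moebius n else 0) else 0 := by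
    rw [sum_floor_aux _ Y hAY]
    apply Finset.sum_congr rfl
    intro n hn
    have hn1 := (Finset.mem_Icc.1 hn).1
    split_ifs
    · unfold Mob
      rw [sum_floor_aux _ X (Nat.floor_mono (div_le_self hx0.le (hone n hn1))), Finset.mul_sum]
      apply Finset.sum_congr rfl
      intro m _
      simp only [hP1 m n hn1, ite_mul, zero_mul, mul_comm (moebius n)]
    · simp
  have h2 : (∑ m ∈ Finset.Icc 1 ⌊b⌋₊, moebius m * Mob ((x / (m : ℝ)) ^ β))
      = ∑ n ∈ Finset.Icc 1 Y, ∑ m ∈ Finset.Icc 1 X,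
        if (m : ℝ) ≤ b then
          (if (m : ℝ) * (n : ℝ) ^ (1/β) ≤ x then moebius m * moebius n else 0) else 0 := by
    rw [sum_floor_aux _ X hBX, Finset.sum_comm]
    apply Finset.sum_congr rfl
    intro m hm
    have hm1 := (Finset.mem_Icc.1 hm).1
    split_ifs
    · unfold Mob
      rw [sum_floor_aux _ Y (Nat.floor_mono
        (Real.rpow_le_rpow (by positivity) (hxm m hm1) hβ.le)), Finset.mul_sum]
      apply Finset.sum_congr rfl
      intro n _
      simp only [hP2 m n hm1, mul_ite, mul_zero]
    · simp
  have h3 : Mob (a ^ β) * Mob b = ∑ n ∈ Finset.Icc 1 Y, ∑ m ∈ Finset.Icc 1 X,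
      if (n : ℝ) ≤ a ^ β then (if (m : ℝ) ≤ b then moebius m * moebius n else 0) else 0 := by
    unfold Mob
    rw [sum_floor_aux _ Y hAY, sum_floor_aux _ X hBX, Finset.sum_mul_sum]
    apply Finset.sum_congr rfl
    intro n _
    apply Finset.sum_congr rfl
    intro m _
    split_ifs <;> ring
  rw [hL, h1, h2, h3, ← Finset.sum_add_distrib, ← Finset.sum_sub_distrib]
  apply Finset.sum_congr rfl
  intro n hn
  rw [← Finset.sum_add_distrib, ← Finset.sum_sub_distrib]
  apply Finset.sum_congr rfl
  intro m hm
  have hn1 := hone n (Finset.mem_Icc.1 hn).1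
  have hA := hroot n a ha0.le
  have hboth : (n : ℝ) ≤ a ^ β → (m : ℝ) ≤ b → (m : ℝ) * (n : ℝ) ^ (1/β) ≤ x := by
    intro h h'
    rw [← hab, mul_comm a b]
    exact mul_le_mul h' (hA.1 h) (by linarith) hb0.le
  have hor : (m : ℝ) * (n : ℝ) ^ (1/β) ≤ x → ¬ (n : ℝ) ≤ a ^ β → (m : ℝ) ≤ b := by
    intro h h'
    by_contra hc
    rw [hA] at h'
    push Not at h' hc
    have : b * a < (m : ℝ) * (n : ℝ) ^ (1/β) := mul_lt_mul'' hc h' hb0.le ha0.le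
    linarith [mul_comm a b]
  by_cases c1 : (n : ℝ) ≤ a ^ β <;> by_cases c2 : (m : ℝ) ≤ b <;>
    by_cases c3 : (m : ℝ) * (n : ℝ) ^ (1/β) ≤ x <;> simp only [c1, c2, c3, if_true, if_false] <;>
    first
      | exact absurd (hboth c1 c2) c3
      | exact absurd (hor c3 c1) c2
      | ring
end

section
/- Assume that for every ε > 0, M(y) = O(y^{1/2+ε}) as y → ∞ (as holds under the Riemann Hypothesis). Fix β ∈ (1/2, 1). Then for every ε > 0, Σ_{(m,n) : m, n ≥ 1, m · n^{1/β} ≤ x} μ(m)μ(n) = O(x^{3β/(2(1+β)) + ε}) as x → ∞. -/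
open Filter Asymptotics ArithmeticFunction

theorem aux_sum_rpow (s : ℝ) (h0 : 0 < s) (h1 : s < 1) (N : ℕ) :
    ∑ m ∈ Finset.Icc 1 N, (m : ℝ) ^ (-s) ≤ (N : ℝ) ^ (1 - s) / (1 - s) := by
  have h1s : 0 < 1 - s := by linarith
  induction N with
  | zero => simp [Real.zero_rpow h1s.ne']
  | succ N ih =>
    rw [Finset.sum_Icc_succ_top (by omega)]
    refine (add_le_add_left ih _).trans ?_
    rw [le_div_iff₀ h1s, add_mul, div_mul_cancel₀ _ h1s.ne']
    have hA : (0:ℝ) < (N:ℝ) + 1 := by positivity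
    have hb := rpow_one_add_le_one_add_mul_self (s := -(1/((N:ℝ)+1))) (p := 1 - s)
      (by
        have : 1/((N:ℝ)+1) ≤ 1 := by
          rw [div_le_one hA]; linarith [Nat.cast_nonneg (α := ℝ) N]
        linarith) h1s.le (by linarith)
    have e1 : 1 + -(1/((N:ℝ)+1)) = (N:ℝ) / ((N:ℝ)+1) := by field_simp; ring
    rw [e1, Real.div_rpow (Nat.cast_nonneg N) hA.le, div_le_iff₀ (Real.rpow_pos_of_pos hA _)] at hb
    have e2 : ((N:ℝ)+1) ^ (1 - s) = ((N:ℝ)+1) * ((N:ℝ)+1) ^ (-s) := by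
      rw [sub_eq_add_neg, Real.rpow_add hA, Real.rpow_one]
    push_cast
    rw [e2] at hb ⊢
    refine (add_le_add_left hb _).trans (le_of_eq ?_)
    field_simp
    ring

theorem aux_Mob_trivial (t : ℝ) (ht : 0 ≤ t) : |(Mob t : ℝ)| ≤ t := by
  unfold Mob
  push_cast
  refine (Finset.abs_sum_le_sum_abs _ _).trans ?_
  have : ∀ k ∈ Finset.Icc 1 ⌊t⌋₊, |((moebius k : ℤ) : ℝ)| ≤ 1 := by
    intro k _
    exact_mod_cast abs_moebius_le_one
  refine (Finset.sum_le_sum this).trans ?_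
  simpa using Nat.floor_le ht

theorem aux_Mob_bound (h : ℝ) (hh : 0 < h)
    (hM : (fun y : ℝ => (Mob y : ℝ)) =O[atTop] fun y => y ^ h) :
    ∃ C : ℝ, 0 < C ∧ ∀ t : ℝ, 0 < t → |(Mob t : ℝ)| ≤ C * t ^ h := by
  obtain ⟨C, hC⟩ := hM.bound
  obtain ⟨T, hT⟩ := eventually_atTop.1 hC
  refine ⟨|C| + |T| + 1, by positivity, fun t ht => ?_⟩
  have hp : 0 < t ^ h := Real.rpow_pos_of_pos ht _
  rcases lt_or_ge t 1 with h1 | h1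
  · have : Mob t = 0 := by
      unfold Mob
      rw [Nat.floor_eq_zero.2 h1]; simp
    rw [this]; simp; positivity
  rcases le_or_gt T t with h2 | h2
  · have := hT t h2
    rw [Real.norm_eq_abs, Real.norm_eq_abs, abs_of_pos hp] at this
    refine this.trans ?_
    gcongr
    linarith [le_abs_self C, abs_nonneg T]
  · refine (aux_Mob_trivial t ht.le).trans ?_
    have h3 : 1 ≤ t ^ h := Real.one_le_rpow h1 hh.le
    nlinarith [le_abs_self T, abs_nonneg C, abs_nonneg T]

theorem aux_Mob_ite (K : ℕ) (t : ℝ) (ht : 0 ≤ t) (hK : ⌊t⌋₊ ≤ K) (P : ℕ → Prop)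
    [DecidablePred P] (hP : ∀ n, 0 < n → (P n ↔ (n : ℝ) ≤ t)) :
    ∑ n ∈ Finset.Icc 1 K, (if P n then moebius n else 0) = Mob t := by
  unfold Mob
  rw [← Finset.sum_filter]
  apply Finset.sum_congr _ (fun _ _ => rfl)
  ext n
  simp only [Finset.mem_filter, Finset.mem_Icc]
  constructor
  · rintro ⟨⟨a, b⟩, c⟩
    exact ⟨a, Nat.le_floor ((hP n a).1 c)⟩
  · rintro ⟨a, b⟩
    exact ⟨⟨a, b.trans hK⟩, (hP n a).2 ((Nat.le_floor_iff ht).1 b)⟩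

theorem aux_restrict (K N : ℕ) (hNK : N ≤ K) (g : ℕ → ℤ) :
    ∑ n ∈ Finset.Icc 1 K, (if n ≤ N then g n else 0) = ∑ n ∈ Finset.Icc 1 N, g n := by
  rw [← Finset.sum_filter]
  apply Finset.sum_congr _ (fun _ _ => rfl)
  ext n
  simp only [Finset.mem_filter, Finset.mem_Icc]
  omega

theorem aux_cond (β x : ℝ) (hβ : 0 < β) (hx : 0 < x) (m n : ℕ) (hm : 0 < m) :
    (m : ℝ) * (n : ℝ) ^ (1/β) ≤ x ↔ (n : ℝ) ≤ (x / m) ^ β := by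
  have hm' : (0:ℝ) < m := by exact_mod_cast hm
  rw [mul_comm, ← le_div_iff₀ hm', one_div]
  rw [Real.rpow_inv_le_iff_of_pos (Nat.cast_nonneg n) (by positivity) hβ]

open Classical in
theorem aux_hyperbola (β x y : ℝ) (hβ : 0 < β) (hβ1 : β < 1) (hy : 1 ≤ y)
    (hxy : x = y * y ^ (1/β)) :
    MobPairSum β x = ∑ m ∈ Finset.Icc 1 ⌊y⌋₊, moebius m * Mob ((x / m) ^ β)
      + ∑ n ∈ Finset.Icc 1 ⌊y⌋₊, moebius n * Mob (x / (n:ℝ) ^ (1/β)) - Mob y * Mob y := by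
  have hib : 1 ≤ 1/β := by rw [le_div_iff₀ hβ]; linarith
  have hib0 : 0 < 1/β := by linarith
  have hy0 : 0 < y := by linarith
  have hyp : 1 ≤ y ^ (1/β) := Real.one_le_rpow hy (by linarith)
  have hyx : y ≤ x := by rw [hxy]; nlinarith
  have hx1 : 1 ≤ x := hy.trans hyx
  have hx0 : 0 < x := by linarith
  set K := ⌊x⌋₊ with hK
  set N := ⌊y⌋₊ with hN
  have hNK : N ≤ K := Nat.floor_mono hyx
  let P : ℕ → ℕ → Prop := fun m n => (m : ℝ) * (n : ℝ) ^ (1/β) ≤ x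
  have step1 : MobPairSum β x = ∑ m ∈ Finset.Icc 1 K, ∑ n ∈ Finset.Icc 1 K,
      if P m n then moebius m * moebius n else 0 := by
    unfold MobPairSum
    rw [← Finset.sum_product', ← Finset.sum_filter]
    rw [← finsum_mem_coe_finset]
    apply finsum_mem_congr _ (fun _ _ => rfl)
    ext ⟨m, n⟩
    simp only [Set.mem_ofPred_eq, Finset.coe_filter, Finset.mem_product, Finset.mem_Icc, P]
    constructor
    · rintro ⟨hm, hn, h⟩
      have hm' : (1:ℝ) ≤ m := by exact_mod_cast hm
      have hn' : (1:ℝ) ≤ n := by exact_mod_cast hn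
      have h1 : (1:ℝ) ≤ (n:ℝ) ^ (1/β) := Real.one_le_rpow hn' hib0.le
      have h2 : (n:ℝ) ≤ (n:ℝ) ^ (1/β) := by
        simpa using Real.rpow_le_rpow_of_exponent_le hn' hib
      refine ⟨⟨⟨hm, Nat.le_floor ?_⟩, hn, Nat.le_floor ?_⟩, h⟩ <;> nlinarith
    · rintro ⟨⟨⟨hm, -⟩, hn, -⟩, h⟩
      exact ⟨hm, hn, h⟩
  have hpt : ∀ m n : ℕ, (if P m n then moebius m * moebius n else 0) =
      (if m ≤ N then (moebius m * if P m n then moebius n else 0) else 0)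
      + (if n ≤ N then (moebius n * if P m n then moebius m else 0) else 0)
      - (if m ≤ N then moebius m else 0) * (if n ≤ N then moebius n else 0) := by
    intro m n
    by_cases hm : m ≤ N
    · by_cases hn : n ≤ N
      · have hm' : (m:ℝ) ≤ y := (Nat.le_floor_iff hy0.le).1 hm
        have hn' : (n:ℝ) ≤ y := (Nat.le_floor_iff hy0.le).1 hn
        have : P m n := by
          show (m : ℝ) * (n : ℝ) ^ (1/β) ≤ x
          rw [hxy]
          gcongr
        simp only [hm, hn, this, if_true]; ring
      · simp [hm, hn]
    · by_cases hn : n ≤ N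
      · simp [hm, hn, mul_comm]
      · have hm' : y < m := (Nat.floor_lt hy0.le).1 (not_le.1 hm)
        have hn' : y < n := (Nat.floor_lt hy0.le).1 (not_le.1 hn)
        have : ¬ P m n := by
          show ¬ ((m : ℝ) * (n : ℝ) ^ (1/β) ≤ x)
          rw [hxy, not_le]
          have := Real.rpow_lt_rpow hy0.le hn' hib0
          exact mul_lt_mul'' hm' this hy0.le (by linarith)
        simp [hm, hn, this]
  rw [step1]
  simp_rw [hpt, Finset.sum_sub_distrib, Finset.sum_add_distrib]
  congr 1
  · congr 1
    · have : ∀ m ∈ Finset.Icc 1 K, (∑ n ∈ Finset.Icc 1 K,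
          if m ≤ N then (moebius m * if P m n then moebius n else 0) else 0) =
          if m ≤ N then moebius m * Mob ((x / m) ^ β) else 0 := by
        intro m hm
        split_ifs
        · rw [← Finset.mul_sum]
          congr 1
          have hm1 : 1 ≤ m := (Finset.mem_Icc.1 hm).1
          have hm1' : (1:ℝ) ≤ m := by exact_mod_cast hm1
          have hmx : (m:ℝ) ≤ x := (Nat.le_floor_iff hx0.le).1 (Finset.mem_Icc.1 hm).2
          apply aux_Mob_ite _ _ (by positivity)
          · apply Nat.floor_mono
            have h1 : 1 ≤ x / m := by rw [le_div_iff₀ (by linarith)]; linarith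
            calc (x / m) ^ β ≤ (x/m) ^ (1:ℝ) := Real.rpow_le_rpow_of_exponent_le h1 hβ1.le
              _ = x / m := Real.rpow_one _
              _ ≤ x := div_le_self hx0.le hm1'
          · intro n _
            exact aux_cond β x hβ hx0 m n hm1
        · simp
      rw [Finset.sum_congr rfl this, aux_restrict K N hNK]
    · rw [Finset.sum_comm]
      have : ∀ n ∈ Finset.Icc 1 K, (∑ m ∈ Finset.Icc 1 K,
          if n ≤ N then (moebius n * if P m n then moebius m else 0) else 0) =
          if n ≤ N then moebius n * Mob (x / (n:ℝ) ^ (1/β)) else 0 := by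
        intro n hn
        split_ifs
        · rw [← Finset.mul_sum]
          congr 1
          have hn1 : 1 ≤ n := (Finset.mem_Icc.1 hn).1
          have hn1' : (1:ℝ) ≤ n := by exact_mod_cast hn1
          have h1 : (1:ℝ) ≤ (n:ℝ) ^ (1/β) := Real.one_le_rpow hn1' hib0.le
          apply aux_Mob_ite _ _ (by positivity)
          · apply Nat.floor_mono
            exact div_le_self hx0.le h1
          · intro m _
            rw [le_div_iff₀ (by linarith)]
        · simp
      rw [Finset.sum_congr rfl this, aux_restrict K N hNK]
  · rw [← Finset.sum_mul_sum, aux_restrict K N hNK]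
    rfl

theorem aux_sum_bound (N : ℕ) (y A s : ℝ) (hNy : (N:ℝ) ≤ y) (hA : 0 ≤ A) (h0 : 0 < s) (h1 : s < 1)
    (g : ℕ → ℤ) (hg : ∀ m, 0 < m → |(g m : ℝ)| ≤ A * (m:ℝ) ^ (-s)) :
    |((∑ m ∈ Finset.Icc 1 N, moebius m * g m : ℤ) : ℝ)| ≤ A * (y ^ (1 - s) / (1 - s)) := by
  have h1s : 0 < 1 - s := by linarith
  push_cast
  refine (Finset.abs_sum_le_sum_abs _ _).trans ?_
  calc ∑ m ∈ Finset.Icc 1 N, |((moebius m : ℤ) : ℝ) * (g m : ℝ)|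
      ≤ ∑ m ∈ Finset.Icc 1 N, A * (m:ℝ) ^ (-s) := by
        apply Finset.sum_le_sum
        intro m hm
        have : |((moebius m : ℤ) : ℝ)| ≤ 1 := by exact_mod_cast abs_moebius_le_one
        rw [abs_mul]
        have h2 := hg m (Finset.mem_Icc.1 hm).1
        nlinarith [abs_nonneg (g m : ℝ)]
    _ = A * ∑ m ∈ Finset.Icc 1 N, (m:ℝ) ^ (-s) := by rw [Finset.mul_sum]
    _ ≤ A * ((N:ℝ) ^ (1 - s) / (1 - s)) := by
        gcongr
        exact aux_sum_rpow s h0 h1 N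
    _ ≤ _ := by gcongr

theorem aux_main (β h C x y : ℝ) (hβ : 1/2 < β) (hβ1 : β < 1) (hy : 1 ≤ y)
    (hxy : x = y * y ^ (1/β)) (hh : 0 < h) (hhβ : h < β) (hC : 0 < C)
    (hM : ∀ t : ℝ, 0 < t → |(Mob t : ℝ)| ≤ C * t ^ h) :
    |(MobPairSum β x : ℝ)| ≤ (C / (1 - β * h) + C / (1 - h / β) + C * C) * y ^ (1 + h) := by
  have hβ0 : 0 < β := by linarith
  have hy0 : 0 < y := by linarith
  have hxy' : x = y ^ (1 + 1/β) := by rw [hxy, Real.rpow_add hy0, Real.rpow_one]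
  have hx0 : 0 < x := by rw [hxy']; positivity
  have hs1 : h / β < 1 := by rw [div_lt_one hβ0]; exact hhβ
  have hs2 : β * h < 1 := by nlinarith
  have hNy : ((⌊y⌋₊ : ℕ) : ℝ) ≤ y := Nat.floor_le hy0.le
  rw [aux_hyperbola β x y hβ0 hβ1 hy hxy]
  have b1 := aux_sum_bound ⌊y⌋₊ y (C * x ^ (β * h)) (β * h) hNy (by positivity) (by positivity) hs2
    (fun m => Mob ((x / m) ^ β)) (by
      intro m hm
      have hm' : (0:ℝ) < m := by exact_mod_cast hm
      refine (hM _ (by positivity)).trans (le_of_eq ?_)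
      rw [← Real.rpow_mul (by positivity), Real.div_rpow hx0.le hm'.le, Real.rpow_neg hm'.le]
      ring)
  have b2 := aux_sum_bound ⌊y⌋₊ y (C * x ^ h) (h / β) hNy (by positivity) (by positivity) hs1
    (fun n => Mob (x / (n:ℝ) ^ (1/β))) (by
      intro m hm
      have hm' : (0:ℝ) < m := by exact_mod_cast hm
      refine (hM _ (by positivity)).trans (le_of_eq ?_)
      rw [Real.div_rpow hx0.le (by positivity), ← Real.rpow_mul hm'.le, Real.rpow_neg hm'.le,
        show 1 / β * h = h / β by ring]
      ring)
  have e1 : x ^ (β * h) * y ^ (1 - β * h) = y ^ (1 + h) := by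
    rw [hxy', ← Real.rpow_mul hy0.le, ← Real.rpow_add hy0]
    congr 1; field_simp; ring
  have e2 : x ^ h * y ^ (1 - h / β) = y ^ (1 + h) := by
    rw [hxy', ← Real.rpow_mul hy0.le, ← Real.rpow_add hy0]
    congr 1; field_simp; ring
  have b1' : C * x ^ (β * h) * (y ^ (1 - β * h) / (1 - β * h)) = C / (1 - β * h) * y ^ (1 + h) := by
    rw [← e1]; ring
  have b2' : C * x ^ h * (y ^ (1 - h / β) / (1 - h / β)) = C / (1 - h / β) * y ^ (1 + h) := by
    rw [← e2]; ring
  rw [b1'] at b1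
  rw [b2'] at b2
  have b3 : |((Mob y * Mob y : ℤ) : ℝ)| ≤ C * C * y ^ (1 + h) := by
    push_cast
    rw [abs_mul]
    calc |(Mob y : ℝ)| * |(Mob y : ℝ)| ≤ (C * y ^ h) * (C * y ^ h) := by
          gcongr <;> exact hM y hy0
      _ = C * C * y ^ (h + h) := by rw [Real.rpow_add hy0]; ring
      _ ≤ C * C * y ^ (1 + h) := by
          gcongr
          · linarith
  rw [Int.cast_sub, Int.cast_add]
  refine (abs_sub _ _).trans ?_
  refine (add_le_add_left (abs_add_le _ _) _).trans ?_
  linarith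

theorem stmt13
    (hM : ∀ ε > 0, (fun y : ℝ => (Mob y : ℝ)) =O[atTop] fun y => y ^ ((1:ℝ)/2 + ε))
    (β : ℝ) (hβ : β ∈ Set.Ioo (1/2 : ℝ) 1) :
    ∀ ε > 0, (fun x : ℝ => (MobPairSum β x : ℝ))
      =O[atTop] fun x => x ^ (3 * β / (2 * (1 + β)) + ε) := by
  intro ε hε
  obtain ⟨h1, h2⟩ := hβ
  have hβ0 : 0 < β := by linarith
  obtain ⟨δ, hδ0, hδ⟩ : ∃ δ : ℝ, 0 < δ ∧ δ < min ε (β - 1/2) :=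
    exists_between (lt_min hε (by linarith))
  have hδ1 : δ < ε := hδ.trans_le (min_le_left _ _)
  have hδ2 : δ < β - 1/2 := hδ.trans_le (min_le_right _ _)
  obtain ⟨C, hC, hb⟩ := aux_Mob_bound (1/2 + δ) (by linarith) (hM δ hδ0)
  have hden : 0 < 1 + β := by linarith
  refine IsBigO.of_bound
    (C / (1 - β * (1/2 + δ)) + C / (1 - (1/2 + δ) / β) + C * C) ?_
  filter_upwards [eventually_ge_atTop 1] with x hx
  have hx0 : 0 < x := by linarith
  have hc1 : 0 < 1 - β * (1/2 + δ) := by nlinarith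
  have hc2 : 0 < 1 - (1/2 + δ) / β := by
    rw [sub_pos, div_lt_one hβ0]; linarith
  have key := aux_main β (1/2 + δ) C x (x ^ (β / (1 + β))) h1 h2
    (Real.one_le_rpow hx (by positivity))
    (by
      rw [← Real.rpow_mul hx0.le, ← Real.rpow_add hx0,
        show β / (1 + β) + β / (1 + β) * (1 / β) = 1 by field_simp; ring, Real.rpow_one])
    (by linarith) (by linarith) hC hb
  rw [Real.norm_eq_abs, Real.norm_eq_abs, abs_of_pos (Real.rpow_pos_of_pos hx0 _)]
  refine key.trans ?_
  rw [← Real.rpow_mul hx0.le]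
  gcongr
  · have e : β / (1 + β) * (1 + (1/2 + δ)) = 3 * β / (2 * (1 + β)) + β / (1 + β) * δ := by
      field_simp; ring
    rw [e]
    have : β / (1 + β) ≤ 1 := by rw [div_le_one hden]; linarith
    nlinarith
end
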